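/- Let K be a number field of degree d with r_1 real embeddings, regulator R_K, and let w_K denote the number of roots of unity contained in K. Then R_K / w_K ≥ 0.0031 · exp(0.241·d + 0.497·r_1). -/

import Mathlib

section ModP1
open MeasureTheory Set Filter Topology

noncomputable section PoissonMulti

variable {ι : Type*} [Fintype ι]

/-- The additive character of a vector of integers. -/
def zchar (k : ι → ℤ) (x : ι → ℝ) : ℂ :=
  Complex.exp (-2 * Real.pi * Complex.I * ∑ i, (k i : ℂ) * (x i : ℂ))

/-- integer vectors as real vectors -/
def zv (m : ι → ℤ) : ι → ℝ := fun i => (m i : ℝ)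

lemma mFourier_neg_eq_zchar (k : ι → ℤ) (x : ι → ℝ) :
    UnitAddTorus.mFourier (-k) (fun i => (x i : UnitAddCircle)) = zchar k x := by
  simp only [UnitAddTorus.mFourier, ContinuousMap.coe_mk, fourier_coe_apply, zchar,
    ← Complex.exp_sum, Finset.mul_sum]
  congr 1
  refine Finset.sum_congr rfl fun i _ => ?_
  simp only [Pi.neg_apply]; push_cast; ring

lemma zchar_add_int (k m : ι → ℤ) (x : ι → ℝ) : zchar k (x + zv m) = zchar k x := by
  unfold zchar
  rw [show (-2 * Real.pi * Complex.I * ∑ i, (k i : ℂ) * (((x + zv m) i : ℝ) : ℂ))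
    = (-2 * Real.pi * Complex.I * ∑ i, (k i : ℂ) * (x i : ℂ))
      + ((-∑ i, k i * m i : ℤ) : ℂ) * (2 * Real.pi * Complex.I) by
    simp only [Pi.add_apply, zv]
    push_cast
    simp only [mul_add, Finset.sum_add_distrib]
    ring, Complex.exp_add, Complex.exp_int_mul_two_pi_mul_I, mul_one]

lemma norm_zchar (k : ι → ℤ) (x : ι → ℝ) : ‖zchar k x‖ = 1 := by
  unfold zchar
  rw [show (-2 * Real.pi * Complex.I * ∑ i, (k i : ℂ) * (x i : ℂ))
    = ((-2 * Real.pi * ∑ i, (k i : ℝ) * (x i : ℝ) : ℝ) : ℂ) * Complex.I by push_cast; ring]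
  exact Complex.norm_exp_ofReal_mul_I _

lemma continuous_zchar (k : ι → ℤ) : Continuous (zchar k) := by
  unfold zchar; fun_prop

theorem poisson_multi (f : (ι → ℝ) → ℂ) (hc : Continuous f)
    (hb : ∀ R : ℝ, ∃ B : (ι → ℤ) → ℝ, Summable B ∧
      ∀ m x, ‖x‖ < R → ‖f (x + zv m)‖ ≤ B m)
    (hIntg : Integrable f)
    (hs : Summable fun k : ι → ℤ => ∫ x, zchar k x * f x) :
    ∑' m : ι → ℤ, f (zv m) = ∑' k : ι → ℤ, ∫ x, zchar k x * f x := by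
  classical
  set P : (ι → ℝ) → ℂ := fun x => ∑' m : ι → ℤ, f (x + zv m) with hP
  have hPc : Continuous P := by
    rw [continuous_iff_continuousAt]
    intro x
    obtain ⟨B, hB, hB'⟩ := hb (‖x‖ + 1)
    have : ContinuousOn P {y | ‖y‖ < ‖x‖ + 1} := by
      refine continuousOn_tsum (fun m => ?_) hB (fun m y hy => hB' m y hy)
      exact (hc.comp (continuous_id.add continuous_const)).continuousOn
    exact this.continuousAt ((isOpen_lt continuous_norm continuous_const).mem_nhds (by simp))
  have hper : ∀ (x : ι → ℝ) (n : ι → ℤ), P (x + zv n) = P x := by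
    intro x n
    simp only [hP]
    rw [← (Equiv.addRight n).tsum_eq (fun m => f (x + zv m))]
    refine tsum_congr fun m => ?_
    congr 1; ext i; simp [zv]; ring
  let π : (ι → ℝ) → UnitAddTorus ι := Pi.map (fun _ => ((↑) : ℝ → UnitAddCircle))
  have hπ : IsOpenQuotientMap π :=
    IsOpenQuotientMap.piMap fun _ => QuotientAddGroup.isOpenQuotientMap_mk
  let sec : UnitAddTorus ι → (ι → ℝ) := fun q i => (AddCircle.equivIoc 1 0 (q i)).1
  let F0 : UnitAddTorus ι → ℂ := fun q => P (sec q)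
  have hF0 : ∀ x, F0 (π x) = P x := by
    intro x
    have : ∀ i, ∃ n : ℤ, (AddCircle.equivIoc 1 0 (π x i)).1 = x i + n := by
      intro i
      have h1 : (((AddCircle.equivIoc (1:ℝ) 0 (π x i)).1 : ℝ) : UnitAddCircle) = (x i : UnitAddCircle) :=
        (AddCircle.equivIoc (1:ℝ) 0).symm_apply_apply (π x i)
      have h2 := (AddCircle.coe_eq_coe_iff_of_mem_Ico (p := (1:ℝ)) (a := 0) (x := 0) (y := 0))
      rw [← sub_eq_zero, ← AddCircle.coe_sub, AddCircle.coe_eq_zero_iff] at h1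
      obtain ⟨n, hn⟩ := h1
      refine ⟨n, ?_⟩
      simp at hn
      linarith
    choose n hn using this
    have : sec (π x) = x + zv n := by ext i; exact hn i
    simp only [F0, this, hper]
  let F : C(UnitAddTorus ι, ℂ) := ⟨F0, by
    rw [← hπ.continuous_comp_iff]
    convert hPc using 1
    exact funext hF0⟩
  have hmeas : ∀ m : ι → ℤ, MeasurableSet {x : ι → ℝ | ∀ i, x i ∈ Ioc ((m i : ℤ) : ℝ) (m i + 1)} :=
    fun m => MeasurableSet.univ_pi' fun i => measurableSet_Ioc
  have hcoef : ∀ k, UnitAddTorus.mFourierCoeff F k = ∫ x, zchar k x * f x := by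
    intro k
    rw [UnitAddTorus.mFourierCoeff_eq_integral F k 0]
    have e1 : ∀ x : ι → ℝ, UnitAddTorus.mFourier (-k) (fun i => (x i : UnitAddCircle)) •
        F (fun i => (x i : UnitAddCircle)) = ∑' m : ι → ℤ, zchar k (x + zv m) * f (x + zv m) := by
      intro x
      rw [mFourier_neg_eq_zchar]
      have : F (fun i => (x i : UnitAddCircle)) = P x := hF0 x
      rw [this, smul_eq_mul, hP, ← tsum_mul_left]
      simp_rw [zchar_add_int]
    simp_rw [e1]
    set C : Set (ι → ℝ) := {x : ι → ℝ | ∀ i, x i ∈ Ioc ((0 : ι → ℝ) i) ((0 : ι → ℝ) i + 1)} with hC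
    obtain ⟨B, hB, hB'⟩ := hb 2
    have hCm : MeasurableSet C := MeasurableSet.univ_pi' fun i => measurableSet_Ioc
    have hCn : ∀ x ∈ C, ‖x‖ < 2 := by
      intro x hx
      rw [pi_norm_lt_iff (by norm_num)]
      intro i
      have := hx i
      simp only [Pi.zero_apply, zero_add, mem_Ioc] at this
      rw [Real.norm_eq_abs, abs_lt]; constructor <;> linarith
    have hCvol : volume C ≠ ⊤ := by
      have : C ⊆ Metric.ball 0 2 := fun x hx => by simpa using hCn x hx
      exact ((measure_mono this).trans_lt measure_ball_lt_top).ne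
    have hval : ∀ m, ∫ x in {x : ι → ℝ | ∀ i, x i ∈ Ioc ((m i : ℤ) : ℝ) (m i + 1)}, zchar k x * f x
        = ∫ x in C, zchar k (x + zv m) * f (x + zv m) := by
      intro m
      have hmp := measurePreserving_add_right (volume : Measure (ι → ℝ)) (zv m)
      have := hmp.setIntegral_preimage_emb (measurableEmbedding_addRight (zv m))
        (fun x => zchar k x * f x) {x : ι → ℝ | ∀ i, x i ∈ Ioc ((m i : ℤ) : ℝ) (m i + 1)}
      rw [← this]
      congr 2
      ext x
      simp only [hC, mem_preimage, mem_setOf_eq, Pi.add_apply, zv, mem_Ioc, Pi.zero_apply]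
      refine forall_congr' fun i => ?_
      constructor <;> rintro ⟨h1, h2⟩ <;> constructor <;> linarith
    have hU : (⋃ m : ι → ℤ, {x : ι → ℝ | ∀ i, x i ∈ Ioc ((m i : ℤ) : ℝ) (m i + 1)}) = univ := by
      rw [eq_univ_iff_forall]
      intro x
      rw [mem_iUnion]
      refine ⟨fun i => ⌈x i⌉ - 1, fun i => ⟨?_, ?_⟩⟩
      · push_cast; linarith [Int.ceil_lt_add_one (x i)]
      · push_cast; linarith [Int.le_ceil (x i)]
    have hdisj : Pairwise (Function.onFun Disjoint
        fun m : ι → ℤ => {x : ι → ℝ | ∀ i, x i ∈ Ioc ((m i : ℤ) : ℝ) (m i + 1)}) := by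
      intro m n hmn
      rw [Function.onFun, Set.disjoint_left]
      intro x hx hy
      apply hmn
      ext i
      have h1 := hx i
      have h2 := hy i
      simp only [mem_Ioc] at h1 h2
      have h3 : (m i : ℝ) < n i + 1 := by linarith
      have h4 : (n i : ℝ) < m i + 1 := by linarith
      have h5 : m i < n i + 1 := by exact_mod_cast h3
      have h6 : n i < m i + 1 := by exact_mod_cast h4
      omega
    have hIntg' : Integrable (fun x => zchar k x * f x) := by
      refine hIntg.mono ((continuous_zchar k).mul hc).aestronglyMeasurable ?_
      filter_upwards with x
      rw [norm_mul, norm_zchar, one_mul]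
    have hsum := hasSum_integral_iUnion hmeas hdisj (f := fun x => zchar k x * f x) (μ := volume)
      hIntg'.integrableOn
    rw [hU, setIntegral_univ] at hsum
    rw [← hsum.tsum_eq]
    simp_rw [hval]
    have hbm : ∀ m, ∀ᵐ x ∂(volume.restrict C), ‖zchar k (x + zv m) * f (x + zv m)‖ ≤ B m := by
      intro m
      filter_upwards [ae_restrict_mem hCm] with x hx
      rw [norm_mul, norm_zchar, one_mul]
      exact hB' m x (hCn x hx)
    have hcontm : ∀ m, Continuous (fun x : ι → ℝ => zchar k (x + zv m) * f (x + zv m)) := by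
      intro m
      exact ((continuous_zchar k).comp (continuous_id.add continuous_const)).mul
        (hc.comp (continuous_id.add continuous_const))
    haveI : IsFiniteMeasure (volume.restrict C) := ⟨by simpa using hCvol.lt_top⟩
    have hI : ∀ m, Integrable (fun x : ι → ℝ => zchar k (x + zv m) * f (x + zv m))
        (volume.restrict C) := fun m =>
      Integrable.of_bound (hcontm m).aestronglyMeasurable (B m) (hbm m)
    refine (integral_tsum_of_summable_integral_norm hI ?_).symm
    refine Summable.of_nonneg_of_le (fun m => integral_nonneg fun x => norm_nonneg _) (fun m => ?_)
      (hB.mul_right ((volume.restrict C).real univ))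
    calc ∫ x in C, ‖zchar k (x + zv m) * f (x + zv m)‖ ≤ ∫ x in C, B m :=
          integral_mono_ae (hI m).norm (integrable_const _) (hbm m)
      _ = B m * (volume.restrict C).real univ := by
          rw [integral_const, smul_eq_mul, mul_comm]
  have hs' : Summable (UnitAddTorus.mFourierCoeff F) := by
    convert hs using 1; exact funext hcoef
  have := (UnitAddTorus.hasSum_mFourier_series_apply_of_summable hs' (π 0)).tsum_eq
  have hF : F (π 0) = ∑' m : ι → ℤ, f (zv m) := by
    change F0 (π 0) = _
    rw [hF0]; simp [hP]
  rw [← hF, ← this]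
  refine tsum_congr fun k => ?_
  rw [hcoef]
  have : UnitAddTorus.mFourier k (π 0) = 1 := by
    simp [UnitAddTorus.mFourier, π, Pi.map]
  rw [this]; simp

end PoissonMulti

end ModP1

section ModP2
open MeasureTheory Set Filter Topology

noncomputable section ThetaMulti

variable {ι : Type*} [Fintype ι]

lemma summable_gauss_int {a : ℝ} (ha : 0 < a) : Summable fun n : ℤ => Real.exp (-a * (n:ℝ)^2) := by
  have h : Summable fun n : ℤ => ‖jacobiTheta₂_term n 0 (Complex.I * (a / Real.pi : ℝ))‖ := by
    apply Summable.norm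
    rw [summable_jacobiTheta₂_term_iff]
    simp; positivity
  refine h.congr fun n => ?_
  rw [norm_jacobiTheta₂_term]
  simp
  field_simp

lemma summable_gauss_multi {a : ℝ} (ha : 0 < a) :
    Summable fun m : ι → ℤ => Real.exp (-a * ∑ i, (zv m i)^2) := by
  have h1 : Integrable (fun n : ℤ => Real.exp (-a * (n:ℝ)^2)) (Measure.count) := by
    rw [integrable_count_iff]
    exact (summable_gauss_int ha).norm
  have h2 := Integrable.fintype_prod (ι := ι) (fun (_ : ι) => h1)
  have h3 : Measure.pi (fun _ : ι => (Measure.count : Measure ℤ)) = Measure.count := by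
    apply Measure.ext_of_singleton
    intro f
    simp
  rw [h3, integrable_count_iff] at h2
  refine (h2.of_norm).congr fun m => ?_
  simp only [zv, Finset.mul_sum, Real.exp_sum]

/-- Real quadratic form attached to a matrix -/
def qf (B : Matrix ι ι ℝ) (x : ι → ℝ) : ℝ := ∑ i, (B.mulVec x i)^2

lemma continuous_qf (B : Matrix ι ι ℝ) : Continuous (qf B) := by
  unfold qf Matrix.mulVec dotProduct; fun_prop

lemma qf_lower (B C : Matrix ι ι ℝ) [DecidableEq ι] (h : C.transpose * B = 1) :
    ∃ c > 0, ∀ x, c * ∑ i, (x i)^2 ≤ qf B x := by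
  set D : ℝ := ∑ i, ∑ j, (C.transpose i j)^2 + 1 with hD
  have hD0 : 0 < D := by positivity
  refine ⟨D⁻¹, by positivity, fun x => ?_⟩
  rw [inv_mul_le_iff₀ hD0]
  have hx : x = C.transpose.mulVec (B.mulVec x) := by simp [h]
  calc ∑ i, (x i)^2 = ∑ i, (C.transpose.mulVec (B.mulVec x) i)^2 := by rw [← hx]
    _ ≤ ∑ i, (∑ j, (C.transpose i j)^2) * ∑ j, (B.mulVec x j)^2 := by
        refine Finset.sum_le_sum fun i _ => ?_
        exact Finset.sum_mul_sq_le_sq_mul_sq _ _ _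
    _ = (∑ i, ∑ j, (C.transpose i j)^2) * qf B x := by rw [← Finset.sum_mul]; rfl
    _ ≤ D * qf B x := by
        have : 0 ≤ qf B x := by unfold qf; positivity
        gcongr; rw [hD]; linarith

lemma summable_qf (B C : Matrix ι ι ℝ) [DecidableEq ι] (h : C.transpose * B = 1) :
    Summable fun m : ι → ℤ => Real.exp (-Real.pi * qf B (zv m)) := by
  obtain ⟨c, hc, hb⟩ := qf_lower B C h
  refine Summable.of_nonneg_of_le (fun _ => by positivity) (fun m => ?_)
    (summable_gauss_multi (ι := ι) (a := Real.pi * c) (by positivity))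
  apply Real.exp_le_exp.2
  have := mul_le_mul_of_nonneg_left (hb (zv m)) Real.pi_pos.le
  linarith

lemma integral_qf (B C : Matrix ι ι ℝ) [DecidableEq ι] (h : C.transpose * B = 1) (k : ι → ℤ) :
    ∫ x : ι → ℝ, zchar k x * (Real.exp (-Real.pi * qf B x) : ℂ)
      = (|B.det|⁻¹ : ℝ) * (Real.exp (-Real.pi * qf C (zv k)) : ℂ) := by
  have hdet : B.det ≠ 0 := by
    intro h0
    have := congrArg Matrix.det h
    simp [h0] at this
  have hinj : Function.Injective (Matrix.toLin' B) := by
    intro x y hxy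
    have := congrArg (C.transpose.mulVec) hxy
    simpa [h] using this
  set F : (ι → ℝ) → ℂ := fun y => Complex.exp (-Real.pi * ∑ i, (y i : ℂ)^2
    + ∑ i, (-2 * Real.pi * Complex.I * (C.mulVec (zv k) i : ℂ)) * y i) with hF
  have hFB : ∀ x, zchar k x * (Real.exp (-Real.pi * qf B x) : ℂ) = F (Matrix.toLin' B x) := by
    intro x
    have e1 : ∑ i, zv k i * x i = ∑ i, C.mulVec (zv k) i * B.mulVec x i := by
      have : dotProduct (C.mulVec (zv k)) (B.mulVec x) = dotProduct (zv k) x := by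
        rw [← Matrix.vecMul_transpose, ← Matrix.dotProduct_mulVec, Matrix.mulVec_mulVec, h,
          Matrix.one_mulVec]
      exact this.symm
    have e2 : ∑ i, (k i : ℂ) * (x i : ℂ) =
        ∑ i, (C.mulVec (zv k) i : ℂ) * (B.mulVec x i : ℂ) := by
      have := congrArg (fun r : ℝ => (r : ℂ)) e1
      push_cast [zv] at this
      exact_mod_cast this
    simp only [zchar, hF, e2, Complex.ofReal_exp, ← Complex.exp_add, qf, Matrix.toLin'_apply]
    push_cast
    congr 1
    simp only [mul_assoc, ← Finset.mul_sum]
    ring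
  simp_rw [hFB]
  have hmap := Real.map_matrix_volume_pi_eq_smul_volume_pi hdet
  have hFc : Continuous F := by rw [hF]; fun_prop
  have hme : AEMeasurable (Matrix.toLin' B) (volume : Measure (ι → ℝ)) :=
    (LinearMap.continuous_of_finiteDimensional _).aemeasurable
  rw [← integral_map hme hFc.aestronglyMeasurable, hmap, integral_smul_measure,
    hF, GaussianFourier.integral_cexp_neg_mul_sum_add (by simpa using Real.pi_pos)]
  have hp : (Real.pi : ℂ) ≠ 0 := by exact_mod_cast Real.pi_ne_zero
  rw [div_self hp, Complex.one_cpow, one_mul, abs_inv, ENNReal.toReal_ofReal (by positivity),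
    Complex.real_smul, Complex.ofReal_exp]
  congr 2
  simp only [mul_pow, Complex.I_sq, qf]
  push_cast
  rw [← Finset.mul_sum]
  field_simp
  ring

theorem theta_poisson [DecidableEq ι] (B C : Matrix ι ι ℝ) (h : C.transpose * B = 1) :
    ∑' m : ι → ℤ, Real.exp (-Real.pi * qf B (zv m)) =
      |B.det|⁻¹ * ∑' k : ι → ℤ, Real.exp (-Real.pi * qf C (zv k)) := by
  have h' : B.transpose * C = 1 := by
    have := congrArg Matrix.transpose h
    simpa using this
  obtain ⟨c, hc, hb⟩ := qf_lower B C h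
  have hq := continuous_qf B
  have key := poisson_multi (ι := ι) (fun x => (Real.exp (-Real.pi * qf B x) : ℂ)) (by fun_prop)
    ?_ ?_ ?_
  · simp_rw [integral_qf B C h, tsum_mul_left] at key
    have : ((∑' m : ι → ℤ, Real.exp (-Real.pi * qf B (zv m)) : ℝ) : ℂ) =
      ((|B.det|⁻¹ * ∑' k : ι → ℤ, Real.exp (-Real.pi * qf C (zv k)) : ℝ) : ℂ) := by
      rw [Complex.ofReal_tsum, Complex.ofReal_mul, Complex.ofReal_tsum]
      exact key
    exact_mod_cast this
  · intro R
    refine ⟨fun m => Real.exp (Real.pi * c * (Fintype.card ι * R^2)) *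
      Real.exp (-(Real.pi * c / 2) * ∑ i, (zv m i)^2),
      (summable_gauss_multi (by positivity)).mul_left _, fun m x hx => ?_⟩
    rw [Complex.norm_real, Real.norm_of_nonneg (by positivity)]
    beta_reduce
    rw [← Real.exp_add]
    apply Real.exp_le_exp.2
    have h1 := hb (x + zv m)
    have h2 : ∑ i, (zv m i)^2 ≤ 2 * ∑ i, ((x + zv m) i)^2 + 2 * (Fintype.card ι * R^2) := by
      have : ∀ i ∈ Finset.univ, (zv m i)^2 ≤ 2 * ((x + zv m) i)^2 + 2 * R^2 := by
        intro i _
        have hxi : |x i| ≤ R := (norm_le_pi_norm x i).trans hx.le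
        have : (x i)^2 ≤ R^2 := sq_le_sq' (abs_le.1 hxi).1 (abs_le.1 hxi).2
        simp only [Pi.add_apply]
        nlinarith [sq_nonneg (2 * x i + zv m i)]
      refine (Finset.sum_le_sum this).trans ?_
      rw [Finset.sum_add_distrib, Finset.mul_sum]
      simp; linarith
    have hpi := Real.pi_pos
    have h3 : c * ∑ i, (zv m i)^2 ≤ 2 * qf B (x + zv m) + 2 * (c * (Fintype.card ι * R^2)) := by
      have := mul_le_mul_of_nonneg_left h2 hc.le
      linarith
    have := mul_le_mul_of_nonneg_left h3 hpi.le
    linarith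
  · have hg : Integrable fun x : ι → ℝ => (Real.exp (-(Real.pi * c) * ∑ i, (x i)^2)) := by
      have := Integrable.fintype_prod (ι := ι) (μ := fun _ => (volume : Measure ℝ))
        (f := fun _ x => Real.exp (-(Real.pi * c) * x^2)) (fun _ => integrable_exp_neg_mul_sq (by positivity))
      refine this.congr (ae_of_all _ fun x => ?_)
      simp only [Finset.mul_sum, Real.exp_sum]
    refine Integrable.mono' hg (Continuous.aestronglyMeasurable (by fun_prop)) (ae_of_all _ fun x => ?_)
    rw [Complex.norm_real, Real.norm_of_nonneg (by positivity)]
    apply Real.exp_le_exp.2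
    have := mul_le_mul_of_nonneg_left (hb x) Real.pi_pos.le
    linarith
  · simp_rw [integral_qf B C h]
    apply Summable.mul_left
    have := summable_qf C B h'
    exact_mod_cast this

end ThetaMulti

end ModP2

section ModP3
open MeasureTheory Set Filter Topology NumberField

noncomputable section ThetaK

variable (K : Type*) [Field K] [NumberField K]

/-- conjugation as a permutation of the embeddings -/
def conjPerm : Equiv.Perm (K →+* ℂ) :=
  Function.Involutive.toPerm (ComplexEmbedding.conjugate) (ComplexEmbedding.involutive_conjugate K)

variable {K}

lemma sum_conj_antisymm (f : (K →+* ℂ) → ℝ) (hf : ∀ σ, f (ComplexEmbedding.conjugate σ) = - f σ) :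
    ∑ σ, f σ = 0 := by
  have h := Equiv.sum_comp (conjPerm K) f
  have h2 : ∑ σ, f (conjPerm K σ) = - ∑ σ, f σ := by
    rw [← Finset.sum_neg_distrib]
    exact Finset.sum_congr rfl fun σ _ => hf σ
  linarith

lemma sum_embeddings_eq (f : InfinitePlace K → ℝ) :
    ∑ σ : K →+* ℂ, f (InfinitePlace.mk σ) = ∑ v : InfinitePlace K, (v.mult : ℝ) * f v := by
  classical
  rw [← Finset.sum_fiberwise (s := Finset.univ) (g := fun σ : K →+* ℂ => InfinitePlace.mk σ)]
  refine Finset.sum_congr rfl fun v _ => ?_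
  rw [Finset.sum_congr rfl (g := fun _ => f v)]
  · rw [Finset.sum_const, nsmul_eq_mul, ← InfinitePlace.card_filter_mk_eq]
  · intro σ hσ
    rw [(Finset.mem_filter.1 hσ).2]

lemma prod_embeddings_eq (f : InfinitePlace K → ℝ) :
    ∏ σ : K →+* ℂ, f (InfinitePlace.mk σ) = ∏ v : InfinitePlace K, f v ^ v.mult := by
  classical
  rw [← Finset.prod_fiberwise (s := Finset.univ) (g := fun σ : K →+* ℂ => InfinitePlace.mk σ)]
  refine Finset.prod_congr rfl fun v _ => ?_
  rw [Finset.prod_congr rfl (g := fun _ => f v)]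
  · rw [Finset.prod_const, ← InfinitePlace.card_filter_mk_eq]
  · intro σ hσ
    rw [(Finset.mem_filter.1 hσ).2]

/-- Quadratic form attached to a positive vector `y` -/
def qK (y : InfinitePlace K → ℝ) (a : K) : ℝ := ∑ v : InfinitePlace K, v.mult * (y v ^ 2 * v a ^ 2)

lemma sum_add_im (y : InfinitePlace K → ℝ) (a : K) :
    ∑ σ : K →+* ℂ, (y (InfinitePlace.mk σ) * ((σ a).re + (σ a).im))^2 = qK y a := by
  rw [qK, ← sum_embeddings_eq (fun v => y v ^2 * v a ^ 2)]
  have h0 : ∑ σ : K →+* ℂ, (y (InfinitePlace.mk σ))^2 * (2 * ((σ a).re * (σ a).im)) = 0 := by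
    apply sum_conj_antisymm
    intro σ
    simp [InfinitePlace.mk_conjugate_eq, ComplexEmbedding.conjugate_coe_eq]
  rw [← sub_eq_zero, ← h0, ← Finset.sum_sub_distrib]
  refine Finset.sum_congr rfl fun σ _ => ?_
  rw [InfinitePlace.apply, Complex.sq_norm, Complex.normSq_apply]
  ring

lemma sum_sub_im (y : InfinitePlace K → ℝ) (a : K) :
    ∑ σ : K →+* ℂ, (y (InfinitePlace.mk σ) * ((σ a).re - (σ a).im))^2 = qK y a := by
  rw [← sum_add_im, ← Equiv.sum_comp (conjPerm K)]
  refine Finset.sum_congr rfl fun σ _ => ?_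
  simp [conjPerm, InfinitePlace.mk_conjugate_eq, ComplexEmbedding.conjugate_coe_eq]

lemma sum_cross (a b : K) :
    ∑ σ : K →+* ℂ, ((σ a).re - (σ a).im) * ((σ b).re + (σ b).im)
      = (Algebra.trace ℚ K (a * b) : ℝ) := by
  have h1 : (∑ σ : K →+* ℂ, (σ (a * b)).re) = (Algebra.trace ℚ K (a * b) : ℝ) := by
    have := trace_eq_sum_embeddings (K := ℚ) (L := K) (E := ℂ) (x := a * b)
    rw [← Equiv.sum_comp (RingHom.equivRatAlgHom (R := K) (S := ℂ))] at this
    have := congrArg Complex.re this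
    simp only [Complex.re_sum] at this
    simpa using this.symm
  have h0 : ∑ σ : K →+* ℂ, ((σ a).re * (σ b).im - (σ a).im * (σ b).re) = 0 := by
    apply sum_conj_antisymm
    intro σ
    simp [ComplexEmbedding.conjugate_coe_eq]; ring
  rw [← h1, ← sub_eq_zero, ← h0, ← Finset.sum_sub_distrib]
  refine Finset.sum_congr rfl fun σ _ => ?_
  simp; ring

variable (K)

/-- the ring of integers as a subset of K -/
def XO : Set K := Set.range (algebraMap (𝓞 K) K)

/-- dual lattice for the trace form -/
def XD : Set K := {b | ∀ a : 𝓞 K, ∃ n : ℤ, Algebra.trace ℚ K ((a : K) * b) = n}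

open Classical in
theorem exists_bases : ∃ (w w' : (K →+* ℂ) → K), (∀ i j, Algebra.trace ℚ K (w i * w' j) = if i = j then 1 else 0) ∧
    Function.Injective (fun m : (K →+* ℂ) → ℤ => ∑ i, (m i : K) * w i) ∧
    Set.range (fun m : (K →+* ℂ) → ℤ => ∑ i, (m i : K) * w i) = XO K ∧
    Function.Injective (fun m : (K →+* ℂ) → ℤ => ∑ i, (m i : K) * w' i) ∧
    Set.range (fun m : (K →+* ℂ) → ℤ => ∑ i, (m i : K) * w' i) = XD K := by
  classical
  have hcard : Fintype.card (Module.Free.ChooseBasisIndex ℤ (𝓞 K)) = Fintype.card (K →+* ℂ) := by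
    rw [Embeddings.card, ← Module.finrank_eq_card_basis (integralBasis K)]
  set e := Fintype.equivOfCardEq hcard
  set b0 := (RingOfIntegers.basis K).reindex e with hb0
  set b := (integralBasis K).reindex e with hb
  have hbb : ∀ i, b i = (b0 i : K) := by
    intro i
    simp [hb, hb0, integralBasis_apply]
  set b' := (Algebra.traceForm ℚ K).dualBasis (traceForm_nondegenerate ℚ K) b with hb'
  have htr : ∀ i j, Algebra.trace ℚ K (b i * b' j) = if i = j then 1 else 0 := by
    intro i j
    have := LinearMap.BilinForm.apply_dualBasis_left (traceForm_nondegenerate ℚ K) b j i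
    rw [mul_comm]
    simpa [hb', Algebra.traceForm_apply] using this
  have htr2 : ∀ (i) (m : (K →+* ℂ) → ℤ), Algebra.trace ℚ K (b i * ∑ j, (m j : K) * b' j) = m i := by
    intro i m
    have : b i * ∑ j, (m j : K) * b' j = ∑ j, (m j) • (b i * b' j) := by
      rw [Finset.mul_sum]
      refine Finset.sum_congr rfl fun j _ => ?_
      rw [zsmul_eq_mul]; ring
    rw [this, map_sum]
    simp_rw [map_zsmul, htr]
    simp
  have htr3 : ∀ (i) (m : (K →+* ℂ) → ℤ), Algebra.trace ℚ K ((∑ j, (m j : K) * b j) * b' i) = m i := by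
    intro i m
    have : (∑ j, (m j : K) * b j) * b' i = ∑ j, (m j) • (b j * b' i) := by
      rw [Finset.sum_mul]
      refine Finset.sum_congr rfl fun j _ => ?_
      rw [zsmul_eq_mul]; ring
    rw [this, map_sum]
    simp_rw [map_zsmul, htr]
    simp
  refine ⟨b, b', htr, ?_, ?_, ?_, ?_⟩
  · intro m m' h
    funext i
    have h1 := htr3 i m
    have h2 := htr3 i m'
    simp only at h
    rw [h, h2] at h1
    exact_mod_cast h1.symm
  · ext x
    constructor
    · rintro ⟨m, rfl⟩
      exact ⟨∑ i, m i • b0 i, by simp [hbb]⟩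
    · rintro ⟨a, rfl⟩
      refine ⟨fun i => b0.repr a i, ?_⟩
      conv_rhs => rw [← b0.sum_repr a]
      simp [hbb]
  · intro m m' h
    funext i
    have h1 := htr2 i m
    have h2 := htr2 i m'
    simp only at h
    rw [h, h2] at h1
    exact_mod_cast h1.symm
  · ext x
    constructor
    · rintro ⟨m, rfl⟩ a
      refine ⟨∑ i, b0.repr a i * m i, ?_⟩
      have ha : (a : K) = ∑ i, (b0.repr a i : K) * b i := by
        conv_lhs => rw [← b0.sum_repr a]
        simp [hbb]
      have : (a : K) * ∑ j, (m j : K) * b' j = ∑ i, (b0.repr a i) • (b i * ∑ j, (m j : K) * b' j) := by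
        rw [ha, Finset.sum_mul]
        refine Finset.sum_congr rfl fun j _ => ?_
        rw [zsmul_eq_mul]; ring
      simp only
      rw [this, map_sum]
      simp_rw [map_zsmul, htr2]
      simp
    · intro hx
      choose n hn using fun i => hx (b0 i)
      refine ⟨n, ?_⟩
      have hx2 := b'.sum_repr x
      rw [← hx2]
      refine Finset.sum_congr rfl fun i _ => ?_
      have : b'.repr x i = n i := by
        rw [← hn i, ← hbb]
        have e : ∀ j, Algebra.trace ℚ K (b i * (b'.repr x j • b' j))
            = b'.repr x j * if i = j then 1 else 0 := by
          intro j
          rw [mul_smul_comm, map_smul, htr, smul_eq_mul]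
        calc b'.repr x i = ∑ j, b'.repr x j * (if i = j then 1 else 0) := by simp
          _ = Algebra.trace ℚ K (b i * ∑ j, b'.repr x j • b' j) := by
            rw [Finset.mul_sum, map_sum]
            exact Finset.sum_congr rfl fun j _ => (e j).symm
          _ = _ := by rw [hx2]
      rw [this, Algebra.smul_def]
      simp

theorem theta_K : ∃ κ : ℝ, 0 < κ ∧ ∀ y : InfinitePlace K → ℝ, (∀ v, 0 < y v) →
    (Summable fun a : XO K => Real.exp (-Real.pi * qK y a)) ∧
    (Summable fun a : XD K => Real.exp (-Real.pi * qK y⁻¹ a)) ∧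
    (∏ v, y v ^ v.mult) * ∑' a : XO K, Real.exp (-Real.pi * qK y a) =
      κ * ∑' a : XD K, Real.exp (-Real.pi * qK y⁻¹ a) := by
  classical
  obtain ⟨w, w', htr, hi, hr, hi', hr'⟩ := exists_bases K
  set B : ((K →+* ℂ)) → ((K →+* ℂ)) → ℝ := fun σ i => (σ (w i)).re + (σ (w i)).im with hB
  set C : ((K →+* ℂ)) → ((K →+* ℂ)) → ℝ := fun σ i => (σ (w' i)).re - (σ (w' i)).im with hC
  have hCB : ∀ i j, ∑ σ, C σ i * B σ j = if i = j then 1 else 0 := by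
    intro i j
    rw [hB, hC, sum_cross, mul_comm, htr]
    by_cases h : i = j
    · simp [h]
    · simp [h, Ne.symm h]
  have hdet : (Matrix.of B).det ≠ 0 := by
    intro h0
    have : (Matrix.of C).transpose * Matrix.of B = 1 := by
      ext i j
      simp only [Matrix.mul_apply, Matrix.transpose_apply, Matrix.of_apply, hCB, Matrix.one_apply]
    have := congrArg Matrix.det this
    simp [h0] at this
  refine ⟨|(Matrix.of B).det|⁻¹, by positivity, fun y hy => ?_⟩
  set By : Matrix (K →+* ℂ) (K →+* ℂ) ℝ := Matrix.of fun σ i => y (InfinitePlace.mk σ) * B σ i with hBy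
  set Cy : Matrix (K →+* ℂ) (K →+* ℂ) ℝ := Matrix.of fun σ i => y⁻¹ (InfinitePlace.mk σ) * C σ i with hCy
  have h1 : Cy.transpose * By = 1 := by
    ext i j
    rw [Matrix.mul_apply, Matrix.one_apply, ← hCB]
    refine Finset.sum_congr rfl fun σ _ => ?_
    have := (hy (InfinitePlace.mk σ)).ne'
    simp only [hBy, hCy, Matrix.transpose_apply, Matrix.of_apply, Pi.inv_apply]
    field_simp
  have h1' : By.transpose * Cy = 1 := by
    have := congrArg Matrix.transpose h1
    simpa using this
  have hdy : By.det = (∏ v, y v ^ v.mult) * (Matrix.of B).det := by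
    rw [← prod_embeddings_eq]
    exact Matrix.det_mul_column _ (Matrix.of B)
  have hp : 0 < ∏ v, y v ^ v.mult := Finset.prod_pos fun v _ => pow_pos (hy v) _
  have hqB : ∀ m : (K →+* ℂ) → ℤ, qf By (zv m) = qK y (∑ i, (m i : K) * w i) := by
    intro m
    rw [← sum_add_im, qf]
    refine Finset.sum_congr rfl fun σ _ => ?_
    congr 1
    simp only [Matrix.mulVec, dotProduct, hBy, hB, Matrix.of_apply, zv, map_sum, map_mul, map_intCast,
      Complex.re_sum, Complex.im_sum]
    rw [← Finset.sum_add_distrib, Finset.mul_sum]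
    refine Finset.sum_congr rfl fun i _ => ?_
    simp; ring
  have hqC : ∀ m : (K →+* ℂ) → ℤ, qf Cy (zv m) = qK y⁻¹ (∑ i, (m i : K) * w' i) := by
    intro m
    rw [← sum_sub_im, qf]
    refine Finset.sum_congr rfl fun σ _ => ?_
    congr 1
    simp only [Matrix.mulVec, dotProduct, hCy, hC, Matrix.of_apply, zv, map_sum, map_mul, map_intCast,
      Complex.re_sum, Complex.im_sum]
    rw [← Finset.sum_sub_distrib, Finset.mul_sum]
    refine Finset.sum_congr rfl fun i _ => ?_
    simp; ring
  set e1 := (Equiv.ofInjective _ hi).trans (Equiv.setCongr hr) with he1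
  set e2 := (Equiv.ofInjective _ hi').trans (Equiv.setCongr hr') with he2
  have s1 : (fun m => Real.exp (-Real.pi * qf By (zv m))) =
      (fun a : XO K => Real.exp (-Real.pi * qK y a)) ∘ e1 := by
    funext m
    rw [hqB]; rfl
  have s2 : (fun m => Real.exp (-Real.pi * qf Cy (zv m))) =
      (fun a : XD K => Real.exp (-Real.pi * qK y⁻¹ a)) ∘ e2 := by
    funext m
    rw [hqC]; rfl
  have key := theta_poisson By Cy h1
  refine ⟨?_, ?_, ?_⟩
  · rw [← e1.summable_iff, ← s1]
    exact summable_qf By Cy h1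
  · rw [← e2.summable_iff, ← s2]
    exact summable_qf Cy By h1'
  · rw [s1, s2] at key
    simp only [Function.comp_def] at key
    rw [e1.tsum_eq (fun a : XO K => Real.exp (-Real.pi * qK y a)),
      e2.tsum_eq (fun a : XD K => Real.exp (-Real.pi * qK y⁻¹ a)), hdy, abs_mul, abs_of_pos hp] at key
    rw [key]
    field_simp

end ThetaK

end ModP3

section ModP4
open MeasureTheory Set Filter Topology NumberField NumberField.Units NumberField.Units.dirichletUnitTheorem
open scoped ENNReal
open scoped Classical

noncomputable section Unfold

variable (K : Type*) [Field K] [NumberField K]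

lemma exists_fd : ∃ F : Set (logSpace K), Bornology.IsBounded F ∧ MeasurableSet F ∧
    volume F = ENNReal.ofReal (regulator K) ∧
    (∀ h : logSpace K → ℝ≥0∞, ∑' l : unitLattice K, ∫⁻ x in F, h (x + l) = ∫⁻ x, h x) := by
  set b := (basisUnitLattice K).ofZLatticeBasis ℝ (unitLattice K) with hb
  set F := ZSpan.fundamentalDomain b with hF
  have hfd := ZLattice.isAddFundamentalDomain (basisUnitLattice K) (volume : Measure (logSpace K))
  have hbd : Bornology.IsBounded F := ZSpan.fundamentalDomain_isBounded _
  refine ⟨F, hbd, ZSpan.fundamentalDomain_measurableSet _, ?_, ?_⟩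
  · rw [regulator, ZLattice.covolume_eq_measure_fundamentalDomain _ _ hfd, measureReal_def,
      ENNReal.ofReal_toReal]
    exact hbd.measure_lt_top.ne
  · intro h
    have : MeasurableVAdd (unitLattice K) (logSpace K) := (inferInstance : MeasurableVAdd (unitLattice K).toAddSubgroup (logSpace K))
    have : VAddInvariantMeasure (unitLattice K) (logSpace K) volume := (inferInstance : VAddInvariantMeasure (unitLattice K).toAddSubgroup (logSpace K) volume)
    rw [hfd.lintegral_eq_tsum' h, ← (Equiv.neg _).tsum_eq]
    refine tsum_congr fun l => ?_
    simp only [Equiv.neg_apply]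
    refine lintegral_congr fun x => ?_
    congr 1
    rw [add_comm]
    rfl

variable {K}

lemma tsum_fiber_const {α β : Type*} (f : α → β) (w : ℕ) (hw : ∀ b, Nat.card {a // f a = b} = w)
    (hw0 : w ≠ 0) (h : β → ℝ≥0∞) : ∑' a, h (f a) = w * ∑' b, h b := by
  rw [← (Equiv.sigmaFiberEquiv f).tsum_eq, ENNReal.tsum_sigma', ← ENNReal.tsum_mul_left]
  refine tsum_congr fun b => ?_
  have hfin : Finite {a // f a = b} := Nat.finite_of_card_ne_zero (by rw [hw]; exact hw0)
  have : ∀ a : {a // f a = b}, h (f ((Equiv.sigmaFiberEquiv f) ⟨b, a⟩)) = h b := by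
    rintro ⟨a, rfl⟩; rfl
  simp_rw [this]
  rw [ENNReal.tsum_const, ENat.card_eq_coe_natCard, hw]
  simp

lemma tsum_units (h : unitLattice K → ℝ≥0∞) (hh : logSpace K → ℝ≥0∞) (hhh : ∀ l : unitLattice K, h l = hh l) :
    ∑' e : (𝓞 K)ˣ, hh (logEmbedding K (Additive.ofMul e)) = torsionOrder K * ∑' l, h l := by
  set f : (𝓞 K)ˣ → unitLattice K := fun e => ⟨logEmbedding K (Additive.ofMul e), by
    exact ⟨Additive.ofMul e, trivial, rfl⟩⟩ with hf
  rw [← tsum_fiber_const f (torsionOrder K) ?_ ?_ h]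
  · refine tsum_congr fun e => ?_
    rw [hhh]
  · rintro ⟨_, ⟨e, -, rfl⟩⟩
    rw [torsionOrder]
    refine Nat.card_congr ?_
    refine { toFun := fun a => ⟨a.1 * (Additive.toMul e)⁻¹, ?_⟩, invFun := fun t => ⟨t.1 * Additive.toMul e, ?_⟩, left_inv := ?_, right_inv := ?_ }
    · rw [← logEmbedding_eq_zero_iff]
      have := congrArg Subtype.val a.2
      simp only [hf] at this
      rw [ofMul_mul, map_add, this]
      simp
    · have := (logEmbedding_eq_zero_iff (K := K)).2 t.2
      simp only [hf]
      apply Subtype.ext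
      simp only
      rw [ofMul_mul, map_add, this]
      simp
    · intro a; apply Subtype.ext; simp
    · intro t; simp
  · exact torsionOrder_ne_zero K

/-- log vector of an element at places different from w₀ -/
def lv (a : K) : logSpace K := fun w => w.1.mult * Real.log (w.1 a)

/-- log of the absolute norm -/
def lN (a : K) : ℝ := ∑ v : InfinitePlace K, v.mult * Real.log (v a)

lemma lv_mul_unit {a : K} (ha : a ≠ 0) (e : (𝓞 K)ˣ) :
    lv ((e : K) * a) = lv a + logEmbedding K (Additive.ofMul e) := by
  funext w
  simp only [lv, Pi.add_apply, logEmbedding_component]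
  rw [map_mul, Real.log_mul, mul_add, add_comm]
  · simp
  · simpa using ha

lemma lN_mul_unit {a : K} (ha : a ≠ 0) (e : (𝓞 K)ˣ) : lN ((e : K) * a) = lN a := by
  simp only [lN]
  rw [← sub_eq_zero, ← Finset.sum_sub_distrib, ← NumberField.Units.sum_mult_mul_log e]
  refine Finset.sum_congr rfl fun v _ => ?_
  rw [map_mul, Real.log_mul, mul_add]
  · ring
  · simp
  · simpa using ha

/-- nonzero elements of a set modulo units -/
def uSetoid (X : Set K) : Setoid {a : K // a ∈ X ∧ a ≠ 0} where
  r a b := ∃ e : (𝓞 K)ˣ, (a : K) = (e : K) * b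
  iseqv := {
    refl := fun a => ⟨1, by simp⟩
    symm := by
      rintro a b ⟨e, he⟩
      exact ⟨e⁻¹, by rw [he, ← mul_assoc]; simp⟩
    trans := by
      rintro a b c ⟨e, he⟩ ⟨e', he'⟩
      exact ⟨e * e', by rw [he, he', ← mul_assoc]; simp⟩ }

/-- orbits -/
def QX (X : Set K) := Quotient (uSetoid X)

/-- log norm of an orbit -/
def nQ {X : Set K} (q : QX X) : ℝ := lN (Quotient.out q : {a : K // a ∈ X ∧ a ≠ 0}).1

theorem unfold_orbits (X : Set K) (hX : ∀ (e : (𝓞 K)ˣ), ∀ a ∈ X, (e : K) * a ∈ X)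
    (I : (logSpace K → ℝ≥0∞) → ℝ≥0∞)
    (hI : ∀ h : logSpace K → ℝ≥0∞, ∑' l : unitLattice K, I (fun x => h (x + l)) = ∫⁻ x, h x)
    (H : ℝ → logSpace K → ℝ≥0∞) :
    ∑' a : {a : K // a ∈ X ∧ a ≠ 0}, I (fun x => H (lN a.1) (x + lv a.1)) =
      torsionOrder K * ∑' q : QX X, ∫⁻ x, H (nQ q) x := by
  let f : {a : K // a ∈ X ∧ a ≠ 0} → QX X := fun a => Quotient.mk (uSetoid X) a
  rw [← (Equiv.sigmaFiberEquiv f).tsum_eq, ENNReal.tsum_sigma', ← ENNReal.tsum_mul_left]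
  refine tsum_congr fun q => ?_
  set a0 : {a : K // a ∈ X ∧ a ≠ 0} := Quotient.out q with ha0
  have hq : f a0 = q := Quotient.out_eq q
  let E : (𝓞 K)ˣ ≃ {a // f a = q} := Equiv.ofBijective
    (fun e => ⟨⟨(e : K) * a0.1, hX e _ a0.2.1, mul_ne_zero (by simp) a0.2.2⟩, by
      rw [← hq]; exact Quotient.sound ⟨e, rfl⟩⟩) (by
      constructor
      · intro e e' h
        simp only [Subtype.mk.injEq] at h
        have := mul_right_cancel₀ a0.2.2 h
        exact coe_injective K this
      · rintro ⟨a, ha⟩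
        obtain ⟨e, he⟩ := Quotient.exact (ha.trans hq.symm)
        exact ⟨e, by apply Subtype.ext; apply Subtype.ext; exact he.symm⟩)
  rw [← E.tsum_eq]
  have : ∀ e, I (fun x => H (lN ((Equiv.sigmaFiberEquiv f) ⟨q, E e⟩).1)
      (x + lv ((Equiv.sigmaFiberEquiv f) ⟨q, E e⟩).1)) =
      (fun l : logSpace K => I (fun x => (fun z => H (nQ q) (z + lv a0.1)) (x + l))) (logEmbedding K (Additive.ofMul e)) := by
    intro e
    have e1 : ((Equiv.sigmaFiberEquiv f) ⟨q, E e⟩).1 = (e : K) * a0.1 := rfl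
    rw [e1, lN_mul_unit a0.2.2, lv_mul_unit a0.2.2]
    simp only
    congr 1
    funext x
    congr 1
    abel
  rw [tsum_congr this]
  have h1 := tsum_units (fun l : unitLattice K => I (fun x => (fun z => H (nQ q) (z + lv a0.1)) (x + l)))
    (fun l : logSpace K => I (fun x => (fun z => H (nQ q) (z + lv a0.1)) (x + l))) (fun l => rfl)
  refine h1.trans ?_
  congr 1
  refine (hI (fun z => H (nQ q) (z + lv a0.1))).trans ?_
  exact lintegral_add_right_eq_self (fun z => H (nQ q) z) _

end Unfold

end ModP4

section ModP5
open MeasureTheory Set Filter Topology NumberField NumberField.Units NumberField.Units.dirichletUnitTheorem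
open scoped ENNReal
open scoped Classical

noncomputable section FuncEq
set_option linter.unusedSectionVars false

variable {K : Type*} [Field K] [NumberField K]

/-- exponent vector -/
def ev (u : ℝ) (x : logSpace K) : InfinitePlace K → ℝ :=
  fun v => if h : v = w₀ then u - ∑ w, x w else x ⟨v, h⟩

lemma ev_w0 (u : ℝ) (x : logSpace K) : ev u x w₀ = u - ∑ w, x w := by simp [ev]

lemma ev_ne (u : ℝ) (x : logSpace K) (w : {w : InfinitePlace K // w ≠ w₀}) : ev u x w.1 = x w := by
  simp [ev, w.2]

lemma sum_split (f : InfinitePlace K → ℝ) : ∑ v, f v = f w₀ + ∑ w : {w : InfinitePlace K // w ≠ w₀}, f w.1 := by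
  exact Fintype.sum_eq_add_sum_subtype_ne f w₀

lemma sum_ev (u : ℝ) (x : logSpace K) : ∑ v, ev u x v = u := by
  rw [sum_split, ev_w0]
  simp_rw [ev_ne]
  ring

lemma ev_neg (u : ℝ) (x : logSpace K) (v : InfinitePlace K) : ev (-u) (-x) v = - ev u x v := by
  by_cases h : v = w₀
  · subst h; simp [ev_w0]; ring
  · simp [ev, h]

lemma ev_add (u : ℝ) (x : logSpace K) (a : K) (v : InfinitePlace K) :
    ev (u + lN a) (x + lv a) v = ev u x v + v.mult * Real.log (v a) := by
  by_cases h : v = w₀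
  · subst h
    rw [ev_w0, ev_w0, lN, sum_split]
    simp only [Pi.add_apply, Finset.sum_add_distrib, lv]
    ring
  · have h1 := ev_ne (u + lN a) (x + lv a) ⟨v, h⟩
    have h2 := ev_ne u x ⟨v, h⟩
    simp only at h1 h2
    rw [h1, h2]; rfl

/-- the product of Gaussians -/
def GK (u : ℝ) (x : logSpace K) : ℝ :=
  Real.exp (-Real.pi * ∑ v : InfinitePlace K, v.mult * Real.exp (2 * ev u x v / v.mult))

lemma continuous_ev (v : InfinitePlace K) : Continuous fun p : ℝ × logSpace K => ev p.1 p.2 v := by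
  by_cases h : v = w₀
  · simp only [ev, h, dite_true]; fun_prop
  · simp only [ev, h, dite_false]; fun_prop

lemma continuous_GK : Continuous fun p : ℝ × logSpace K => GK p.1 p.2 := by
  unfold GK
  refine Real.continuous_exp.comp (continuous_const.mul (continuous_finsetSum _ fun v _ => ?_))
  exact continuous_const.mul (Real.continuous_exp.comp ((continuous_const.mul (continuous_ev v)).div_const _))

lemma continuous_GK' (u : ℝ) : Continuous fun x : logSpace K => GK u x :=
  Continuous.comp (f := fun x : logSpace K => ((u, x) : ℝ × logSpace K)) continuous_GK
    (Continuous.prodMk continuous_const continuous_id)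

lemma GK_pos (u : ℝ) (x : logSpace K) : 0 < GK u x := Real.exp_pos _

lemma mult_pos' (v : InfinitePlace K) : (0 : ℝ) < v.mult := by exact_mod_cast InfinitePlace.mult_pos

lemma qK_exp (u : ℝ) (x : logSpace K) {a : K} (ha : a ≠ 0) :
    Real.exp (-Real.pi * qK (fun v => Real.exp (ev u x v / v.mult)) a) = GK (u + lN a) (x + lv a) := by
  unfold qK GK
  congr 2
  refine Finset.sum_congr rfl fun v _ => ?_
  congr 1
  have hm := mult_pos' v
  have hva : 0 < v a := InfinitePlace.pos_iff.2 ha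
  rw [ev_add]
  have hva' : v a = Real.exp (Real.log (v a)) := (Real.exp_log hva).symm
  beta_reduce
  conv_lhs => rw [hva']
  rw [← mul_pow, ← Real.exp_add, ← Real.exp_nat_mul]
  congr 1
  field_simp
  push_cast; ring

lemma one_mem_XO : (1 : K) ∈ XO K := ⟨1, by simp⟩
lemma zero_mem_XO : (0 : K) ∈ XO K := ⟨0, by simp⟩
lemma zero_mem_XD : (0 : K) ∈ XD K := fun a => ⟨0, by simp⟩

lemma XO_stable (e : (𝓞 K)ˣ) (a : K) (ha : a ∈ XO K) : (e : K) * a ∈ XO K := by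
  obtain ⟨b, rfl⟩ := ha
  exact ⟨e * b, by simp⟩

lemma XD_stable (e : (𝓞 K)ˣ) (a : K) (ha : a ∈ XD K) : (e : K) * a ∈ XD K := by
  intro b
  obtain ⟨n, hn⟩ := ha (b * e)
  refine ⟨n, ?_⟩
  rw [← hn]
  simp [mul_assoc]

lemma tsum_split_zero (X : Set K) (h0 : (0 : K) ∈ X) (f : K → ℝ≥0∞) :
    ∑' a : X, f a = f 0 + ∑' a : {a : K // a ∈ X ∧ a ≠ 0}, f a := by
  have hX : X = {0} ∪ {a | a ∈ X ∧ a ≠ 0} := by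
    ext a
    by_cases h : a = 0
    · simp [h, h0]
    · simp [h]
  have h1 : ∑' a : X, f a = ∑' a : ({0} ∪ {a | a ∈ X ∧ a ≠ 0} : Set K), f a := by
    rw [← hX]
  rw [h1, ENNReal.summable.tsum_union_disjoint _ ENNReal.summable]
  · congr 1
    exact tsum_singleton (0 : K) f
  · simp

lemma tsum_theta (X : Set K) (h0 : (0 : K) ∈ X) (u : ℝ) (x : logSpace K)
    (hs : Summable fun a : X => Real.exp (-Real.pi * qK (fun v => Real.exp (ev u x v / v.mult)) a)) :
    ENNReal.ofReal (∑' a : X, Real.exp (-Real.pi * qK (fun v => Real.exp (ev u x v / v.mult)) a)) =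
      1 + ∑' a : {a : K // a ∈ X ∧ a ≠ 0}, ENNReal.ofReal (GK (u + lN a.1) (x + lv a.1)) := by
  rw [ENNReal.ofReal_tsum_of_nonneg (fun _ => (Real.exp_pos _).le) hs,
    tsum_split_zero X h0 (fun a => ENNReal.ofReal (Real.exp (-Real.pi * qK (fun v => Real.exp (ev u x v / v.mult)) a)))]
  congr 1
  · simp [qK]
  · refine tsum_congr fun a => ?_
    rw [qK_exp u x a.2.2]

variable (K)

lemma theta_pointwise : ∃ κ : ℝ, 0 < κ ∧ ∀ (u : ℝ) (x : logSpace K),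
    ENNReal.ofReal (Real.exp u) * (1 + ∑' a : {a : K // a ∈ XO K ∧ a ≠ 0},
        ENNReal.ofReal (GK (u + lN a.1) (x + lv a.1))) =
      ENNReal.ofReal κ * (1 + ∑' a : {a : K // a ∈ XD K ∧ a ≠ 0},
        ENNReal.ofReal (GK (-u + lN a.1) (-x + lv a.1))) := by
  obtain ⟨κ, hκ, h⟩ := theta_K K
  refine ⟨κ, hκ, fun u x => ?_⟩
  obtain ⟨h1, h2, h3⟩ := h (fun v => Real.exp (ev u x v / v.mult)) (fun v => Real.exp_pos _)
  have hinv : (fun v : InfinitePlace K => Real.exp (ev u x v / v.mult))⁻¹ =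
      fun v => Real.exp (ev (-u) (-x) v / v.mult) := by
    funext v
    rw [Pi.inv_apply, ← Real.exp_neg, ev_neg, neg_div]
  have hprod : ∏ v : InfinitePlace K, (Real.exp (ev u x v / v.mult)) ^ v.mult = Real.exp u := by
    conv_rhs => rw [← sum_ev u x, Real.exp_sum]
    refine Finset.prod_congr rfl fun v _ => ?_
    rw [← Real.exp_nat_mul]
    congr 1
    have := mult_pos' v
    field_simp
  rw [hinv] at h2 h3
  rw [hprod] at h3
  rw [← tsum_theta (XO K) zero_mem_XO u x h1, ← tsum_theta (XD K) zero_mem_XD (-u) (-x) h2,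
    ← ENNReal.ofReal_mul (Real.exp_pos _).le, ← ENNReal.ofReal_mul hκ.le, h3]

/-- the integrated Gaussian -/
def phi (u : ℝ) : ℝ≥0∞ := ∫⁻ x : logSpace K, ENNReal.ofReal (GK u x)

instance countable_numberField : Countable K := by
  have b := Module.finBasis ℚ K
  exact b.equivFun.toEquiv.injective.countable

lemma theta_finite : ∀ (F : Set (logSpace K)), Bornology.IsBounded F → ∀ u, 
    ∫⁻ x in F, (∑' a : {a : K // a ∈ XO K ∧ a ≠ 0},
        ENNReal.ofReal (GK (u + lN a.1) (x + lv a.1))) < ⊤ := by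
  intro F hF u
  obtain ⟨κ, hκ, h⟩ := theta_K K
  obtain ⟨M, hM⟩ : ∃ M : ℝ, ∀ x ∈ F, ∀ v : InfinitePlace K, -M ≤ ev u x v / v.mult := by
    obtain ⟨R, hR⟩ := hF.exists_norm_le
    have hcomp : IsCompact (Metric.closedBall (0 : logSpace K) R) := isCompact_closedBall _ _
    have : ∀ v : InfinitePlace K, ∃ M : ℝ, ∀ x ∈ F, -M ≤ ev u x v / v.mult := by
      intro v
      have hc : Continuous fun x : logSpace K => ev u x v / (v.mult : ℝ) :=
        ((continuous_ev v).comp (by fun_prop : Continuous fun x : logSpace K => (u, x))).div_const _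
      obtain ⟨M, hM⟩ := (hcomp.image hc).bddBelow
      refine ⟨-M, fun x hx => ?_⟩
      rw [neg_neg]
      exact hM ⟨x, by simpa using hR x hx, rfl⟩
    choose M hM using this
    refine ⟨∑ v, |M v|, fun x hx v => le_trans ?_ (hM v x hx)⟩
    have : |M v| ≤ ∑ v, |M v| := Finset.single_le_sum (f := fun v => |M v|) (fun _ _ => abs_nonneg _) (Finset.mem_univ v)
    linarith [le_abs_self (M v)]
  obtain ⟨h1, -, -⟩ := h (fun v => Real.exp (-M)) (fun v => Real.exp_pos _)
  have hbd : ∀ x ∈ F, (∑' a : {a : K // a ∈ XO K ∧ a ≠ 0},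
        ENNReal.ofReal (GK (u + lN a.1) (x + lv a.1))) ≤
        ∑' a : XO K, ENNReal.ofReal (Real.exp (-Real.pi * qK (fun v => Real.exp (-M)) (a : K))) := by
    intro x hx
    rw [tsum_split_zero (XO K) zero_mem_XO (fun a => ENNReal.ofReal (Real.exp (-Real.pi * qK (fun v => Real.exp (-M)) a)))]
    refine le_trans ?_ le_add_self
    refine ENNReal.tsum_le_tsum fun a => ENNReal.ofReal_le_ofReal ?_
    rw [← qK_exp u x a.2.2]
    apply Real.exp_le_exp.2
    rw [neg_mul, neg_mul]
    apply neg_le_neg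
    apply mul_le_mul_of_nonneg_left _ Real.pi_pos.le
    refine Finset.sum_le_sum fun v _ => ?_
    have := hM x hx v
    beta_reduce
    gcongr
  have hfin : (∑' a : XO K, ENNReal.ofReal (Real.exp (-Real.pi * qK (fun v => Real.exp (-M)) (a : K)))) < ⊤ := by
    rw [← ENNReal.ofReal_tsum_of_nonneg (fun _ => (Real.exp_pos _).le) h1]
    exact ENNReal.ofReal_lt_top
  refine lt_of_le_of_lt (setLIntegral_mono measurable_const hbd) ?_
  rw [setLIntegral_const]
  exact ENNReal.mul_lt_top hfin hF.measure_lt_top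

lemma meas_GK (u c : ℝ) (l : logSpace K) (s : logSpace K → logSpace K) (hs : Continuous s) :
    Measurable fun x : logSpace K => ENNReal.ofReal (GK u (s x + l)) := by
  have := continuous_GK' (K := K) u
  exact (this.comp (hs.add continuous_const)).measurable.ennreal_ofReal

theorem func_eq : ∃ κ : ℝ, 0 < κ ∧ ∀ u : ℝ,
    ENNReal.ofReal (Real.exp u) * (ENNReal.ofReal (regulator K) +
        torsionOrder K * ∑' q : QX (XO K), phi K (u + nQ q)) =
      ENNReal.ofReal κ * (ENNReal.ofReal (regulator K) +
        torsionOrder K * ∑' q : QX (XD K), phi K (-u + nQ q)) ∧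
    ∑' q : QX (XO K), phi K (u + nQ q) < ⊤ := by
  obtain ⟨κ, hκ, h⟩ := theta_pointwise K
  obtain ⟨F, hF, hFm, hFv, hFs⟩ := exists_fd K
  have hFs' : ∀ h : logSpace K → ℝ≥0∞, ∑' l : unitLattice K, ∫⁻ x in F, h (-x + l) = ∫⁻ x, h x := by
    intro h
    have := hFs (fun x => h (-x))
    rw [← (Equiv.neg _).tsum_eq] at this
    rw [lintegral_neg_eq_self (fun x => h x)] at this
    rw [← this]
    refine tsum_congr fun l => lintegral_congr fun x => ?_
    congr 1
    simp
    abel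
  refine ⟨κ, hκ, fun u => ?_⟩
  have hO := unfold_orbits (XO K) XO_stable (fun h => ∫⁻ x in F, h x) hFs
    (fun n x => ENNReal.ofReal (GK (u + n) x))
  have hD := unfold_orbits (XD K) XD_stable (fun h => ∫⁻ x in F, h (-x)) hFs'
    (fun n x => ENNReal.ofReal (GK (-u + n) x))
  have hmO : ∀ a : {a : K // a ∈ XO K ∧ a ≠ 0}, Measurable fun x : logSpace K =>
      ENNReal.ofReal (GK (u + lN a.1) (x + lv a.1)) := fun a =>
      meas_GK K _ 0 _ (fun x => x) continuous_id
  have hmD : ∀ a : {a : K // a ∈ XD K ∧ a ≠ 0}, Measurable fun x : logSpace K =>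
      ENNReal.ofReal (GK (-u + lN a.1) (-x + lv a.1)) := fun a =>
      meas_GK K _ 0 _ (fun x => -x) continuous_neg
  have hO' : torsionOrder K * ∑' q : QX (XO K), phi K (u + nQ q) =
      ∫⁻ x in F, ∑' a : {a : K // a ∈ XO K ∧ a ≠ 0},
        ENNReal.ofReal (GK (u + lN a.1) (x + lv a.1)) := by
    rw [lintegral_tsum fun a => (hmO a).aemeasurable]
    exact hO.symm
  have hD' : torsionOrder K * ∑' q : QX (XD K), phi K (-u + nQ q) =
      ∫⁻ x in F, ∑' a : {a : K // a ∈ XD K ∧ a ≠ 0},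
        ENNReal.ofReal (GK (-u + lN a.1) (-x + lv a.1)) := by
    rw [lintegral_tsum fun a => (hmD a).aemeasurable]
    exact hD.symm
  constructor
  · have hone : ENNReal.ofReal (regulator K) = ∫⁻ x in F, 1 := by
      rw [setLIntegral_one, hFv]
    rw [hO', hD', hone, ← lintegral_add_left measurable_const, ← lintegral_add_left measurable_const,
      ← lintegral_const_mul' _ _ ENNReal.ofReal_ne_top, ← lintegral_const_mul' _ _ ENNReal.ofReal_ne_top]
    exact lintegral_congr fun x => h u x
  · have := theta_finite K F hF u
    rw [← hO'] at this
    refine lt_of_le_of_lt ?_ this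
    have h1 : (1 : ℝ≥0∞) ≤ torsionOrder K := by exact_mod_cast (torsionOrder_pos K)
    calc _ = 1 * ∑' q : QX (XO K), phi K (u + nQ q) := (one_mul _).symm
      _ ≤ _ := by gcongr

lemma nQ_nonneg (q : QX (XO K)) : 0 ≤ nQ q := by
  unfold nQ
  obtain ⟨⟨b, hb⟩, h0⟩ := (Quotient.out q : {a : K // a ∈ XO K ∧ a ≠ 0}).2
  rw [← hb] at h0 ⊢
  have h1 := InfinitePlace.prod_eq_abs_norm (K := K) (algebraMap (𝓞 K) K b)
  have h2 : lN (algebraMap (𝓞 K) K b) = Real.log |(Algebra.norm ℚ (algebraMap (𝓞 K) K b) : ℝ)| := by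
    have : (|(Algebra.norm ℚ (algebraMap (𝓞 K) K b) : ℝ)|) = ((|Algebra.norm ℚ (algebraMap (𝓞 K) K b)| : ℚ) : ℝ) := by push_cast; rfl
    rw [this, ← h1, lN, Real.log_prod]
    · refine Finset.sum_congr rfl fun v _ => ?_
      rw [Real.log_pow]
    · intro v _
      exact pow_ne_zero _ (InfinitePlace.pos_iff.2 h0).ne'
  rw [h2]
  apply Real.log_nonneg
  have h3 : Algebra.norm ℚ (algebraMap (𝓞 K) K b) = ((Algebra.norm ℤ b : ℤ) : ℚ) := by
    rw [Algebra.coe_norm_int]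
  rw [h3]
  have h4 : Algebra.norm ℤ b ≠ 0 := by
    rw [Algebra.norm_ne_zero_iff]
    intro hb0; apply h0; simp [hb0]
  have := Int.one_le_abs h4
  have : (1:ℝ) ≤ ((|Algebra.norm ℤ b| : ℤ) : ℝ) := by exact_mod_cast this
  simpa using this

lemma exists_nQ_zero : ∃ q : QX (XO K), nQ q = 0 := by
  let one : {a : K // a ∈ XO K ∧ a ≠ 0} := ⟨1, one_mem_XO, one_ne_zero⟩
  refine ⟨Quotient.mk (uSetoid (XO K)) one, ?_⟩
  unfold nQ
  have h := Quotient.mk_out (s := uSetoid (XO K)) one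
  obtain ⟨e, he⟩ := h
  have he' : ((Quotient.out (Quotient.mk (uSetoid (XO K)) one)) : {a : K // a ∈ XO K ∧ a ≠ 0}).1 = (e : K) * 1 := he
  rw [he', lN_mul_unit one_ne_zero]
  simp [lN]

lemma phi_anti : Antitone (phi K) := by
  intro u u' h
  refine lintegral_mono fun x => ENNReal.ofReal_le_ofReal ?_
  unfold GK
  apply Real.exp_le_exp.2
  rw [neg_mul, neg_mul]
  apply neg_le_neg
  apply mul_le_mul_of_nonneg_left _ Real.pi_pos.le
  refine Finset.sum_le_sum fun v _ => ?_
  have hv := mult_pos' v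
  gcongr
  by_cases h' : v = w₀
  · subst h'; rw [ev_w0, ev_w0]; linarith
  · simp [ev, h']

lemma phi_lt_top (u : ℝ) : phi K u < ⊤ := by
  obtain ⟨κ, -, h⟩ := func_eq K
  obtain ⟨q, hq⟩ := exists_nQ_zero K
  refine lt_of_le_of_lt ?_ (h u).2
  calc phi K u = phi K (u + nQ q) := by rw [hq, add_zero]
    _ ≤ _ := ENNReal.le_tsum q

end FuncEq

end ModP5

section ModP6
open MeasureTheory Set Filter Topology NumberField NumberField.Units NumberField.Units.dirichletUnitTheorem
open scoped ENNReal
open scoped Classical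

noncomputable section MellinPhi
set_option linter.unusedSectionVars false

/-- local Gaussian factor -/
def gloc (d : ℝ) (e : ℝ) : ℝ := Real.exp (-(Real.pi * d * Real.exp (2 * e / d)))

/-- local Mellin factor -/
def MM (d : ℝ) (s : ℂ) : ℂ :=
  (d / 2 : ℝ) * Complex.exp (-(s * d / 2) * (Real.log (Real.pi * d) : ℝ)) * Complex.Gamma (s * d / 2)

lemma MM_ne_zero {d : ℝ} (hd : 0 < d) {s : ℂ} (hs : 0 < s.re) : MM d s ≠ 0 := by
  unfold MM
  refine mul_ne_zero (mul_ne_zero ?_ (Complex.exp_ne_zero _)) ?_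
  · exact_mod_cast (by positivity : (d / 2) ≠ 0)
  · apply Complex.Gamma_ne_zero_of_re_pos
    have : (s * d / 2).re = s.re * d / 2 := by
      rw [show (s * d / 2) = ((d / 2 : ℝ) : ℂ) * s by push_cast; ring, Complex.re_ofReal_mul]; ring
    rw [this]; positivity

lemma integral_gloc {d : ℝ} (hd : 0 < d) {s : ℂ} (hs : 0 < s.re) :
    ∫ e : ℝ, (gloc d e : ℂ) * Complex.exp (s * e) = MM d s := by
  have hre : (s * d / 2).re = s.re * d / 2 := by
    rw [show (s * d / 2) = ((d / 2 : ℝ) : ℂ) * s by push_cast; ring, Complex.re_ofReal_mul]; ring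
  have h1 := Complex.integral_cpow_mul_exp_neg_mul_Ioi (a := s * d / 2) (r := (Real.pi * d : ℝ))
    (by rw [hre]; positivity) (by positivity)
  have himg : (fun e : ℝ => Real.exp (2 * e / d)) '' univ = Ioi 0 := by
    ext t
    simp only [image_univ, mem_range, mem_Ioi]
    constructor
    · rintro ⟨e, rfl⟩; exact Real.exp_pos _
    · intro ht
      refine ⟨d / 2 * Real.log t, ?_⟩
      rw [show 2 * (d / 2 * Real.log t) / d = Real.log t by field_simp, Real.exp_log ht]
  have hder : ∀ e ∈ (univ : Set ℝ), HasDerivWithinAt (fun e : ℝ => Real.exp (2 * e / d))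
      (Real.exp (2 * e / d) * (2 / d)) univ e := by
    intro e _
    have : HasDerivAt (fun e : ℝ => 2 * e / d) (2 / d) e := by
      simpa using ((hasDerivAt_id e).const_mul 2).div_const d
    exact this.exp.hasDerivWithinAt
  have hinj : InjOn (fun e : ℝ => Real.exp (2 * e / d)) univ := by
    intro a _ b _ hab
    have := Real.exp_injective hab
    field_simp at this
    linarith
  rw [← himg, integral_image_eq_integral_abs_deriv_smul MeasurableSet.univ hder hinj,
    setIntegral_univ] at h1
  have h2 : ∀ e : ℝ, |Real.exp (2 * e / d) * (2 / d)| •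
      ((Real.exp (2 * e / d) : ℂ) ^ (s * d / 2 - 1) * Complex.exp (-(((Real.pi * d : ℝ) : ℂ) * (Real.exp (2 * e / d) : ℝ))))
      = (2 / d : ℝ) * ((gloc d e : ℂ) * Complex.exp (s * e)) := by
    intro e
    rw [abs_of_pos (by positivity), Complex.real_smul, gloc, Complex.ofReal_mul, Complex.cpow_def_of_ne_zero
      (by exact_mod_cast (Real.exp_pos _).ne'), ← Complex.ofReal_log (Real.exp_pos _).le, Real.log_exp,
      Complex.ofReal_exp (2 * e / d), Complex.ofReal_exp (-_)]
    have hd' : (d : ℂ) ≠ 0 := by exact_mod_cast hd.ne'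
    have e3 : Complex.exp (s * e) = Complex.exp ((2 * e / d : ℝ)) *
        Complex.exp ((2 * e / d : ℝ) * (s * d / 2 - 1)) := by
      rw [← Complex.exp_add]; congr 1; push_cast; field_simp; ring
    rw [e3]
    push_cast
    ring
  simp_rw [h2] at h1
  rw [integral_const_mul] at h1
  have hd' : (d : ℂ) ≠ 0 := by exact_mod_cast hd.ne'
  have hpd : 0 < Real.pi * d := by positivity
  have h3 : (1 / ((Real.pi * d : ℝ) : ℂ)) ^ (s * d / 2) =
      Complex.exp (-(s * d / 2) * (Real.log (Real.pi * d) : ℝ)) := by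
    rw [show (1 / ((Real.pi * d : ℝ) : ℂ)) = (((Real.pi * d)⁻¹ : ℝ) : ℂ) by push_cast; simp,
      Complex.cpow_def_of_ne_zero (by exact_mod_cast (inv_pos.2 hpd).ne'),
      ← Complex.ofReal_log (inv_pos.2 hpd).le, Real.log_inv]
    congr 1; push_cast; ring
  rw [h3] at h1
  rw [MM, mul_assoc, ← h1, ← mul_assoc]
  push_cast
  field_simp

lemma integrable_gloc {d : ℝ} (hd : 0 < d) {s : ℂ} (hs : 0 < s.re) :
    Integrable fun e : ℝ => (gloc d e : ℂ) * Complex.exp (s * e) := by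
  by_contra h
  have := integral_undef h
  rw [integral_gloc hd hs] at this
  exact MM_ne_zero hd hs this

variable (K : Type*) [Field K] [NumberField K]

/-- real version of phi -/
def phiR (u : ℝ) : ℝ := (phi K u).toReal

/-- global Mellin factor -/
def MK (s : ℂ) : ℂ := ∏ v : InfinitePlace K, MM v.mult s

variable {K}

lemma GK_eq (u : ℝ) (x : logSpace K) (s : ℂ) :
    (GK u x : ℂ) * Complex.exp (s * u) =
      (∏ w : {w : InfinitePlace K // w ≠ w₀}, (gloc w.1.mult (x w) : ℂ) * Complex.exp (s * x w)) *
      ((gloc (w₀ : InfinitePlace K).mult (u - ∑ w, x w) : ℂ) * Complex.exp (s * (u - ∑ w, x w : ℝ))) := by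
  have h1 : GK u x = ∏ v : InfinitePlace K, gloc v.mult (ev u x v) := by
    unfold GK gloc
    rw [← Real.exp_sum, Finset.mul_sum]
    congr 1
    refine Finset.sum_congr rfl fun v _ => ?_
    ring
  have h2 : Complex.exp (s * u) = ∏ v : InfinitePlace K, Complex.exp (s * ev u x v) := by
    rw [← Complex.exp_sum, ← Finset.mul_sum]
    congr 2
    rw [← Complex.ofReal_sum, sum_ev]
  rw [h1, h2, Complex.ofReal_prod, ← Finset.prod_mul_distrib,
    Fintype.prod_eq_mul_prod_subtype_ne _ (w₀ : InfinitePlace K), mul_comm, ev_w0]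
  simp_rw [ev_ne]

lemma integrable_GK {s : ℂ} (hs : 0 < s.re) :
    Integrable (fun p : ℝ × logSpace K => (GK p.1 p.2 : ℂ) * Complex.exp (s * p.1)) (volume.prod volume) := by
  have hc : Continuous (fun p : ℝ × logSpace K => (GK p.1 p.2 : ℂ) * Complex.exp (s * p.1)) :=
    (Complex.continuous_ofReal.comp continuous_GK).mul (by fun_prop)
  rw [integrable_prod_iff' hc.aestronglyMeasurable]
  constructor
  · refine ae_of_all _ fun x => ?_
    simp only [GK_eq]
    apply Integrable.const_mul
    have := (integrable_gloc (mult_pos' (w₀ : InfinitePlace K)) hs).comp_sub_right (∑ w, x w)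
    exact this
  · simp only [GK_eq, norm_mul _ ((_ : ℂ) * _), norm_prod]
    have h1 : ∀ x : logSpace K, ∫ u : ℝ, (∏ w : {w : InfinitePlace K // w ≠ w₀}, ‖(gloc w.1.mult (x w) : ℂ) * Complex.exp (s * x w)‖) *
      ‖((gloc (w₀ : InfinitePlace K).mult (u - ∑ w, x w) : ℂ) * Complex.exp (s * (u - ∑ w, x w : ℝ)))‖ =
      (∏ w : {w : InfinitePlace K // w ≠ w₀}, ‖(gloc w.1.mult (x w) : ℂ) * Complex.exp (s * x w)‖) *
       ∫ u : ℝ, ‖((gloc (w₀ : InfinitePlace K).mult u : ℂ) * Complex.exp (s * u))‖ := by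
      intro x
      rw [integral_const_mul]
      congr 1
      exact integral_sub_right_eq_self (fun u : ℝ => ‖((gloc (w₀ : InfinitePlace K).mult u : ℂ) * Complex.exp (s * u))‖) _
    simp_rw [h1]
    apply Integrable.mul_const
    exact Integrable.fintype_prod (μ := fun _ => (volume : Measure ℝ)) (f := fun (w : {w : InfinitePlace K // w ≠ w₀}) (e : ℝ) =>
      ‖(gloc w.1.mult e : ℂ) * Complex.exp (s * e)‖) (fun w => (integrable_gloc (mult_pos' w.1) hs).norm)

lemma phiR_eq (u : ℝ) : phiR K u = ∫ x : logSpace K, GK u x := by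
  rw [phiR, phi, integral_eq_lintegral_of_nonneg_ae (ae_of_all _ fun x => (GK_pos u x).le)
    (continuous_GK' u).aestronglyMeasurable]

lemma phiR_mul_exp (u : ℝ) (s : ℂ) :
    (phiR K u : ℂ) * Complex.exp (s * u) = ∫ x : logSpace K, (GK u x : ℂ) * Complex.exp (s * u) := by
  rw [phiR_eq, integral_mul_const, integral_complex_ofReal]

lemma integrable_phi {s : ℂ} (hs : 0 < s.re) :
    Integrable fun u : ℝ => (phiR K u : ℂ) * Complex.exp (s * u) := by
  simp_rw [phiR_mul_exp]
  exact (integrable_GK hs).integral_prod_left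

lemma integral_phi {s : ℂ} (hs : 0 < s.re) :
    ∫ u : ℝ, (phiR K u : ℂ) * Complex.exp (s * u) = MK K s := by
  simp_rw [phiR_mul_exp]
  rw [integral_integral_swap (integrable_GK hs)]
  have h1 : ∀ x : logSpace K, ∫ u : ℝ, (GK u x : ℂ) * Complex.exp (s * u) =
      (∏ w : {w : InfinitePlace K // w ≠ w₀}, (gloc w.1.mult (x w) : ℂ) * Complex.exp (s * x w)) *
       MM (w₀ : InfinitePlace K).mult s := by
    intro x
    simp_rw [GK_eq]
    rw [integral_const_mul]
    congr 1
    rw [← integral_gloc (mult_pos' (w₀ : InfinitePlace K)) hs]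
    exact integral_sub_right_eq_self (fun u : ℝ => ((gloc (w₀ : InfinitePlace K).mult u : ℂ) * Complex.exp (s * u))) _
  simp_rw [h1]
  rw [integral_mul_const, integral_fintype_prod_volume_eq_prod (f := fun (w : {w : InfinitePlace K // w ≠ w₀}) (e : ℝ) =>
      (gloc w.1.mult e : ℂ) * Complex.exp (s * e)), MK,
    Fintype.prod_eq_mul_prod_subtype_ne _ (w₀ : InfinitePlace K), mul_comm]
  congr 1
  exact Finset.prod_congr rfl fun w _ => integral_gloc (mult_pos' w.1) hs

end MellinPhi

end ModP6

section ModP7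
open MeasureTheory Set Filter Topology

noncomputable section StripShift

/-- holomorphic with quadratic decay on a closed vertical strip -/
def StripNice (a b : ℝ) (f : ℂ → ℂ) : Prop :=
  DifferentiableOn ℂ f (Complex.re ⁻¹' Icc a b) ∧
    ∃ C : ℝ, ∀ z : ℂ, z.re ∈ Icc a b → ‖f z‖ ≤ C * (1 + z.im ^ 2)⁻¹

/-- point on vertical line -/
def vl (a y : ℝ) : ℂ := (a : ℂ) + (y : ℂ) * Complex.I

@[simp] lemma vl_re (a y : ℝ) : (vl a y).re = a := by simp [vl]
@[simp] lemma vl_im (a y : ℝ) : (vl a y).im = y := by simp [vl]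
lemma continuous_vl (a : ℝ) : Continuous (vl a) := by unfold vl; fun_prop

lemma StripNice.continuous {a b : ℝ} {f : ℂ → ℂ} (h : StripNice a b f) {x : ℝ} (hx : x ∈ Icc a b) :
    Continuous fun y : ℝ => f (vl x y) := by
  have := h.1.continuousOn
  exact this.comp_continuous (continuous_vl x) (fun y => by simpa using hx)

lemma StripNice.integrable {a b : ℝ} {f : ℂ → ℂ} (h : StripNice a b f) {x : ℝ} (hx : x ∈ Icc a b) :
    Integrable fun y : ℝ => f (vl x y) := by
  obtain ⟨C, hC⟩ := h.2
  refine Integrable.mono' (integrable_inv_one_add_sq.const_mul C)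
    (h.continuous hx).aestronglyMeasurable (ae_of_all _ fun y => ?_)
  simpa using hC (vl x y) (by simpa using hx)

lemma strip_shift {a b : ℝ} {f : ℂ → ℂ} (h : StripNice a b f) {x x' : ℝ} (hx : x ∈ Icc a b)
    (hx' : x' ∈ Icc a b) : ∫ y : ℝ, f (vl x y) = ∫ y : ℝ, f (vl x' y) := by
  wlog hxx : x ≤ x' generalizing x x'
  · exact (this hx' hx (le_of_not_ge hxx)).symm
  obtain ⟨C, hC⟩ := h.2
  have hC0 : 0 ≤ C := by
    have h1 := (norm_nonneg _).trans (hC (vl x 0) (by simpa using hx))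
    simpa using h1
  have rect : ∀ T : ℝ, Complex.I • ((∫ y in (-T)..T, f (vl x' y)) - (∫ y in (-T)..T, f (vl x y))) =
      (∫ r in x..x', f (vl r T)) - (∫ r in x..x', f (vl r (-T))) := by
    intro T
    have := Complex.integral_boundary_rect_eq_zero_of_differentiableOn f (vl x (-T)) (vl x' T) (by
      refine h.1.mono ?_
      intro z hz
      have := hz.1
      simp only [mem_preimage, vl_re, uIcc_of_le hxx] at this
      exact ⟨hx.1.trans this.1, this.2.trans hx'.2⟩)
    simp only [vl_re, vl_im] at this
    simp only [vl] at this ⊢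
    rw [smul_sub]
    linear_combination this
  have lim1 : ∀ {r : ℝ}, r ∈ Icc a b → Tendsto (fun T : ℝ => ∫ y in (-T)..T, f (vl r y)) atTop
      (𝓝 (∫ y : ℝ, f (vl r y))) := fun hr =>
    intervalIntegral_tendsto_integral (h.integrable hr) tendsto_neg_atTop_atBot tendsto_id
  have hz : Tendsto (fun T : ℝ => C * (1 + T ^ 2)⁻¹ * |x' - x| + C * (1 + T ^ 2)⁻¹ * |x' - x|) atTop (𝓝 0) := by
    have h1 : Tendsto (fun T : ℝ => (1 + T ^ 2)⁻¹) atTop (𝓝 0) :=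
      tendsto_inv_atTop_zero.comp (tendsto_atTop_add_const_left _ _ (tendsto_pow_atTop (by norm_num)))
    have := (h1.const_mul C).mul_const |x' - x|
    simpa using this.add this
  have hn : ∀ T s : ℝ, s ^ 2 = T ^ 2 → ‖∫ r in x..x', f (vl r s)‖ ≤ C * (1 + T ^ 2)⁻¹ * |x' - x| := by
    intro T s hs
    refine intervalIntegral.norm_integral_le_of_norm_le_const fun r hr => ?_
    rw [uIoc_of_le hxx] at hr
    have := hC (vl r s) (by simpa using ⟨hx.1.trans hr.1.le, hr.2.trans hx'.2⟩)
    simpa [hs] using this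
  have lim2 : Tendsto (fun T : ℝ => (∫ r in x..x', f (vl r T)) - (∫ r in x..x', f (vl r (-T)))) atTop (𝓝 0) := by
    refine squeeze_zero_norm (fun T => ?_) hz
    exact (norm_sub_le _ _).trans (add_le_add (hn T T rfl) (hn T (-T) (by ring)))
  have lim3 := ((lim1 hx').sub (lim1 hx)).const_smul Complex.I
  have := tendsto_nhds_unique (lim3.congr rect) lim2
  rw [smul_eq_zero] at this
  rcases this with h | h
  · exact absurd h Complex.I_ne_zero
  · exact (sub_eq_zero.1 h).symm

lemma integral_inv_csq {c : ℝ} (hc : 0 < c) : ∫ y : ℝ, (c ^ 2 + y ^ 2)⁻¹ = Real.pi / c := by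
  have h1 : ∀ y : ℝ, (c ^ 2 + y ^ 2)⁻¹ = (c ^ 2)⁻¹ * (1 + (y / c) ^ 2)⁻¹ := by
    intro y; field_simp
  simp_rw [h1]
  rw [integral_const_mul, Measure.integral_comp_div (fun y : ℝ => (1 + y ^ 2)⁻¹), integral_univ_inv_one_add_sq,
    abs_of_pos hc, smul_eq_mul]
  field_simp

lemma integrable_inv_sq_add_sq {c : ℝ} (hc : 0 < c) : Integrable fun y : ℝ => (c ^ 2 + y ^ 2)⁻¹ := by
  by_contra h
  have := integral_undef h
  rw [integral_inv_csq hc] at this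
  have : 0 < Real.pi / c := by positivity
  linarith

/-- functions with quadratic decay on a left half plane have zero vertical integrals -/
lemma left_vanish {f : ℂ → ℂ} (hd : DifferentiableOn ℂ f (Complex.re ⁻¹' Iio 0)) {C : ℝ}
    (hC : ∀ z : ℂ, z.re < 0 → ‖f z‖ ≤ C * (z.re ^ 2 + z.im ^ 2)⁻¹) {e : ℝ} (he : 0 < e) :
    ∫ y : ℝ, f (vl (-e) y) = 0 := by
  have hC0 : 0 ≤ C := by
    have h1 := (norm_nonneg _).trans (hC (-1) (by simp))
    simpa using h1
  have hX : ∀ X : ℝ, e ≤ X → ‖∫ y : ℝ, f (vl (-e) y)‖ ≤ C * (Real.pi / X) := by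
    intro X hX
    have hX0 : 0 < X := by linarith
    have hn : StripNice (-X) (-e) f := by
      refine ⟨hd.mono fun z hz => ?_, C * (1 + (e ^ 2)⁻¹), fun z hz => ?_⟩
      · have := hz.2
        simp only [mem_preimage, mem_Iio]; linarith
      · have hz2 := hz.2
        refine (hC z (by linarith)).trans ?_
        rw [mul_assoc]
        apply mul_le_mul_of_nonneg_left _ hC0
        have h1 : e ^ 2 ≤ z.re ^ 2 := by nlinarith
        have h2 : 0 < e ^ 2 := by positivity
        have h0 : 0 < z.re ^ 2 + z.im ^ 2 := by have := sq_nonneg z.im; linarith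
        rw [inv_le_iff_one_le_mul₀ h0, mul_comm, ← div_eq_mul_inv, mul_div_assoc',
          le_div_iff₀ (by positivity)]
        have h3 : (1 + (e ^ 2)⁻¹) * e ^ 2 = e ^ 2 + 1 := by field_simp
        have h4 : 0 < (e ^ 2)⁻¹ := by positivity
        have h5 : (e^2)⁻¹ * (z.re ^ 2) ≥ 1 := by
          rw [ge_iff_le, ← div_eq_inv_mul, le_div_iff₀ h2]; linarith
        nlinarith [sq_nonneg z.im, sq_nonneg z.re]
    rw [strip_shift hn (x := -e) (x' := -X) ⟨by linarith, le_rfl⟩ ⟨le_rfl, by linarith⟩]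
    refine (norm_integral_le_of_norm_le ((integrable_inv_sq_add_sq hX0).const_mul C)
      (ae_of_all _ fun y => ?_)).trans ?_
    · simpa using hC (vl (-X) y) (by simpa using hX0)
    · rw [integral_const_mul, integral_inv_csq hX0]
  have lim : Tendsto (fun X : ℝ => C * (Real.pi / X)) atTop (𝓝 0) := by
    have := (tendsto_inv_atTop_zero (𝕜 := ℝ)).const_mul (C * Real.pi)
    simpa [mul_assoc, div_eq_mul_inv] using this
  have : ‖∫ y : ℝ, f (vl (-e) y)‖ ≤ 0 :=
    ge_of_tendsto lim (eventually_atTop.2 ⟨e, hX⟩)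
  exact norm_le_zero_iff.1 this

end StripShift

end ModP7

section ModP8
open MeasureTheory Set Filter Topology

noncomputable section GammaBounds

lemma norm_Gamma_le {s : ℂ} (hs : 0 < s.re) : ‖Complex.Gamma s‖ ≤ Real.Gamma s.re := by
  rw [Complex.Gamma_eq_integral hs, Real.Gamma_eq_integral hs, Complex.GammaIntegral]
  refine (norm_integral_le_integral_norm _).trans (le_of_eq ?_)
  refine setIntegral_congr_fun measurableSet_Ioi fun x hx => ?_
  have hx : 0 < x := hx
  simp only [norm_mul, Complex.norm_real, Real.norm_eq_abs, abs_of_pos (Real.exp_pos _)]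
  rw [Complex.norm_cpow_eq_rpow_re_of_pos hx]
  simp

lemma norm_sin_le (z : ℂ) : ‖Complex.sin z‖ ≤ Real.exp |z.im| := by
  rw [Complex.sin, norm_div, norm_mul, Complex.norm_I, mul_one]
  have h1 : ‖Complex.exp (-z * Complex.I)‖ ≤ Real.exp |z.im| := by
    rw [Complex.norm_exp]; gcongr; simp [le_abs_self]
  have h2 : ‖Complex.exp (z * Complex.I)‖ ≤ Real.exp |z.im| := by
    rw [Complex.norm_exp]; gcongr; simp [neg_le_abs]
  have h3 := norm_sub_le (Complex.exp (-z * Complex.I)) (Complex.exp (z * Complex.I))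
  simp only [Complex.norm_ofNat]
  linarith

lemma Gamma_bdd_Icc {a b : ℝ} (ha : 0 < a) : ∃ C, 0 < C ∧ ∀ x ∈ Icc a b, Real.Gamma x ≤ C := by
  have hc : ContinuousOn Real.Gamma (Icc a b) := fun x hx =>
    ((Real.differentiableAt_Gamma fun m => by
      have := hx.1; have h2 : (0:ℝ) ≤ m := m.cast_nonneg; intro h; linarith).continuousAt).continuousWithinAt
  obtain ⟨C, hC⟩ := (isCompact_Icc.bddAbove_image hc)
  exact ⟨max C 1, by positivity, fun x hx => (hC ⟨x, hx, rfl⟩).trans (le_max_left _ _)⟩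

lemma norm_inv_Gamma_le : ∃ C : ℝ, 0 < C ∧ ∀ s : ℂ, s.re ∈ Icc (1/2 : ℝ) 4 →
    ‖(Complex.Gamma s)⁻¹‖ ≤ C * Real.exp (Real.pi * |s.im|) := by
  obtain ⟨C1, hC1, h1⟩ := Gamma_bdd_Icc (a := 1) (b := 9/2) one_pos
  have hcpt : IsCompact (Icc (1/2 : ℝ) 4 ×ℂ Icc (-1 : ℝ) 1) := isCompact_Icc.reProdIm isCompact_Icc
  obtain ⟨C2, hC2⟩ := hcpt.exists_bound_of_continuousOn Complex.differentiable_one_div_Gamma.continuous.continuousOn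
  refine ⟨max C1 C2, lt_max_of_lt_left hC1, fun s hs => ?_⟩
  by_cases him : |s.im| ≤ 1
  · have := hC2 s ⟨hs, abs_le.1 him⟩
    refine this.trans ((le_max_right C1 C2).trans ?_)
    have : 1 ≤ Real.exp (Real.pi * |s.im|) := Real.one_le_exp (by positivity)
    have hm : 0 < max C1 C2 := lt_max_of_lt_left hC1
    nlinarith
  · push Not at him
    have him0 : s.im ≠ 0 := by intro h; simp [h] at him; linarith
    have hne : ∀ j : ℝ, (j : ℂ) - s ≠ 0 := fun j h => him0 (by
      have := congrArg Complex.im h; simpa using this)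
    have hnb : ∀ j : ℝ, 1 ≤ ‖(j : ℂ) - s‖ := fun j => by
      have := Complex.abs_im_le_norm ((j : ℂ) - s)
      simp at this; linarith
    have e1 := Complex.Gamma_mul_Gamma_one_sub s
    have hs0 : Complex.Gamma s ≠ 0 := Complex.Gamma_ne_zero_of_re_pos (by linarith [hs.1])
    have hsin : Complex.sin (Real.pi * s) ≠ 0 := by
      intro h
      rw [Complex.sin_eq_zero_iff] at h
      obtain ⟨k, hk⟩ := h
      have := congrArg Complex.im hk
      simp at this
      exact him0 this
    have g1 := Complex.Gamma_add_one (1 - s) (by simpa using hne 1)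
    have g2 := Complex.Gamma_add_one (2 - s) (by simpa using hne 2)
    have g3 := Complex.Gamma_add_one (3 - s) (by simpa using hne 3)
    have g4 := Complex.Gamma_add_one (4 - s) (by simpa using hne 4)
    rw [show (1 - s + 1) = 2 - s by ring] at g1
    rw [show (2 - s + 1) = 3 - s by ring] at g2
    rw [show (3 - s + 1) = 4 - s by ring] at g3
    rw [show (4 - s + 1) = 5 - s by ring] at g4
    have e2 : Complex.Gamma (5 - s) = (4 - s) * (3 - s) * (2 - s) * (1 - s) * Complex.Gamma (1 - s) := by
      rw [g4, g3, g2, g1]; ring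
    have n1 : ‖Complex.Gamma (1 - s)‖ ≤ C1 := by
      have hb : ‖Complex.Gamma (5 - s)‖ ≤ C1 := (norm_Gamma_le (by simp; linarith [hs.2])).trans
        (h1 _ (by constructor <;> simp <;> linarith [hs.1, hs.2]))
      rw [e2] at hb
      simp only [norm_mul] at hb
      have a1 := hnb 1
      have a2 := hnb 2
      have a3 := hnb 3
      have a4 := hnb 4
      push_cast at a1 a2 a3 a4
      have : 1 ≤ ‖4 - s‖ * ‖3 - s‖ * ‖2 - s‖ * ‖1 - s‖ :=
        one_le_mul_of_one_le_of_one_le (one_le_mul_of_one_le_of_one_le (one_le_mul_of_one_le_of_one_le a4 a3) a2) a1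
      have := mul_le_mul_of_nonneg_right this (norm_nonneg (Complex.Gamma (1 - s)))
      linarith
    have e3 : (Complex.Gamma s)⁻¹ = Complex.Gamma (1 - s) * Complex.sin (Real.pi * s) / Real.pi := by
      have hpi : (Real.pi : ℂ) ≠ 0 := by exact_mod_cast Real.pi_ne_zero
      rw [eq_div_iff hsin] at e1
      rw [inv_eq_one_div, div_eq_div_iff hs0 hpi]
      linear_combination -e1
    rw [e3, norm_div, norm_mul]
    have n2 := norm_sin_le (Real.pi * s)
    rw [Complex.im_ofReal_mul, abs_mul, abs_of_pos Real.pi_pos] at n2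
    have n3 : 1 ≤ ‖(Real.pi : ℂ)‖ := by
      rw [Complex.norm_real, Real.norm_eq_abs, abs_of_pos Real.pi_pos]; linarith [Real.pi_gt_three]
    calc _ ≤ ‖Complex.Gamma (1 - s)‖ * ‖Complex.sin (Real.pi * s)‖ := div_le_self (by positivity) n3
      _ ≤ C1 * Real.exp (Real.pi * |s.im|) := by gcongr
      _ ≤ _ := by gcongr; exact le_max_left _ _

end GammaBounds

end ModP8

section ModP9
open MeasureTheory Set Filter Topology

noncomputable section PosDef

/-- characteristic functions of finite measures -/
def PD (f : ℝ → ℂ) : Prop := ∃ μ : Measure ℝ, IsFiniteMeasure μ ∧ ∀ t, f t = charFun μ t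

lemma PD.mul {f g : ℝ → ℂ} (hf : PD f) (hg : PD g) : PD fun t => f t * g t := by
  obtain ⟨μ, hμ, h1⟩ := hf
  obtain ⟨ν, hν, h2⟩ := hg
  exact ⟨Measure.conv μ ν, inferInstance, fun t => by simp only [charFun_conv, h1, h2]⟩

lemma PD_exp (v : ℝ) : PD fun t => Complex.exp (t * v * Complex.I) :=
  ⟨Measure.dirac v, inferInstance, fun t => by rw [charFun_apply_real, integral_dirac]⟩

lemma PD_const {c : ℝ} (hc : 0 ≤ c) : PD fun _ => (c : ℂ) := by
  refine ⟨ENNReal.ofReal c • Measure.dirac 0, ?_, fun t => ?_⟩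
  · exact Measure.smul_finite _ ENNReal.ofReal_ne_top
  · rw [charFun_apply_real, integral_smul_measure, integral_dirac, ENNReal.toReal_ofReal hc]
    simp

lemma PD.prod {ι : Type*} (s : Finset ι) {f : ι → ℝ → ℂ} (h : ∀ i ∈ s, PD (f i)) :
    PD fun t => ∏ i ∈ s, f i t := by
  classical
  induction s using Finset.induction_on with
  | empty => simpa using PD_const (c := 1) zero_le_one
  | insert a s ha ih =>
    simp_rw [Finset.prod_insert ha]
    exact (h a (Finset.mem_insert_self _ _)).mul (ih fun i hi => h i (Finset.mem_insert_of_mem hi))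

lemma PD_beta {p q : ℝ} (hp : 0 < p) (hpq : p < q) (h : ℝ) :
    PD fun t => Complex.Gamma (p - h * t * Complex.I) / Complex.Gamma (q - h * t * Complex.I) := by
  set w : ℝ → ℝ := fun x => x ^ (p - 1) * (1 - x) ^ (q - p - 1) / Real.Gamma (q - p) with hw
  have hG : 0 < Real.Gamma (q - p) := Real.Gamma_pos_of_pos (by linarith)
  have hwm : Measurable w := by fun_prop
  have hIntg : IntegrableOn w (Ioo 0 1) := by
    have h1 := Complex.betaIntegral_convergent (u := p) (v := (q - p : ℝ)) (by simpa) (by simpa using hpq)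
    rw [intervalIntegrable_iff_integrableOn_Ioo_of_le zero_le_one] at h1
    have h2 := (h1.norm).div_const (Real.Gamma (q - p))
    refine IntegrableOn.congr_fun (f := fun x : ℝ => ‖(x : ℂ) ^ ((p : ℂ) - 1) * (1 - (x : ℂ)) ^ (((q - p : ℝ) : ℂ) - 1)‖ / Real.Gamma (q - p)) h2 (fun x hx => ?_) measurableSet_Ioo
    simp only [hw, norm_mul]
    rw [show (1 - (x : ℂ)) = ((1 - x : ℝ) : ℂ) by push_cast; ring,
      Complex.norm_cpow_eq_rpow_re_of_pos hx.1, Complex.norm_cpow_eq_rpow_re_of_pos (by linarith [hx.2])]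
    simp
  set ν : Measure ℝ := (volume.restrict (Ioo 0 1)).withDensity (fun x => ENNReal.ofReal (w x)) with hν
  have : IsFiniteMeasure ν := isFiniteMeasure_withDensity_ofReal hIntg.2
  have hm : Measurable fun x : ℝ => -h * Real.log x := by fun_prop
  refine ⟨ν.map (fun x => -h * Real.log x), inferInstance, fun t => ?_⟩
  rw [charFun_apply_real, integral_map hm.aemeasurable (by fun_prop), hν,
    integral_withDensity_eq_integral_toReal_smul (by fun_prop) (ae_of_all _ fun _ => ENNReal.ofReal_lt_top)]
  have hre : ∀ x : ℝ, ((x : ℂ) - h * t * Complex.I).re = x := by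
    intro x
    rw [show (x : ℂ) - h * t * Complex.I = ((x : ℝ) : ℂ) - ((h * t : ℝ) : ℂ) * Complex.I by push_cast; ring]
    simp
  have hb := Complex.Gamma_mul_Gamma_eq_betaIntegral (s := p - h * t * Complex.I) (t := (q - p : ℝ))
    (by rw [hre]; exact hp) (by simpa using hpq)
  rw [show (p : ℂ) - h * t * Complex.I + (q - p : ℝ) = q - h * t * Complex.I by push_cast; ring] at hb
  have hq0 : Complex.Gamma (q - h * t * Complex.I) ≠ 0 :=
    Complex.Gamma_ne_zero_of_re_pos (by rw [hre]; linarith)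
  have hG0 : (Real.Gamma (q - p) : ℂ) ≠ 0 := by exact_mod_cast hG.ne'
  rw [Complex.Gamma_ofReal] at hb
  have e1 : Complex.Gamma (p - h * t * Complex.I) / Complex.Gamma (q - h * t * Complex.I) =
      Complex.betaIntegral (p - h * t * Complex.I) (q - p : ℝ) / (Real.Gamma (q - p) : ℝ) := by
    rw [div_eq_div_iff hq0 hG0, hb]; ring
  beta_reduce
  rw [e1, Complex.betaIntegral, intervalIntegral.integral_of_le zero_le_one, integral_Ioc_eq_integral_Ioo,
    ← integral_div]
  refine setIntegral_congr_fun measurableSet_Ioo fun x hx => ?_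
  have hx0 : (x : ℂ) ≠ 0 := by exact_mod_cast hx.1.ne'
  have hw0 : 0 ≤ w x := by
    have h1 := hx.1
    have h2 : 0 < 1 - x := by linarith [hx.2]
    simp only [hw]; positivity
  rw [ENNReal.toReal_ofReal hw0, Complex.real_smul]
  simp only [hw]
  push_cast
  rw [Complex.ofReal_cpow hx.1.le, Complex.ofReal_cpow (by linarith [hx.2])]
  rw [show (p : ℂ) - h * t * Complex.I - 1 = (p - 1) + (-(h * t * Complex.I)) by ring, Complex.cpow_add _ _ hx0,
    Complex.cpow_def_of_ne_zero hx0 (-_), ← Complex.ofReal_log hx.1.le]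
  rw [show (Real.log x : ℂ) * -(h * t * Complex.I) = t * (-h * Real.log x) * Complex.I by ring]
  push_cast
  ring

lemma PD_inv {p : ℝ} (hp : 0 < p) (h : ℝ) : PD fun t => ((p : ℂ) - h * t * Complex.I)⁻¹ := by
  have := PD_beta hp (lt_add_one p) h
  convert this using 2 with t
  have hre : ((p : ℂ) - h * t * Complex.I).re = p := by
    rw [show (p : ℂ) - h * t * Complex.I = ((p : ℝ) : ℂ) - ((h * t : ℝ) : ℂ) * Complex.I by push_cast; ring]
    simp
  have h0 : (p : ℂ) - h * t * Complex.I ≠ 0 := by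
    intro h; rw [h] at hre; simp at hre; linarith
  have hG : Complex.Gamma (p - h * t * Complex.I) ≠ 0 :=
    Complex.Gamma_ne_zero_of_re_pos (by rw [hre]; exact hp)
  rw [show ((p + 1 : ℝ) : ℂ) - h * t * Complex.I = (p - h * t * Complex.I) + 1 by push_cast; ring,
    Complex.Gamma_add_one _ h0]
  field_simp

lemma PD.gauss {f : ℝ → ℂ} (hf : PD f) {η : ℝ} (hη : 0 < η) :
    ∃ r : ℝ, 0 ≤ r ∧ ∫ t : ℝ, f t * Complex.exp (-η * (t : ℂ) ^ 2) = r := by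
  obtain ⟨μ, hμ, h1⟩ := hf
  have e1 : ∀ t : ℝ, f t * Complex.exp (-η * (t : ℂ) ^ 2) =
      ∫ x : ℝ, Complex.exp (t * x * Complex.I) * Complex.exp (-η * (t : ℂ) ^ 2) ∂μ := by
    intro t; rw [integral_mul_const, h1, charFun_apply_real]
  have hg : Integrable fun t : ℝ => Complex.exp (-η * (t : ℂ) ^ 2) :=
    integrable_cexp_neg_mul_sq (b := (η : ℂ)) (by simpa using hη)
  simp_rw [e1]
  rw [integral_integral_swap]
  · have e2 : ∀ x : ℝ, ∫ t : ℝ, Complex.exp (t * x * Complex.I) * Complex.exp (-η * (t : ℂ) ^ 2) =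
        (((Real.pi / η) ^ (1 / 2 : ℝ) * Real.exp (-x ^ 2 / (4 * η)) : ℝ) : ℂ) := by
      intro x
      have := fourierIntegral_gaussian (b := (η : ℂ)) (by simpa using hη) x
      rw [Complex.ofReal_mul, Complex.ofReal_cpow (by positivity)]
      push_cast
      rw [← this]
      congr 1; ext t; congr 2; ring
    simp_rw [e2]
    rw [integral_complex_ofReal]
    exact ⟨_, integral_nonneg fun x => by positivity, rfl⟩
  · have h2 : Integrable (fun z : ℝ × ℝ => Complex.exp (-η * (z.1 : ℂ) ^ 2) * (1 : ℂ)) (volume.prod μ) :=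
      hg.mul_prod (integrable_const (1 : ℂ))
    refine h2.mono (by fun_prop) (ae_of_all _ fun z => ?_)
    simp only [Function.uncurry, norm_mul, mul_one]
    rw [show (z.1 : ℂ) * z.2 * Complex.I = ((z.1 * z.2 : ℝ) : ℂ) * Complex.I by push_cast; ring,
      Complex.norm_exp_ofReal_mul_I]
    simp

end PosDef

end ModP9

section ModP10
open MeasureTheory Set Filter Topology

noncomputable section Contour

/-- the contour kernel -/
def KK (c : ℝ) (z : ℂ) : ℂ := (c : ℂ) ^ 2 / (z ^ 2 * ((c : ℂ) ^ 2 - z ^ 2))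

lemma sq_sub_ne {c : ℝ} {z : ℂ} (h : |z.re| < c) : (c : ℂ) ^ 2 - z ^ 2 ≠ 0 := by
  rw [abs_lt] at h
  have h1 : (c : ℂ) - z ≠ 0 := fun h0 => by
    have := congrArg Complex.re h0; simp at this; linarith
  have h2 : (c : ℂ) + z ≠ 0 := fun h0 => by
    have := congrArg Complex.re h0; simp at this; linarith
  rw [show (c : ℂ) ^ 2 - z ^ 2 = (c - z) * (c + z) by ring]
  exact mul_ne_zero h1 h2

lemma norm_sq_sub_ge {c e : ℝ} (he : e < c) {z : ℂ} (hz : |z.re| ≤ e) :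
    (c - e) ^ 2 + z.im ^ 2 ≤ ‖(c : ℂ) ^ 2 - z ^ 2‖ := by
  rw [show (c : ℂ) ^ 2 - z ^ 2 = (c - z) * (c + z) by ring, norm_mul]
  have hb : ∀ w : ℂ, |w.re| ≤ e → Real.sqrt ((c - e) ^ 2 + w.im ^ 2) ≤ ‖(c : ℂ) + w‖ := by
    intro w hw
    rw [abs_le] at hw
    rw [Complex.norm_eq_sqrt_sq_add_sq]
    apply Real.sqrt_le_sqrt
    simp
    nlinarith
  have h1 := hb z hz
  have h2 := hb (-z) (by simpa using hz)
  simp only [Complex.neg_im, even_two, Even.neg_pow, ← sub_eq_add_neg] at h2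
  calc _ = Real.sqrt ((c - e) ^ 2 + z.im ^ 2) * Real.sqrt ((c - e) ^ 2 + z.im ^ 2) :=
        (Real.mul_self_sqrt (by positivity)).symm
    _ ≤ _ := mul_le_mul h2 h1 (Real.sqrt_nonneg _) (norm_nonneg _)

lemma inv_add_sq_le {m : ℝ} (hm : 0 < m) : ∃ C : ℝ, 0 < C ∧ ∀ y : ℝ, (m + y ^ 2)⁻¹ ≤ C * (1 + y ^ 2)⁻¹ := by
  refine ⟨1 + m⁻¹, by positivity, fun y => ?_⟩
  rw [inv_le_iff_one_le_mul₀ (by positivity), mul_comm, ← div_eq_mul_inv, mul_div_assoc',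
    le_div_iff₀ (by positivity)]
  have : m * m⁻¹ = 1 := by field_simp
  have : 0 < m⁻¹ := by positivity
  nlinarith [sq_nonneg y, mul_nonneg this.le (sq_nonneg y)]

lemma stripNice_inv {c e : ℝ} (he0 : 0 ≤ e) (he : e < c) : StripNice (-e) e fun z => ((c : ℂ) ^ 2 - z ^ 2)⁻¹ := by
  have h0 : (0 : ℝ) < (c - e) ^ 2 := by have : 0 < c - e := by linarith
                                        positivity
  obtain ⟨C, hC, h⟩ := inv_add_sq_le h0
  refine ⟨?_, C, fun z hz => ?_⟩
  · intro z hz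
    refine DifferentiableWithinAt.inv (by fun_prop) (sq_sub_ne ?_)
    exact (abs_le.2 hz).trans_lt he
  · rw [norm_inv]
    refine le_trans ?_ (h z.im)
    apply inv_anti₀ (by positivity)
    exact norm_sq_sub_ge he (abs_le.2 hz)

lemma integral_inv_line {c e : ℝ} (he0 : 0 < e) (he : e < c) :
    ∫ y : ℝ, ((c : ℂ) ^ 2 - (vl (-e) y) ^ 2)⁻¹ = ((Real.pi / c : ℝ) : ℂ) := by
  rw [strip_shift (stripNice_inv he0.le he) (x := -e) (x' := 0) ⟨le_rfl, by linarith⟩ ⟨by linarith, he0.le⟩,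
    ← integral_inv_csq (he0.trans he), ← integral_complex_ofReal]
  congr 1; ext y
  simp only [vl]
  push_cast
  rw [zero_add, mul_pow, Complex.I_sq]
  congr 1; ring

lemma integral_inv_sq_line {e : ℝ} (he0 : 0 < e) :
    ∫ y : ℝ, ((vl (-e) y) ^ 2)⁻¹ = 0 := by
  refine left_vanish (f := fun z => (z ^ 2)⁻¹) (C := 1) ?_ ?_ he0
  · intro z hz
    refine DifferentiableWithinAt.inv (by fun_prop) (pow_ne_zero _ ?_)
    intro h; simp [h] at hz
  · intro z hz
    rw [norm_inv, norm_pow, Complex.sq_norm, Complex.normSq_apply, one_mul, sq, sq]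

lemma integral_lin_line {c e : ℝ} (he0 : 0 < e) (hc : 0 < c) :
    ∫ y : ℝ, (c : ℂ) * (vl (-e) y * (c - vl (-e) y))⁻¹ = 0 := by
  have hre : ∀ z : ℂ, z.re < 0 → z ≠ 0 ∧ (c : ℂ) - z ≠ 0 := by
    intro z hz
    refine ⟨by rintro rfl; simp at hz, fun h0 => ?_⟩
    have := congrArg Complex.re h0; simp at this; linarith
  refine left_vanish (f := fun z => (c : ℂ) * (z * (c - z))⁻¹) (C := c) ?_ ?_ he0
  · intro z hz
    refine DifferentiableWithinAt.const_mul (DifferentiableWithinAt.inv (by fun_prop) ?_) _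
    exact mul_ne_zero (hre z hz).1 (hre z hz).2
  · intro z hz
    rw [norm_mul, norm_inv, norm_mul, Complex.norm_real, Real.norm_eq_abs, abs_of_pos hc]
    have h0 : 0 < z.re ^ 2 + z.im ^ 2 := by nlinarith [sq_nonneg z.im]
    gcongr
    have h1 : ‖z‖ ≤ ‖(c : ℂ) - z‖ := by
      rw [Complex.norm_eq_sqrt_sq_add_sq, Complex.norm_eq_sqrt_sq_add_sq]
      apply Real.sqrt_le_sqrt
      simp
      nlinarith
    calc z.re ^ 2 + z.im ^ 2 = ‖z‖ * ‖z‖ := by rw [← sq, Complex.sq_norm, Complex.normSq_apply]; ring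
      _ ≤ _ := by gcongr

lemma contour_ge {c e g ℓ : ℝ} (he0 : 0 < e) (hec : e < c) (heg : e < g) (hℓ : ℓ ≤ 0) {P : ℂ → ℂ}
    (hP : DifferentiableOn ℂ P (Complex.re ⁻¹' Ioo (-g) g))
    (hB : ∃ B : ℝ, ∀ z : ℂ, z.re ∈ Icc (-e) 0 → ‖P z‖ ≤ B)
    (hP0 : P 0 = 1) (hP1 : deriv P 0 = ℓ) (hP2 : ∀ y : ℝ, ‖P (vl 0 y)‖ ≤ 1) :
    Real.pi / c ≤ (∫ y : ℝ, P (vl (-e) y) * KK c (vl (-e) y)).re := by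
  have hc : 0 < c := he0.trans hec
  have hc0 : (c : ℂ) ≠ 0 := by exact_mod_cast hc.ne'
  set S := Complex.re ⁻¹' Ioo (-g) g with hS
  have hSo : IsOpen S := isOpen_Ioo.preimage Complex.continuous_re
  have hS0 : S ∈ 𝓝 (0 : ℂ) := hSo.mem_nhds (by simp [hS]; linarith)
  set Q : ℂ → ℂ := fun z => P z - 1 - ℓ * z - ℓ * z ^ 2 / c with hQ
  have hQd : DifferentiableOn ℂ Q S := by
    simp only [hQ]
    exact ((hP.sub (by fun_prop)).sub (by fun_prop)).sub (by fun_prop)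
  have hQ0 : Q 0 = 0 := by simp [hQ, hP0]
  have hQ1 : deriv Q 0 = 0 := by
    have h1 : HasDerivAt P ℓ 0 := by
      rw [← hP1]; exact (hP.differentiableAt hS0).hasDerivAt
    have h2 : HasDerivAt (fun z : ℂ => ℓ * z) (ℓ : ℂ) 0 := by simpa using (hasDerivAt_id (0:ℂ)).const_mul (ℓ : ℂ)
    have h3 : HasDerivAt (fun z : ℂ => ℓ * z ^ 2 / c) 0 0 := by
      simpa using ((hasDerivAt_pow 2 (0:ℂ)).const_mul (ℓ : ℂ)).div_const (c : ℂ)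
    have := (((h1.sub_const 1).sub h2).sub h3).deriv
    rw [sub_self, sub_zero] at this
    exact this
  set Q1 := dslope Q 0 with hQ1'
  set R := dslope Q1 0 with hR
  have hQ1d : DifferentiableOn ℂ Q1 S := (Complex.differentiableOn_dslope hS0).2 hQd
  have hRd : DifferentiableOn ℂ R S := (Complex.differentiableOn_dslope hS0).2 hQ1d
  have hQR : ∀ z, z ≠ 0 → Q z = z ^ 2 * R z := by
    intro z hz
    rw [hR, dslope_of_ne _ hz, slope_def_field, hQ1', dslope_same, hQ1, dslope_of_ne _ hz, slope_def_field, hQ0]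
    field_simp
    ring
  obtain ⟨B, hB⟩ := hB
  have hB0 : 0 ≤ B := (norm_nonneg _).trans (hB 0 (by simp [he0.le]))
  have hRb : ∃ B' : ℝ, 0 ≤ B' ∧ ∀ z : ℂ, z.re ∈ Icc (-e) 0 → ‖R z‖ ≤ B' := by
    have hcpt : IsCompact (Icc (-e) 0 ×ℂ Icc (-1 : ℝ) 1) := isCompact_Icc.reProdIm isCompact_Icc
    obtain ⟨C2, hC2⟩ := hcpt.exists_bound_of_continuousOn (hRd.continuousOn.mono (by
      intro z hz
      have := hz.1
      simp only [mem_preimage, mem_Icc] at this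
      exact ⟨by linarith, by linarith⟩))
    refine ⟨max C2 (B + 1 + |ℓ| + |ℓ| / c), le_max_of_le_right (by positivity), fun z hz => ?_⟩
    by_cases him : |z.im| ≤ 1
    · exact (hC2 z ⟨hz, abs_le.1 him⟩).trans (le_max_left _ _)
    · push Not at him
      have hz1 : 1 ≤ ‖z‖ := him.le.trans (Complex.abs_im_le_norm z)
      have hz0 : z ≠ 0 := by rintro rfl; simp at hz1; linarith
      refine le_trans ?_ (le_max_right _ _)
      have h1 : ‖Q z‖ ≤ B + 1 + |ℓ| * ‖z‖ + |ℓ| / c * ‖z‖ ^ 2 := by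
        have n1 := norm_sub_le (P z - 1 - ℓ * z) (ℓ * z ^ 2 / c)
        have n2 := norm_sub_le (P z - 1) (ℓ * z)
        have n3 := norm_sub_le (P z) 1
        have n4 := hB z hz
        have m1 : ‖(ℓ : ℂ) * z‖ = |ℓ| * ‖z‖ := by rw [norm_mul, Complex.norm_real, Real.norm_eq_abs]
        have m2 : ‖(ℓ : ℂ) * z ^ 2 / c‖ = |ℓ| / c * ‖z‖ ^ 2 := by
          rw [norm_div, norm_mul, norm_pow, Complex.norm_real, Complex.norm_real, Real.norm_eq_abs,
            Real.norm_eq_abs, abs_of_pos hc]; ring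
        rw [norm_one] at n3
        simp only [hQ]
        linarith
      rw [hQR z hz0, norm_mul, norm_pow] at h1
      have hzz : 1 ≤ ‖z‖ ^ 2 := one_le_pow₀ hz1
      have h3 : ‖z‖ ≤ ‖z‖ ^ 2 := by nlinarith
      have hl : 0 ≤ |ℓ| := abs_nonneg _
      have : ‖z‖ ^ 2 * ‖R z‖ ≤ ‖z‖ ^ 2 * (B + 1 + |ℓ| + |ℓ| / c) := by nlinarith
      exact le_of_mul_le_mul_left this (by positivity)
  obtain ⟨B', hB'0, hB'⟩ := hRb
  set F : ℂ → ℂ := fun z => (c : ℂ) ^ 2 * R z * ((c : ℂ) ^ 2 - z ^ 2)⁻¹ with hF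
  have hsn := stripNice_inv he0.le hec
  have hFn : StripNice (-e) 0 F := by
    refine ⟨?_, ?_⟩
    · refine DifferentiableOn.mul (DifferentiableOn.const_mul (hRd.mono ?_) _) (hsn.1.mono ?_)
      · intro z hz
        simp only [mem_preimage, mem_Icc] at hz
        exact ⟨by linarith, by linarith⟩
      · intro z hz
        simp only [mem_preimage, mem_Icc] at hz ⊢
        exact ⟨by linarith, by linarith⟩
    · obtain ⟨C, hC⟩ := hsn.2
      refine ⟨c ^ 2 * B' * C, fun z hz => ?_⟩
      have h1 := hC z ⟨hz.1, hz.2.trans he0.le⟩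
      have h2 := hB' z hz
      simp only [hF]
      rw [norm_mul, norm_mul, norm_pow, Complex.norm_real, Real.norm_eq_abs, abs_of_pos hc, mul_assoc (c ^ 2 * B')]
      gcongr
  have hFint := strip_shift hFn (x := -e) (x' := 0) ⟨le_rfl, by linarith⟩ ⟨by linarith, le_rfl⟩
  have hF0 : 0 ≤ (∫ y : ℝ, F (vl 0 y)).re := by
    have e1 : (∫ y : ℝ, F (vl 0 y)).re = ∫ y : ℝ, (F (vl 0 y)).re :=
      (Complex.reCLM.integral_comp_comm (hFn.integrable (x := 0) ⟨by linarith, le_rfl⟩)).symm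
    rw [e1]
    apply integral_nonneg_of_ae
    have : ∀ᵐ y : ℝ, y ≠ 0 := by simp [ae_iff]
    filter_upwards [this] with y hy
    have hz0 : vl 0 y ≠ 0 := fun h => hy (by have := congrArg Complex.im h; simpa using this)
    have hz2 : (vl 0 y) ^ 2 = ((-y ^ 2 : ℝ) : ℂ) := by
      simp only [vl]; push_cast; rw [zero_add, mul_pow, Complex.I_sq]; ring
    have e2 : F (vl 0 y) = ((-(c ^ 2 / (y ^ 2 * (c ^ 2 + y ^ 2))) : ℝ) : ℂ) * Q (vl 0 y) := by
      simp only [hF]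
      rw [hQR _ hz0, hz2]
      have : (y : ℂ) ≠ 0 := by exact_mod_cast hy
      have h3 : (c : ℂ) ^ 2 + (y : ℂ) ^ 2 ≠ 0 := by
        have : (c ^ 2 + y ^ 2 : ℝ) ≠ 0 := by positivity
        exact_mod_cast this
      push_cast
      rw [sub_neg_eq_add]
      field_simp
    rw [Pi.zero_apply, e2, Complex.re_ofReal_mul]
    apply mul_nonneg_of_nonpos_of_nonpos
    · have : 0 ≤ c ^ 2 / (y ^ 2 * (c ^ 2 + y ^ 2)) := by positivity
      linarith
    · simp only [hQ]
      rw [hz2, show (ℓ : ℂ) * ((-y ^ 2 : ℝ) : ℂ) / c = ((-(ℓ * y ^ 2 / c) : ℝ) : ℂ) by push_cast; ring]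
      simp only [Complex.sub_re, Complex.one_re, Complex.re_ofReal_mul, vl_re, Complex.ofReal_re]
      have h1 := (Complex.re_le_norm _).trans (hP2 y)
      have h2 : ℓ * y ^ 2 / c ≤ 0 := by
        apply div_nonpos_of_nonpos_of_nonneg _ hc.le
        exact mul_nonpos_of_nonpos_of_nonneg hℓ (sq_nonneg y)
      linarith
  have hvre : ∀ y : ℝ, vl (-e) y ≠ 0 := fun y h => by
    have := congrArg Complex.re h; simp at this; linarith
  have hcm : ∀ y : ℝ, (c : ℂ) - vl (-e) y ≠ 0 := fun y h => by
    have := congrArg Complex.re h; simp at this; linarith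
  have hcp : ∀ y : ℝ, (c : ℂ) + vl (-e) y ≠ 0 := fun y h => by
    have := congrArg Complex.re h; simp at this; linarith
  have hdec : ∀ y : ℝ, P (vl (-e) y) * KK c (vl (-e) y) = F (vl (-e) y) + (((vl (-e) y) ^ 2)⁻¹ +
      (((c : ℂ) ^ 2 - (vl (-e) y) ^ 2)⁻¹ + ℓ * ((c : ℂ) * (vl (-e) y * (c - vl (-e) y))⁻¹))) := by
    intro y
    have hP' : P (vl (-e) y) = (vl (-e) y) ^ 2 * R (vl (-e) y) + 1 + ℓ * vl (-e) y + ℓ * (vl (-e) y) ^ 2 / c := by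
      rw [← hQR _ (hvre y)]; simp only [hQ]; ring
    rw [hP']
    simp only [hF, KK]
    have h1 := hvre y
    have h2 := hcm y
    have h3 := hcp y
    generalize vl (-e) y = z at h1 h2 h3 ⊢
    rw [show (c : ℂ) ^ 2 - z ^ 2 = (c - z) * (c + z) by ring]
    field_simp
    ring
  have i1 := hFn.integrable (x := -e) ⟨le_rfl, by linarith⟩
  have i3 := hsn.integrable (x := -e) ⟨le_rfl, by linarith⟩
  have hbase := integrable_inv_sq_add_sq he0
  have i2 : Integrable fun y : ℝ => ((vl (-e) y) ^ 2)⁻¹ := by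
    refine hbase.mono' ?_ (ae_of_all _ fun y => ?_)
    · have := continuous_vl (-e)
      exact (Continuous.inv₀ (by fun_prop) fun y => pow_ne_zero _ (hvre y)).aestronglyMeasurable
    · rw [norm_inv, norm_pow, Complex.sq_norm, Complex.normSq_apply, vl_re, vl_im]
      apply le_of_eq; congr 1; ring
  have i4 : Integrable fun y : ℝ => (c : ℂ) * (vl (-e) y * (c - vl (-e) y))⁻¹ := by
    refine (hbase.const_mul c).mono' ?_ (ae_of_all _ fun y => ?_)
    · have := continuous_vl (-e)
      exact (continuous_const.mul (Continuous.inv₀ (by fun_prop) fun y => mul_ne_zero (hvre y) (hcm y))).aestronglyMeasurable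
    · rw [norm_mul, norm_inv, norm_mul, Complex.norm_real, Real.norm_eq_abs, abs_of_pos hc]
      gcongr
      have h1 : ‖vl (-e) y‖ ≤ ‖(c : ℂ) - vl (-e) y‖ := by
        rw [Complex.norm_eq_sqrt_sq_add_sq, Complex.norm_eq_sqrt_sq_add_sq]
        apply Real.sqrt_le_sqrt
        simp
        nlinarith
      calc e ^ 2 + y ^ 2 = ‖vl (-e) y‖ * ‖vl (-e) y‖ := by
            rw [← sq, Complex.sq_norm, Complex.normSq_apply, vl_re, vl_im]; ring
        _ ≤ _ := by gcongr
  simp_rw [hdec]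
  have i4' := i4.const_mul (ℓ : ℂ)
  have i34 : Integrable fun y : ℝ => ((c : ℂ) ^ 2 - (vl (-e) y) ^ 2)⁻¹ +
      ℓ * ((c : ℂ) * (vl (-e) y * (c - vl (-e) y))⁻¹) := i3.add i4'
  have i234 : Integrable fun y : ℝ => ((vl (-e) y) ^ 2)⁻¹ + (((c : ℂ) ^ 2 - (vl (-e) y) ^ 2)⁻¹ +
      ℓ * ((c : ℂ) * (vl (-e) y * (c - vl (-e) y))⁻¹)) := i2.add i34
  rw [integral_add i1 i234, integral_add i2 i34, integral_add i3 i4', integral_const_mul, integral_inv_sq_line he0, integral_inv_line he0 hec,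
    integral_lin_line he0 hc, hFint]
  simp only [Complex.add_re, Complex.zero_re, mul_zero, Complex.ofReal_re]
  linarith

end Contour

end ModP10

section ModP11
open MeasureTheory Set Filter Topology

noncomputable section Kernel

/-- inverse Mellin kernel -/
def mker (ω : ℂ → ℂ) (u : ℝ) : ℂ := ∫ y : ℝ, ω (vl (1/2) y) * Complex.exp (vl (1/2) y * u)

lemma norm_exp_vl (a y u : ℝ) : ‖Complex.exp (vl a y * u)‖ = Real.exp (a * u) := by
  rw [Complex.norm_exp]; simp [vl]

lemma StripNice.mul_exp {a b : ℝ} {ω : ℂ → ℂ} (h : StripNice a b ω) (u : ℝ) :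
    StripNice a b fun z => ω z * Complex.exp (z * u) := by
  obtain ⟨C, hC⟩ := h.2
  refine ⟨h.1.mul (by fun_prop), C * Real.exp (max (a * u) (b * u)), fun z hz => ?_⟩
  have h1 := hC z hz
  have h2 : ‖Complex.exp (z * u)‖ ≤ Real.exp (max (a * u) (b * u)) := by
    rw [Complex.norm_exp]
    apply Real.exp_le_exp.2
    simp only [Complex.mul_re, Complex.ofReal_re, Complex.ofReal_im, mul_zero, sub_zero]
    rcases le_total 0 u with hu | hu
    · exact le_max_of_le_right (mul_le_mul_of_nonneg_right hz.2 hu)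
    · exact le_max_of_le_left (mul_le_mul_of_nonpos_right hz.1 hu)
  rw [norm_mul]
  calc _ ≤ (C * (1 + z.im ^ 2)⁻¹) * Real.exp (max (a * u) (b * u)) :=
        mul_le_mul h1 h2 (norm_nonneg _) ((norm_nonneg _).trans h1)
    _ = _ := by ring

variable {a b : ℝ} {ω : ℂ → ℂ}

lemma ker_eq (h : StripNice a b ω) (hab : (1/2 : ℝ) ∈ Icc a b) {σ : ℝ} (hσ : σ ∈ Icc a b) (u : ℝ) :
    mker ω u = ∫ y : ℝ, ω (vl σ y) * Complex.exp (vl σ y * u) :=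
  strip_shift (h.mul_exp u) hab hσ

lemma ker_bound (h : StripNice a b ω) (hab : (1/2 : ℝ) ∈ Icc a b) : ∃ C : ℝ, 0 ≤ C ∧ ∀ σ ∈ Icc a b, ∀ u : ℝ,
    ‖mker ω u‖ ≤ C * Real.exp (σ * u) := by
  obtain ⟨C, hC⟩ := h.2
  have hC0 : 0 ≤ C := by
    have h1 := (norm_nonneg _).trans (hC (vl (1/2) 0) (by simpa using hab))
    simpa using h1
  refine ⟨C * Real.pi, by positivity, fun σ hσ u => ?_⟩
  rw [ker_eq h hab hσ]
  refine (norm_integral_le_of_norm_le ((integrable_inv_one_add_sq.const_mul (C * Real.exp (σ * u))))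
      (ae_of_all _ fun y => ?_)).trans (le_of_eq ?_)
  · rw [norm_mul, norm_exp_vl]
    have := hC (vl σ y) (by simpa using hσ)
    rw [vl_im] at this
    calc _ ≤ C * (1 + y ^ 2)⁻¹ * Real.exp (σ * u) := by gcongr
      _ = _ := by ring
  · rw [integral_const_mul, integral_univ_inv_one_add_sq]; ring

lemma measurable_ker (h : StripNice a b ω) (hab : (1/2 : ℝ) ∈ Icc a b) : StronglyMeasurable (mker ω) := by
  unfold mker
  have h1 := h.continuous hab
  have h2 := continuous_vl (1/2)
  have : Continuous fun p : ℝ × ℝ => ω (vl (1/2) p.2) * Complex.exp (vl (1/2) p.2 * p.1) :=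
    (h1.comp continuous_snd).mul (by fun_prop)
  exact this.stronglyMeasurable.integral_prod_right

lemma integrable_exp_neg_abs {c : ℝ} (hc : 0 < c) : Integrable fun u : ℝ => Real.exp (-(c * |u|)) := by
  have h1 := integrableOn_exp_mul_Ioi (a := -c) (by linarith) 0
  have h2 := integrableOn_exp_mul_Iic hc 0
  rw [← integrableOn_univ, ← Iic_union_Ioi (a := (0:ℝ))]
  refine IntegrableOn.union (h2.congr_fun (fun u hu => ?_) measurableSet_Iic)
    (h1.congr_fun (fun u hu => ?_) measurableSet_Ioi)
  · have hu : u ≤ 0 := hu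
    beta_reduce; rw [abs_of_nonpos hu]; congr 1; ring
  · have hu : 0 < u := hu
    beta_reduce; rw [abs_of_pos hu]; congr 1; ring

lemma integrable_ker (h : StripNice a b ω) (hab : (1/2 : ℝ) ∈ Icc a b) {s : ℝ} (hs : s ∈ Ioo a b) :
    Integrable fun u : ℝ => mker ω u * Complex.exp (-(s * u)) := by
  obtain ⟨C, hC0, hC⟩ := ker_bound h hab
  have ha := hs.1
  have hb := hs.2
  set c := min (s - a) (b - s) with hc
  have hc0 : 0 < c := lt_min (by linarith) (by linarith)
  have hab' : a ≤ b := by linarith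
  refine ((integrable_exp_neg_abs hc0).const_mul C).mono'
    (((measurable_ker h hab).aestronglyMeasurable).mul (by fun_prop)) (ae_of_all _ fun u => ?_)
  have e1 : ‖Complex.exp (-(s * u))‖ = Real.exp (-(s * u)) := by
    rw [Complex.norm_exp]; simp
  rw [norm_mul, e1]
  rcases le_total 0 u with hu | hu
  · calc _ ≤ C * Real.exp (a * u) * Real.exp (-(s * u)) := by gcongr; exact hC a ⟨le_rfl, hab'⟩ u
      _ = C * Real.exp (a * u + -(s * u)) := by rw [mul_assoc, ← Real.exp_add]
      _ ≤ _ := by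
        gcongr
        rw [abs_of_nonneg hu]
        nlinarith [min_le_left (s - a) (b - s)]
  · calc _ ≤ C * Real.exp (b * u) * Real.exp (-(s * u)) := by gcongr; exact hC b ⟨hab', le_rfl⟩ u
      _ = C * Real.exp (b * u + -(s * u)) := by rw [mul_assoc, ← Real.exp_add]
      _ ≤ _ := by
        gcongr
        rw [abs_of_nonpos hu]
        nlinarith [min_le_right (s - a) (b - s)]

open FourierTransform in
lemma integral_ker (h : StripNice a b ω) (hab : (1/2 : ℝ) ∈ Icc a b) {s : ℝ} (hs : s ∈ Ioo a b) :
    ∫ u : ℝ, mker ω u * Complex.exp (-(s * u)) = 2 * Real.pi * ω s := by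
  have hs' : s ∈ Icc a b := ⟨hs.1.le, hs.2.le⟩
  set g : ℝ → ℂ := fun y => ω (vl s y) with hg
  set hh : ℝ → ℂ := fun u => mker ω u * Complex.exp (-(s * u)) with hhh
  have hF : 𝓕 g = fun v => hh (-(2 * Real.pi) * v) := by
    ext v
    rw [Real.fourier_eq', hhh]
    simp only
    rw [ker_eq h hab hs', ← integral_mul_const]
    congr 1; ext y
    simp only [hg, smul_eq_mul]
    rw [mul_assoc (ω _), ← Complex.exp_add, mul_comm (Complex.exp _)]
    congr 2
    simp [vl]
    ring
  have hpi := Real.pi_pos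
  have hhi : Integrable hh := integrable_ker h hab hs
  have hFi : Integrable (𝓕 g) := by
    rw [hF]; exact hhi.comp_mul_left' (by linarith)
  have inv := (h.integrable hs').fourierInv_fourier_eq hFi (v := 0) (h.continuous hs').continuousAt
  rw [Real.fourierInv_eq'] at inv
  simp only [inner_zero_right, mul_zero, Complex.ofReal_zero, zero_mul, Complex.exp_zero, one_smul] at inv
  rw [hF, Measure.integral_comp_mul_left hh] at inv
  have e2 : |(-(2 * Real.pi))⁻¹| = (2 * Real.pi)⁻¹ := by
    rw [inv_neg, abs_neg, abs_of_pos (by positivity)]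
  rw [e2, Complex.real_smul] at inv
  have e3 : ω (vl s 0) = ω s := by simp [vl]
  have hpi0 : (Real.pi : ℂ) ≠ 0 := by exact_mod_cast hpi.ne'
  rw [← e3, ← inv]
  push_cast
  field_simp

lemma fubini_ker (h : StripNice a b ω) (hab : (1/2 : ℝ) ∈ Icc a b) {σ : ℝ} (hσ : σ ∈ Icc a b)
    {ψ : ℝ → ℂ} (hψ : Integrable fun u : ℝ => ψ u * Complex.exp (σ * u)) :
    ∫ u : ℝ, ψ u * mker ω u = ∫ y : ℝ, ω (vl σ y) * ∫ u : ℝ, ψ u * Complex.exp (vl σ y * u) := by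
  have e1 : ∀ u : ℝ, ψ u * mker ω u = ∫ y : ℝ, ψ u * (ω (vl σ y) * Complex.exp (vl σ y * u)) := by
    intro u; rw [ker_eq h hab hσ, integral_const_mul]
  simp_rw [e1]
  rw [integral_integral_swap]
  · congr 1; ext y
    rw [← integral_const_mul]
    congr 1; ext u; ring
  · have h2 := hψ.mul_prod (h.integrable hσ)
    have h3 : AEStronglyMeasurable (fun p : ℝ × ℝ => Complex.exp (p.1 * p.2 * Complex.I)) (volume.prod volume) := by
      fun_prop
    refine (h2.bdd_mul (c := 1) h3 (ae_of_all _ fun p => ?_)).congr (ae_of_all _ fun p => ?_)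
    · rw [show (p.1 : ℂ) * p.2 * Complex.I = ((p.1 * p.2 : ℝ) : ℂ) * Complex.I by push_cast; ring,
        Complex.norm_exp_ofReal_mul_I]
    · simp only [Function.uncurry]
      rw [show Complex.exp (vl σ p.2 * p.1) = Complex.exp (p.1 * p.2 * Complex.I) * Complex.exp (σ * p.1) by
        rw [← Complex.exp_add]; congr 1; simp [vl]; ring]
      ring

end Kernel

end ModP11

section ModP12
open MeasureTheory Set Filter Topology

noncomputable section Conclude

lemma hasSum_integral_mul {ι : Type*} [Countable ι] {g : ι → ℝ → ℝ} (hg0 : ∀ q u, 0 ≤ g q u)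
    (hgm : ∀ q, Measurable (g q)) (hs : ∀ u, Summable fun q => g q u) {k : ℝ → ℂ}
    (hk : AEStronglyMeasurable k) (hi : Integrable fun u => (∑' q, g q u) * ‖k u‖) :
    HasSum (fun q => ∫ u, (g q u : ℂ) * k u) (∫ u, ((∑' q, g q u : ℝ) : ℂ) * k u) := by
  refine hasSum_integral_of_dominated_convergence (fun q u => g q u * ‖k u‖) (fun q => ?_) (fun q => ?_)
    (ae_of_all _ fun u => ?_) ?_ (ae_of_all _ fun u => ?_)
  · have := hgm q
    exact (by fun_prop : Measurable fun u => (g q u : ℂ)).aestronglyMeasurable.mul hk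
  · refine ae_of_all _ fun u => le_of_eq ?_
    rw [norm_mul, Complex.norm_real, Real.norm_eq_abs, abs_of_nonneg (hg0 q u)]
  · exact (hs u).mul_right _
  · simpa only [tsum_mul_right] using hi
  · exact (Complex.hasSum_ofReal.2 (hs u).hasSum).mul_right _

theorem abstract_ineq {ι ι' : Type*} [Countable ι] [Countable ι'] {ω : ℂ → ℂ} (h : StripNice (-1/4) (5/4) ω)
    {R w κ h0 : ℝ} (hR : 0 ≤ R) (hw : 0 ≤ w) (hκ : 0 < κ) {n : ι → ℝ} {n' : ι' → ℝ} {φ : ℝ → ℝ}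
    (hφ0 : ∀ u, 0 ≤ φ u) (hφa : Antitone φ)
    (hs : ∀ u, Summable fun q => φ (u + n q)) (hs' : ∀ u, Summable fun q => φ (-u + n' q))
    (heq : ∀ u, Real.exp u * (R + w * ∑' q, φ (u + n q)) = κ * (R + w * ∑' q, φ (-u + n' q)))
    (hω1 : ω 1 = 0) (hH : ∀ q, (∫ u : ℝ, (φ (u + n q) : ℂ) * mker ω u).re ≤ 0) (q0 : ι)
    (hH0 : (∫ u : ℝ, (φ (u + n q0) : ℂ) * mker ω u).re ≤ -h0)
    (hD : ∀ q, 0 ≤ (∫ u : ℝ, (φ (-u + n' q) : ℂ) * (mker ω u * Complex.exp (-(u : ℂ)))).re) :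
    w * h0 ≤ R * (2 * Real.pi * (ω 0).re) := by
  have hab : (1/2 : ℝ) ∈ Icc (-1/4 : ℝ) (5/4) := by constructor <;> norm_num
  obtain ⟨C, hC0, hC⟩ := ker_bound h hab
  have hkm := (measurable_ker h hab).aestronglyMeasurable (μ := volume)
  set T : ℝ → ℝ := fun u => ∑' q, φ (u + n q) with hT
  set T' : ℝ → ℝ := fun u => ∑' q, φ (-u + n' q) with hT'
  have hT0 : ∀ u, 0 ≤ T u := fun u => tsum_nonneg fun q => hφ0 _
  have hT'0 : ∀ u, 0 ≤ T' u := fun u => tsum_nonneg fun q => hφ0 _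
  have hTa : Antitone T := fun u v huv => (hs v).tsum_le_tsum (fun q => hφa (by linarith)) (hs u)
  have hT'a : Monotone T' := fun u v huv => (hs' u).tsum_le_tsum (fun q => hφa (by linarith)) (hs' v)
  have kb1 : ∀ u, ‖mker ω u‖ ≤ C * Real.exp (-1/4 * u) := hC _ ⟨le_rfl, by norm_num⟩
  have kb2 : ∀ u, ‖mker ω u‖ ≤ C * Real.exp (5/4 * u) := hC _ ⟨by norm_num, le_rfl⟩
  -- main bound
  set B := (R + w * T 0) + κ * (R + w * T' 0) with hB
  have hB0 : 0 ≤ B := by have := hT0 0; have := hT'0 0; positivity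
  have hbound : ∀ u, (R + w * T u) * ‖mker ω u‖ ≤ B * C * Real.exp (-(1/4 * |u|)) := by
    intro u
    have hpos : 0 ≤ R + w * T u := by have := hT0 u; positivity
    rcases le_total 0 u with hu | hu
    · have h1 : R + w * T u ≤ B := by
        have : w * T u ≤ w * T 0 := mul_le_mul_of_nonneg_left (hTa hu) hw
        have h3 : 0 ≤ κ * (R + w * T' 0) := by have := hT'0 0; positivity
        linarith
      calc _ ≤ B * (C * Real.exp (-1/4 * u)) := mul_le_mul h1 (kb1 u) (norm_nonneg _) hB0
        _ = _ := by rw [abs_of_nonneg hu, mul_assoc]; ring_nf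
    · have h1 : R + w * T u ≤ B * Real.exp (-u) := by
        have e1 := heq u
        have h2 : κ * (R + w * T' u) ≤ B := by
          have : w * T' u ≤ w * T' 0 := mul_le_mul_of_nonneg_left (hT'a hu) hw
          have h3 : 0 ≤ (R + w * T 0) := by have := hT0 0; positivity
          have := mul_le_mul_of_nonneg_left (add_le_add_right this R) hκ.le
          linarith
        have e2 : R + w * T u = Real.exp (-u) * (Real.exp u * (R + w * T u)) := by
          rw [← mul_assoc, ← Real.exp_add]; simp
        have e3 : Real.exp u * (R + w * T u) = κ * (R + w * T' u) := e1
        rw [e2, e3, mul_comm]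
        gcongr
      calc _ ≤ B * Real.exp (-u) * (C * Real.exp (5/4 * u)) := mul_le_mul h1 (kb2 u) (norm_nonneg _) (by positivity)
        _ = B * C * Real.exp (-u + 5/4 * u) := by rw [Real.exp_add]; ring
        _ = _ := by rw [abs_of_nonpos hu]; congr 2; ring
  have hE := (integrable_exp_neg_abs (c := 1/4) (by norm_num)).const_mul (B * C)
  have hTm : Measurable T := hTa.measurable
  have hT'm : Measurable T' := hT'a.measurable
  have iRT : Integrable fun u => (R + w * T u) * ‖mker ω u‖ := by
    refine hE.mono' ?_ (ae_of_all _ fun u => ?_)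
    · exact (by fun_prop : Measurable fun u => R + w * T u).aestronglyMeasurable.mul hkm.norm
    · rw [Real.norm_eq_abs, abs_of_nonneg (mul_nonneg (by have := hT0 u; positivity) (norm_nonneg _))]
      exact hbound u
  have ik0 : Integrable fun u => mker ω u := by
    have := integrable_ker h hab (s := 0) ⟨by norm_num, by norm_num⟩
    simpa using this
  have ik1 : Integrable fun u : ℝ => mker ω u * Complex.exp (-(u : ℂ)) := by
    have := integrable_ker h hab (s := 1) ⟨by norm_num, by norm_num⟩
    simpa using this
  have I0 : ∫ u, mker ω u = 2 * Real.pi * ω 0 := by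
    have := integral_ker h hab (s := 0) ⟨by norm_num, by norm_num⟩
    simpa using this
  have I1 : ∫ u : ℝ, mker ω u * Complex.exp (-(u : ℂ)) = 0 := by
    have := integral_ker h hab (s := 1) ⟨by norm_num, by norm_num⟩
    simpa [hω1] using this
  rcases hw.eq_or_lt with hw0 | hw0
  · -- w = 0
    rw [← hw0, zero_mul]
    have e1 := heq 0
    have e2 := heq 1
    rw [← hw0] at e1 e2
    simp only [zero_mul, add_zero, Real.exp_zero, one_mul] at e1 e2
    have : R = 0 := by
      rw [← e1] at e2
      have h3 : (Real.exp 1 - 1) * R = 0 := by linarith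
      have h4 : Real.exp 1 - 1 ≠ 0 := by
        have := Real.add_one_lt_exp (x := 1) one_ne_zero; intro h; linarith
      exact (mul_eq_zero.1 h3).resolve_left h4
    rw [this]; simp
  have iT : Integrable fun u => T u * ‖mker ω u‖ := by
    have h1 := (iRT.sub (ik0.norm.const_mul R)).const_mul w⁻¹
    refine h1.congr (ae_of_all _ fun u => ?_)
    simp only [Pi.sub_apply]
    field_simp
    ring
  have ek : ∀ u : ℝ, ‖mker ω u * Complex.exp (-(u : ℂ))‖ = ‖mker ω u‖ * Real.exp (-u) := by
    intro u; rw [norm_mul, Complex.norm_exp]; simp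
  have iT' : Integrable fun u => T' u * ‖mker ω u * Complex.exp (-(u : ℂ))‖ := by
    have h1 := ((iRT.const_mul κ⁻¹).sub (ik1.norm.const_mul R)).const_mul w⁻¹
    refine h1.congr (ae_of_all _ fun u => ?_)
    simp only [Pi.sub_apply, ek]
    have e3 : Real.exp u * (R + w * T u) = κ * (R + w * T' u) := heq u
    have e4 : R + w * T u = Real.exp (-u) * (κ * (R + w * T' u)) := by
      rw [← e3, ← mul_assoc, ← Real.exp_add]; simp
    rw [e4]
    field_simp
    ring
  have hφm : Measurable φ := hφa.measurable
  have S1 := hasSum_integral_mul (g := fun q u => φ (u + n q)) (fun q u => hφ0 _) (fun q => by fun_prop) hs hkm iT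
  have S2 := hasSum_integral_mul (g := fun q u => φ (-u + n' q)) (fun q u => hφ0 _) (fun q => by fun_prop) hs'
    ik1.aestronglyMeasurable iT'
  have cT : Integrable fun u => (T u : ℂ) * mker ω u := by
    refine iT.mono' ((by fun_prop : Measurable fun u => (T u : ℂ)).aestronglyMeasurable.mul hkm) (ae_of_all _ fun u => ?_)
    rw [norm_mul, Complex.norm_real, Real.norm_eq_abs, abs_of_nonneg (hT0 u)]
  have cT' : Integrable fun u => (T' u : ℂ) * (mker ω u * Complex.exp (-(u : ℂ))) := by
    refine iT'.mono' ((by fun_prop : Measurable fun u => (T' u : ℂ)).aestronglyMeasurable.mul ik1.aestronglyMeasurable)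
      (ae_of_all _ fun u => ?_)
    rw [norm_mul, Complex.norm_real, Real.norm_eq_abs, abs_of_nonneg (hT'0 u)]
  have L : ∫ u, ((R : ℂ) * mker ω u + w * ((T u : ℂ) * mker ω u)) =
      R * (2 * Real.pi * ω 0) + w * ∫ u, (T u : ℂ) * mker ω u := by
    rw [integral_add (ik0.const_mul _) (cT.const_mul _), integral_const_mul, integral_const_mul, I0]
  have L' : ∫ u : ℝ, (κ : ℂ) * ((R : ℂ) * (mker ω u * Complex.exp (-(u : ℂ))) +
      w * ((T' u : ℂ) * (mker ω u * Complex.exp (-(u : ℂ))))) =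
      κ * (w * ∫ u, (T' u : ℂ) * (mker ω u * Complex.exp (-(u : ℂ)))) := by
    rw [integral_const_mul, integral_add (ik1.const_mul _) (cT'.const_mul _), integral_const_mul, integral_const_mul, I1,
      mul_zero, zero_add]
  have LL : ∫ u, ((R : ℂ) * mker ω u + w * ((T u : ℂ) * mker ω u)) =
      ∫ u : ℝ, (κ : ℂ) * ((R : ℂ) * (mker ω u * Complex.exp (-(u : ℂ))) +
      w * ((T' u : ℂ) * (mker ω u * Complex.exp (-(u : ℂ))))) := by
    congr 1; ext u
    have e3 : Real.exp u * (R + w * T u) = κ * (R + w * T' u) := heq u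
    have e4 : ((R + w * T u : ℝ) : ℂ) = ((Real.exp (-u) * (κ * (R + w * T' u)) : ℝ) : ℂ) := by
      rw [← e3, ← mul_assoc, ← Real.exp_add]; simp
    push_cast at e4
    linear_combination (mker ω u) * e4
  rw [L, L'] at LL
  have S1r := Complex.hasSum_re S1
  have S2r := Complex.hasSum_re S2
  have r2 : 0 ≤ (∫ u, (T' u : ℂ) * (mker ω u * Complex.exp (-(u : ℂ)))).re := S2r.nonneg hD
  have r1 : (∫ u, (T u : ℂ) * mker ω u).re ≤ -h0 := by
    have h1 := le_hasSum S1r.neg q0 (fun q _ => by have := hH q; simpa using this)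
    have h2 : -(∫ u : ℝ, (φ (u + n q0) : ℂ) * mker ω u).re ≤ -(∫ u, (T u : ℂ) * mker ω u).re := h1
    linarith
  have := congrArg Complex.re LL
  rw [Complex.add_re, Complex.re_ofReal_mul, Complex.re_ofReal_mul, Complex.re_ofReal_mul, Complex.re_ofReal_mul,
    show (2 : ℂ) * Real.pi = ((2 * Real.pi : ℝ) : ℂ) by push_cast; ring, Complex.re_ofReal_mul] at this
  have h5 := mul_nonneg hκ.le (mul_nonneg hw r2)
  have h6 := mul_le_mul_of_nonneg_left r1 hw
  linarith

end Conclude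

end ModP12

section ModP13
open MeasureTheory Set Filter Topology

noncomputable section MBounds

lemma smul_half_re (s : ℂ) (d : ℝ) : (s * d / 2).re = s.re * d / 2 := by
  rw [show (s * d / 2) = ((d / 2 : ℝ) : ℂ) * s by push_cast; ring, Complex.re_ofReal_mul]; ring

lemma smul_half_im (s : ℂ) (d : ℝ) : (s * d / 2).im = s.im * d / 2 := by
  rw [show (s * d / 2) = ((d / 2 : ℝ) : ℂ) * s by push_cast; ring, Complex.im_ofReal_mul]; ring

lemma norm_MM (d : ℝ) (hd : 0 < d) (s : ℂ) : ‖MM d s‖ =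
    d / 2 * Real.exp (-(s.re * d / 2) * Real.log (Real.pi * d)) * ‖Complex.Gamma (s * d / 2)‖ := by
  rw [MM, norm_mul, norm_mul, Complex.norm_real, Real.norm_eq_abs, abs_of_pos (by positivity), Complex.norm_exp,
    Complex.re_mul_ofReal, Complex.neg_re, smul_half_re]

lemma MM_upper {d : ℝ} (hd : d = 1 ∨ d = 2) : ∃ C : ℝ, 0 < C ∧ ∀ s : ℂ, s.re ∈ Icc (1 : ℝ) 4 → ‖MM d s‖ ≤ C := by
  have hd0 : 0 < d := by rcases hd with rfl | rfl <;> norm_num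
  obtain ⟨C, hC, h⟩ := Gamma_bdd_Icc (a := 1/2) (b := 4) (by norm_num)
  refine ⟨d / 2 * Real.exp (4 * |Real.log (Real.pi * d)|) * C, by positivity, fun s hs => ?_⟩
  have hr : (s * d / 2).re ∈ Icc (1/2 : ℝ) 4 := by
    rw [smul_half_re]
    rcases hd with rfl | rfl <;> constructor <;> linarith [hs.1, hs.2]
  rw [norm_MM d hd0]
  have h1 : ‖Complex.Gamma (s * d / 2)‖ ≤ C := (norm_Gamma_le (by linarith [hr.1])).trans (h _ hr)
  have h2 : -(s.re * d / 2) * Real.log (Real.pi * d) ≤ 4 * |Real.log (Real.pi * d)| := by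
    rw [smul_half_re] at hr
    have := neg_abs_le (Real.log (Real.pi * d))
    have h3 := abs_nonneg (Real.log (Real.pi * d))
    nlinarith [hr.1, hr.2]
  gcongr

lemma MM_lower {d : ℝ} (hd : d = 1 ∨ d = 2) : ∃ C : ℝ, 0 < C ∧ ∀ s : ℂ, s.re ∈ Icc (1 : ℝ) 4 →
    ‖(MM d s)⁻¹‖ ≤ C * Real.exp (Real.pi * |s.im|) := by
  have hd0 : 0 < d := by rcases hd with rfl | rfl <;> norm_num
  obtain ⟨C, hC, h⟩ := norm_inv_Gamma_le
  refine ⟨2 / d * Real.exp (4 * |Real.log (Real.pi * d)|) * C, by positivity, fun s hs => ?_⟩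
  have hr : (s * d / 2).re ∈ Icc (1/2 : ℝ) 4 := by
    rw [smul_half_re]
    rcases hd with rfl | rfl <;> constructor <;> linarith [hs.1, hs.2]
  have h1 := h _ hr
  rw [norm_inv, norm_MM d hd0, mul_inv, mul_inv, inv_div, ← Real.exp_neg, mul_assoc (2 / d * _)]
  rw [norm_inv] at h1
  have h2 : -(-(s.re * d / 2) * Real.log (Real.pi * d)) ≤ 4 * |Real.log (Real.pi * d)| := by
    rw [smul_half_re] at hr
    have := le_abs_self (Real.log (Real.pi * d))
    have h3 := abs_nonneg (Real.log (Real.pi * d))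
    nlinarith [hr.1, hr.2]
  have h4 : Real.exp (Real.pi * |(s * d / 2).im|) ≤ Real.exp (Real.pi * |s.im|) := by
    rw [smul_half_im]
    gcongr 2
    rw [mul_div_assoc, abs_mul]
    apply mul_le_of_le_one_right (abs_nonneg _)
    rcases hd with rfl | rfl <;> norm_num [abs_le]
  have h5 := h1.trans (mul_le_mul_of_nonneg_left h4 hC.le)
  gcongr

variable {ι : Type*} [Fintype ι]

/-- product of local Mellin factors -/
def MP (m : ι → ℝ) (s : ℂ) : ℂ := ∏ i, MM (m i) s

lemma MP_ne_zero {m : ι → ℝ} (hm : ∀ i, m i = 1 ∨ m i = 2) {s : ℂ} (hs : 0 < s.re) : MP m s ≠ 0 :=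
  Finset.prod_ne_zero_iff.2 fun i _ => MM_ne_zero (by rcases hm i with h | h <;> rw [h] <;> norm_num) hs

lemma differentiableAt_MM {d : ℝ} (hd : 0 < d) {s : ℂ} (hs : 0 < s.re) : DifferentiableAt ℂ (MM d) s := by
  unfold MM
  refine DifferentiableAt.mul (by fun_prop) ?_
  have h1 : DifferentiableAt ℂ Complex.Gamma (s * d / 2) := by
    refine Complex.differentiableAt_Gamma _ fun k hk => ?_
    have := congrArg Complex.re hk
    rw [smul_half_re] at this
    simp at this
    have h2 : 0 < s.re * d / 2 := by positivity
    have h3 : (0:ℝ) ≤ k := k.cast_nonneg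
    linarith
  exact h1.comp s (f := fun s : ℂ => s * d / 2) (by fun_prop)

lemma differentiableAt_MP {m : ι → ℝ} (hm : ∀ i, m i = 1 ∨ m i = 2) {s : ℂ} (hs : 0 < s.re) :
    DifferentiableAt ℂ (MP m) s := by
  unfold MP
  apply DifferentiableAt.fun_finsetProd
  intro i _
  exact differentiableAt_MM (by rcases hm i with h | h <;> rw [h] <;> norm_num) hs

lemma MP_upper {m : ι → ℝ} (hm : ∀ i, m i = 1 ∨ m i = 2) : ∃ C : ℝ, 0 < C ∧ ∀ s : ℂ, s.re ∈ Icc (1 : ℝ) 4 →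
    ‖MP m s‖ ≤ C := by
  choose C hC h using fun i => MM_upper (hm i)
  refine ⟨∏ i, C i, Finset.prod_pos fun i _ => hC i, fun s hs => ?_⟩
  rw [MP, norm_prod]
  exact Finset.prod_le_prod (fun i _ => norm_nonneg _) fun i _ => h i s hs

lemma MP_lower {m : ι → ℝ} (hm : ∀ i, m i = 1 ∨ m i = 2) : ∃ C A : ℝ, 0 < C ∧ ∀ s : ℂ, s.re ∈ Icc (1 : ℝ) 4 →
    ‖(MP m s)⁻¹‖ ≤ C * Real.exp (A * |s.im|) := by
  choose C hC h using fun i => MM_lower (hm i)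
  refine ⟨∏ i, C i, Fintype.card ι * Real.pi, Finset.prod_pos fun i _ => hC i, fun s hs => ?_⟩
  rw [MP, ← Finset.prod_inv_distrib, norm_prod]
  refine (Finset.prod_le_prod (fun i _ => norm_nonneg _) fun i _ => h i s hs).trans (le_of_eq ?_)
  rw [Finset.prod_mul_distrib, Finset.prod_const, ← Real.exp_nat_mul, Finset.card_univ]
  congr 2; ring

lemma MM_conj (d : ℝ) (s : ℂ) : MM d ((starRingEnd ℂ) s) = (starRingEnd ℂ) (MM d s) := by
  unfold MM
  simp only [map_mul, Complex.conj_ofReal]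
  rw [← Complex.exp_conj, ← Complex.Gamma_conj]
  simp [map_div₀, map_ofNat]

lemma MP_conj (m : ι → ℝ) (s : ℂ) : MP m ((starRingEnd ℂ) s) = (starRingEnd ℂ) (MP m s) := by
  unfold MP
  rw [map_prod]
  simp_rw [MM_conj]

end MBounds

end ModP13

section ModP14
open MeasureTheory Set Filter Topology

noncomputable section Omega

variable {ι : Type*} [Fintype ι]

/-- the test function -/
def om (ξ : ℝ) (m : ι → ℝ) (s : ℂ) : ℂ :=
  Complex.exp (ξ * s) * ((s - 1) / (219/100 - s)) * (-KK (69/25) (s - 319/200)) *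
    Complex.exp ((s - 319/200) ^ 2 / 1000) * (MP m (319/100 - s))⁻¹

lemma om_one (ξ : ℝ) (m : ι → ℝ) : om ξ m 1 = 0 := by simp [om]

lemma norm_le_of_re {z w : ℂ} (hi : |z.im| = |w.im|) (h : |z.re| ≤ |w.re|) : ‖z‖ ≤ ‖w‖ := by
  rw [Complex.norm_eq_sqrt_sq_add_sq, Complex.norm_eq_sqrt_sq_add_sq]
  apply Real.sqrt_le_sqrt
  have h1 := sq_le_sq.2 h
  have h2 := sq_abs z.im
  have h3 := sq_abs w.im
  rw [hi] at h2
  linarith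

lemma norm_gauss (z : ℂ) : ‖Complex.exp (z ^ 2 / 1000)‖ = Real.exp ((z.re ^ 2 - z.im ^ 2) / 1000) := by
  rw [Complex.norm_exp]
  congr 1
  rw [show z ^ 2 / 1000 = ((1 / 1000 : ℝ) : ℂ) * z ^ 2 by push_cast; ring, Complex.re_ofReal_mul]
  simp [pow_two]
  ring

lemma om_strip (ξ : ℝ) {m : ι → ℝ} (hm : ∀ i, m i = 1 ∨ m i = 2) : StripNice (-1/4) (5/4) (om ξ m) := by
  obtain ⟨C, A, hC, hMP⟩ := MP_lower hm
  obtain ⟨hd, C2, hC2⟩ := stripNice_inv (c := 69/25) (e := 369/200) (by norm_num) (by norm_num)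
  have key : ∀ s : ℂ, om ξ m s = Complex.exp (ξ * s) * ((s - 1) / (219/100 - s)) * (-((69/25) ^ 2 / (s - 319/200) ^ 2)) *
     (((69/25 : ℝ) : ℂ) ^ 2 - (s - 319/200) ^ 2)⁻¹ *
    Complex.exp ((s - 319/200) ^ 2 / 1000) * (MP m (319/100 - s))⁻¹ := by
    intro s
    unfold om KK
    push_cast
    rw [← div_div, div_eq_mul_inv _ ((69 / 25 : ℂ) ^ 2 - _)]
    ring
  have hre : ∀ s : ℂ, s.re ∈ Icc (-1/4 : ℝ) (5/4) → (s - 319/200).re ∈ Icc (-(369/200 : ℝ)) (-69/200) := by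
    intro s hs
    have : (s - 319/200).re = s.re - 319/200 := by
      rw [show s - 319/200 = s - ((319/200 : ℝ) : ℂ) by push_cast; ring]; simp only [Complex.sub_re, Complex.ofReal_re]
    rw [this]
    constructor <;> linarith [hs.1, hs.2]
  have him : ∀ s : ℂ, (s - 319/200).im = s.im := by
    intro s
    rw [show s - 319/200 = s - ((319/200 : ℝ) : ℂ) by push_cast; ring]; simp only [Complex.sub_im, Complex.ofReal_im]; ring
  have hre2 : ∀ s : ℂ, (319/100 - s).re = 319/100 - s.re := by
    intro s
    rw [show 319/100 - s = ((319/100 : ℝ) : ℂ) - s by push_cast; ring]; simp only [Complex.sub_re, Complex.ofReal_re]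
  have him2 : ∀ s : ℂ, (319/100 - s).im = -s.im := by
    intro s
    rw [show 319/100 - s = ((319/100 : ℝ) : ℂ) - s by push_cast; ring]; simp only [Complex.sub_im, Complex.ofReal_im]; ring
  have hre3 : ∀ s : ℂ, (219/100 - s).re = 219/100 - s.re := by
    intro s
    rw [show 219/100 - s = ((219/100 : ℝ) : ℂ) - s by push_cast; ring]; simp only [Complex.sub_re, Complex.ofReal_re]
  have him3 : ∀ s : ℂ, (219/100 - s).im = -s.im := by
    intro s
    rw [show 219/100 - s = ((219/100 : ℝ) : ℂ) - s by push_cast; ring]; simp only [Complex.sub_im, Complex.ofReal_im]; ring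
  have hz0 : ∀ s : ℂ, s.re ∈ Icc (-1/4 : ℝ) (5/4) → (s - 319/200) ≠ 0 := by
    intro s hs h0
    have := (hre s hs).2
    rw [h0] at this
    norm_num at this
  have hw0 : ∀ s : ℂ, s.re ∈ Icc (-1/4 : ℝ) (5/4) → (219/100 - s) ≠ 0 := by
    intro s hs h0
    have := congrArg Complex.re h0
    rw [hre3] at this
    simp at this
    linarith [hs.2]
  constructor
  · intro s hs
    have hs' : s.re ∈ Icc (-1/4 : ℝ) (5/4) := hs
    apply DifferentiableAt.differentiableWithinAt
    have e : om ξ m = fun s => Complex.exp (ξ * s) * ((s - 1) / (219/100 - s)) * (-((69/25) ^ 2 / (s - 319/200) ^ 2)) *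
     (((69/25 : ℝ) : ℂ) ^ 2 - (s - 319/200) ^ 2)⁻¹ *
      Complex.exp ((s - 319/200) ^ 2 / 1000) * (MP m (319/100 - s))⁻¹ := funext key
    rw [e]
    have h1 : DifferentiableAt ℂ (fun s => (MP m (319/100 - s))⁻¹) s := by
      have hp : 0 < (319/100 - s).re := by rw [hre2]; linarith [hs'.2]
      refine DifferentiableAt.inv ?_ (MP_ne_zero hm hp)
      exact (differentiableAt_MP hm hp).comp s (f := fun s => 319/100 - s) (by fun_prop)
    have h2 : DifferentiableAt ℂ (fun s : ℂ => (((69/25 : ℝ) : ℂ) ^ 2 - (s - 319/200) ^ 2)⁻¹) s := by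
      refine DifferentiableAt.inv (by fun_prop) (sq_sub_ne ?_)
      have := hre s hs'
      rw [abs_lt]
      constructor <;> linarith [this.1, this.2]
    have h3 : DifferentiableAt ℂ (fun s : ℂ => ((s - 1) / (219/100 - s))) s :=
      DifferentiableAt.div (by fun_prop) (by fun_prop) (hw0 s hs')
    have h4 : DifferentiableAt ℂ (fun s : ℂ => (-((69/25) ^ 2 / (s - 319/200) ^ 2))) s := by
      have h6 : DifferentiableAt ℂ (fun s : ℂ => (s - 319/200) ^ 2) s := by fun_prop
      exact ((differentiableAt_const _).fun_div h6 (pow_ne_zero 2 (hz0 s hs'))).fun_neg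
    have h5 : DifferentiableAt ℂ (fun s : ℂ => Complex.exp (ξ * s)) s := by fun_prop
    have h6 : DifferentiableAt ℂ (fun s : ℂ => Complex.exp ((s - 319/200) ^ 2 / 1000)) s := by fun_prop
    exact ((((h5.mul h3).mul h4).mul h2).mul h6).mul h1
  · refine ⟨Real.exp (2 * |ξ|) * 1 * 100 * C2 * (Real.exp 1 * C * Real.exp (250 * A ^ 2)), fun s hs => ?_⟩
    rw [key]
    have b1 : ‖Complex.exp (ξ * s)‖ ≤ Real.exp (2 * |ξ|) := by
      rw [Complex.norm_exp, Complex.re_ofReal_mul]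
      refine Real.exp_le_exp.2 ((le_abs_self _).trans ?_)
      rw [abs_mul, mul_comm]
      refine mul_le_mul_of_nonneg_right ?_ (abs_nonneg _)
      rw [abs_le]; constructor <;> linarith [hs.1, hs.2]
    have b2 : ‖(s - 1) / (219/100 - s)‖ ≤ 1 := by
      rw [norm_div]
      apply div_le_one_of_le₀ _ (norm_nonneg _)
      apply norm_le_of_re
      · rw [him3]; simp
      · rw [hre3]; simp only [Complex.sub_re, Complex.one_re]
        rw [abs_of_pos (a := 219/100 - s.re) (by linarith [hs.2]), abs_le]
        constructor <;> linarith [hs.1, hs.2]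
    have b3 : ‖(-((69/25) ^ 2 / (s - 319/200) ^ 2) : ℂ)‖ ≤ 100 := by
      rw [norm_neg, norm_div, norm_pow, norm_pow, div_le_iff₀ (by have := norm_pos_iff.2 (hz0 s hs); positivity)]
      have h1 : (69/200 : ℝ) ≤ ‖s - 319/200‖ := by
        refine le_trans ?_ (Complex.abs_re_le_norm _)
        refine le_trans ?_ (neg_le_abs _)
        linarith [(hre s hs).2]
      have h2 : ‖(69/25 : ℂ)‖ = 69/25 := by norm_num
      rw [h2]
      nlinarith
    have b4 := hC2 (s - 319/200) ⟨(hre s hs).1, by linarith [(hre s hs).2]⟩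
    rw [him] at b4
    have b5 : ‖Complex.exp ((s - 319/200) ^ 2 / 1000) * (MP m (319/100 - s))⁻¹‖ ≤ Real.exp 1 * C * Real.exp (250 * A ^ 2) := by
      rw [norm_mul, norm_gauss, him]
      have h1 := hMP (319/100 - s) (by rw [hre2]; constructor <;> linarith [hs.1, hs.2])
      rw [him2, abs_neg] at h1
      have h2 : Real.exp (((s - 319/200).re ^ 2 - s.im ^ 2) / 1000) ≤ Real.exp 1 * Real.exp (-(s.im ^ 2 / 1000)) := by
        rw [← Real.exp_add]
        gcongr
        nlinarith [(hre s hs).1, (hre s hs).2]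
      have h3 : Real.exp (-(s.im ^ 2 / 1000)) * Real.exp (A * |s.im|) ≤ Real.exp (250 * A ^ 2) := by
        rw [← Real.exp_add]
        gcongr
        nlinarith [sq_nonneg (|s.im| - 500 * A), sq_abs s.im]
      calc _ ≤ (Real.exp 1 * Real.exp (-(s.im ^ 2 / 1000))) * (C * Real.exp (A * |s.im|)) :=
            mul_le_mul h2 h1 (norm_nonneg _) (by positivity)
        _ = Real.exp 1 * C * (Real.exp (-(s.im ^ 2 / 1000)) * Real.exp (A * |s.im|)) := by ring
        _ ≤ _ := by gcongr
    have hC20 : 0 ≤ C2 * (1 + s.im ^ 2)⁻¹ := (norm_nonneg _).trans b4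
    rw [mul_assoc (_ * _) (Complex.exp _), norm_mul, norm_mul, norm_mul, norm_mul]
    calc _ ≤ Real.exp (2 * |ξ|) * 1 * 100 * (C2 * (1 + s.im ^ 2)⁻¹) * (Real.exp 1 * C * Real.exp (250 * A ^ 2)) := by
          gcongr
      _ = _ := by ring

end Omega

end ModP14

section ModP15
open MeasureTheory Set Filter Topology

noncomputable section HPart

variable {ι : Type*} [Fintype ι]

/-- real digamma -/
def psiR (x : ℝ) : ℝ := deriv Real.Gamma x / Real.Gamma x

lemma gamma_ne_aux {x : ℝ} (hx : 0 < x) (k : ℕ) : (x : ℂ) ≠ -k := by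
  intro hk
  have := congrArg Complex.re hk
  simp at this
  have h3 : (0:ℝ) ≤ k := k.cast_nonneg
  linarith

lemma logDeriv_Gamma_real {x : ℝ} (hx : 0 < x) : logDeriv Complex.Gamma (x : ℂ) = (psiR x : ℂ) := by
  have h1 : HasDerivAt Complex.Gamma (deriv Complex.Gamma x) (x : ℂ) :=
    (Complex.differentiableAt_Gamma _ (gamma_ne_aux hx)).hasDerivAt
  have h2 := h1.comp_ofReal
  have h3 : HasDerivAt Real.Gamma (deriv Real.Gamma x) x := by
    refine (Real.differentiableAt_Gamma fun k hk => ?_).hasDerivAt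
    have h3 : (0:ℝ) ≤ k := k.cast_nonneg
    linarith
  have h4 := h3.ofReal_comp
  have e : (fun y : ℝ => Complex.Gamma y) = fun y : ℝ => ((Real.Gamma y : ℝ) : ℂ) := by
    ext y; rw [Complex.Gamma_ofReal]
  rw [e] at h2
  rw [logDeriv_apply, h2.unique h4, psiR, Complex.Gamma_ofReal]
  push_cast; rfl

lemma logDeriv_MM {d x : ℝ} (hd : 0 < d) (hx : 0 < x) :
    logDeriv (MM d) (x : ℂ) = ((d / 2 * (psiR (x * d / 2) - Real.log (Real.pi * d)) : ℝ) : ℂ) := by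
  have hxd : 0 < x * d / 2 := by positivity
  have e0 : (x : ℂ) * d / 2 = ((x * d / 2 : ℝ) : ℂ) := by push_cast; ring
  have h1 : HasDerivAt Complex.Gamma (deriv Complex.Gamma ((x : ℂ) * d / 2)) ((x : ℂ) * d / 2) := by
    rw [e0]
    exact (Complex.differentiableAt_Gamma _ (gamma_ne_aux hxd)).hasDerivAt
  have h2 : HasDerivAt (fun s : ℂ => s * d / 2) ((d : ℂ) / 2) (x : ℂ) := by
    simpa using ((hasDerivAt_id (x : ℂ)).mul_const (d : ℂ)).div_const 2
  have h3 := h1.comp (x : ℂ) h2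
  have h4 : HasDerivAt (fun s : ℂ => Complex.exp (-(s * d / 2) * (Real.log (Real.pi * d) : ℝ)))
      (Complex.exp (-((x : ℂ) * d / 2) * (Real.log (Real.pi * d) : ℝ)) * (-((d : ℂ) / 2) * (Real.log (Real.pi * d) : ℝ)))
      (x : ℂ) := ((h2.neg).mul_const _).cexp
  have h5 := (h4.const_mul ((d / 2 : ℝ) : ℂ)).mul h3
  have h6 : HasDerivAt (MM d) _ (x : ℂ) := h5.congr_of_eventuallyEq (Eventually.of_forall fun s => by
    simp [MM])
  rw [logDeriv_apply, h6.deriv]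
  have hG := logDeriv_Gamma_real hxd
  have hG0 : Complex.Gamma (((x * d / 2 : ℝ) : ℂ)) ≠ 0 := Complex.Gamma_ne_zero (gamma_ne_aux hxd)
  rw [logDeriv_apply, div_eq_iff hG0] at hG
  have hd0 : (d : ℂ) ≠ 0 := by exact_mod_cast hd.ne'
  simp only [MM, Function.comp]
  rw [e0, hG]
  have hE := Complex.exp_ne_zero (-((x * d / 2 : ℝ) : ℂ) * (Real.log (Real.pi * d) : ℝ))
  clear h1 h3 h4 h5 h6 hG e0
  generalize Complex.Gamma ((x * d / 2 : ℝ) : ℂ) = G at *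
  generalize psiR (x * d / 2) = p at *
  generalize Complex.exp (-((x * d / 2 : ℝ) : ℂ) * (Real.log (Real.pi * d) : ℝ)) = E at *
  push_cast
  field_simp
  ring

/-- log derivative at the central point -/
def Lam (m : ι → ℝ) : ℝ := ∑ i, m i / 2 * (psiR (319/200 * m i / 2) - Real.log (Real.pi * m i))

lemma logDeriv_MP {m : ι → ℝ} (hm : ∀ i, m i = 1 ∨ m i = 2) :
    logDeriv (MP m) (((319/200 : ℝ)) : ℂ) = (Lam m : ℂ) := by
  have hp : ∀ i, 0 < m i := fun i => by rcases hm i with h | h <;> rw [h] <;> norm_num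
  have hr : 0 < ((319/200 : ℝ) : ℂ).re := by rw [Complex.ofReal_re]; norm_num
  have e : MP m = fun s => ∏ i, MM (m i) s := rfl
  have := logDeriv_prod (s := Finset.univ) (f := fun i => MM (m i)) (x := ((319/200 : ℝ) : ℂ))
    (fun i _ => MM_ne_zero (hp i) hr) (fun i _ => differentiableAt_MM (hp i) hr)
  have e2 : MP m = ∏ i, MM (m i) := by ext s; simp [MP]
  first
    | rw [e2, this]
    | rw [e, this]
  rw [Lam, Complex.ofReal_sum]
  exact Finset.sum_congr rfl fun i _ => logDeriv_MM (hp i) (by norm_num)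

/-- the contour function -/
def PP (m : ι → ℝ) (ρ : ℝ) (z : ℂ) : ℂ := Complex.exp (ρ * z) * ((119/200 + z) / (119/200 - z)) *
  Complex.exp (z ^ 2 / 1000) * (MP m (((319/200 : ℝ) : ℂ) + z) / MP m (((319/200 : ℝ) : ℂ) - z))

lemma PP_hasDeriv {m : ι → ℝ} (hm : ∀ i, m i = 1 ∨ m i = 2) (ρ : ℝ) :
    HasDerivAt (PP m ρ) ((ρ + 400/119 + 2 * Lam m : ℝ) : ℂ) 0 := by
  have hr : 0 < ((319/200 : ℝ) : ℂ).re := by rw [Complex.ofReal_re]; norm_num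
  have hM0 := MP_ne_zero hm hr
  have hL := logDeriv_MP hm
  rw [logDeriv_apply, div_eq_iff hM0] at hL
  have hM : HasDerivAt (MP m) (Lam m * MP m ((319/200 : ℝ) : ℂ)) ((319/200 : ℝ) : ℂ) := by
    rw [← hL]; exact (differentiableAt_MP hm hr).hasDerivAt
  set M0 := MP m ((319/200 : ℝ) : ℂ) with hM0d
  have h1 : HasDerivAt (fun z => MP m (((319/200 : ℝ) : ℂ) + z)) (Lam m * M0) 0 := by
    have := HasDerivAt.comp_const_add (f := MP m) ((319/200 : ℝ) : ℂ) 0 (by rw [add_zero]; exact hM)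
    exact this
  have h2 : HasDerivAt (fun z => MP m (((319/200 : ℝ) : ℂ) - z)) (-(Lam m * M0)) 0 := by
    have := HasDerivAt.comp_const_sub (f := MP m) ((319/200 : ℝ) : ℂ) 0 (by rw [sub_zero]; exact hM)
    exact this
  have h3 := h1.fun_div h2 (by rw [sub_zero]; exact hM0)
  have h4 : HasDerivAt (fun z : ℂ => Complex.exp (ρ * z)) (ρ : ℂ) 0 := by
    have := ((hasDerivAt_id (0 : ℂ)).const_mul (ρ : ℂ)).cexp
    simpa using this
  have h5 : HasDerivAt (fun z : ℂ => Complex.exp (z ^ 2 / 1000)) 0 0 := by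
    have := ((hasDerivAt_pow 2 (0 : ℂ)).div_const 1000).cexp
    simpa using this
  have h6 : HasDerivAt (fun z : ℂ => (119/200 + z) / (119/200 - z)) (400/119) 0 := by
    have a1 : HasDerivAt (fun z : ℂ => 119/200 + z) 1 0 := (hasDerivAt_id (0:ℂ)).const_add _
    have a2 : HasDerivAt (fun z : ℂ => 119/200 - z) (-1) 0 := (hasDerivAt_id (0:ℂ)).const_sub _
    exact (a1.fun_div a2 (by norm_num)).congr_deriv (by norm_num)
  have h7 := ((h4.fun_mul h6).fun_mul h5).fun_mul h3
  have : HasDerivAt (PP m ρ) _ 0 := h7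
  refine this.congr_deriv ?_
  simp only [mul_zero, Complex.exp_zero, add_zero, sub_zero, ← hM0d]
  push_cast
  norm_num
  field_simp
  ring

lemma PP_zero {m : ι → ℝ} (hm : ∀ i, m i = 1 ∨ m i = 2) (ρ : ℝ) : PP m ρ 0 = 1 := by
  have hr : 0 < ((319/200 : ℝ) : ℂ).re := by rw [Complex.ofReal_re]; norm_num
  have hM0 := MP_ne_zero hm hr
  simp only [PP, mul_zero, Complex.exp_zero, add_zero, sub_zero, div_self hM0]
  norm_num

lemma re_const_add (a : ℝ) (z : ℂ) : ((a : ℂ) + z).re = a + z.re := by simp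
lemma re_const_sub (a : ℝ) (z : ℂ) : ((a : ℂ) - z).re = a - z.re := by simp

lemma PP_imag {m : ι → ℝ} (ρ y : ℝ) : ‖PP m ρ (vl 0 y)‖ ≤ 1 := by
  have hc : (starRingEnd ℂ) (vl 0 y) = - vl 0 y := by simp [vl]
  have h1 : MP m (((319/200 : ℝ) : ℂ) - vl 0 y) = (starRingEnd ℂ) (MP m (((319/200 : ℝ) : ℂ) + vl 0 y)) := by
    rw [← MP_conj, map_add, hc, Complex.conj_ofReal, sub_eq_add_neg]
  have h2 : (119/200 : ℂ) - vl 0 y = (starRingEnd ℂ) ((119/200 : ℂ) + vl 0 y) := by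
    rw [map_add, hc, show (119/200 : ℂ) = ((119/200 : ℝ) : ℂ) by push_cast; rfl, Complex.conj_ofReal, sub_eq_add_neg]
  rw [PP, norm_mul, norm_mul, norm_mul, norm_div, norm_div, h1, h2, RCLike.norm_conj, RCLike.norm_conj, norm_gauss,
    Complex.norm_exp, Complex.re_ofReal_mul]
  simp only [vl_re, vl_im, mul_zero, Real.exp_zero]
  refine mul_le_one₀ (mul_le_one₀ ?_ (by positivity) ?_) (by positivity) (div_self_le_one _)
  · rw [one_mul]; exact div_self_le_one _
  · rw [Real.exp_le_one_iff]; nlinarith [sq_nonneg y]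

lemma PP_diff {m : ι → ℝ} (hm : ∀ i, m i = 1 ∨ m i = 2) (ρ : ℝ) :
    DifferentiableOn ℂ (PP m ρ) (Complex.re ⁻¹' Ioo (-(1/2)) (1/2)) := by
  intro z hz
  have hz' : z.re ∈ Ioo (-(1/2) : ℝ) (1/2) := hz
  apply DifferentiableAt.differentiableWithinAt
  have p1 : 0 < (((319/200 : ℝ) : ℂ) + z).re := by rw [re_const_add]; linarith [hz'.1]
  have p2 : 0 < (((319/200 : ℝ) : ℂ) - z).re := by rw [re_const_sub]; linarith [hz'.2]
  have h1 : DifferentiableAt ℂ (fun z => MP m (((319/200 : ℝ) : ℂ) + z)) z :=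
    (differentiableAt_MP hm p1).comp z (f := fun z => ((319/200 : ℝ) : ℂ) + z) (by fun_prop)
  have h2 : DifferentiableAt ℂ (fun z => MP m (((319/200 : ℝ) : ℂ) - z)) z :=
    (differentiableAt_MP hm p2).comp z (f := fun z => ((319/200 : ℝ) : ℂ) - z) (by fun_prop)
  have h3 := h1.fun_div h2 (MP_ne_zero hm p2)
  have h0 : (119/200 : ℂ) - z ≠ 0 := by
    intro h0
    have := congrArg Complex.re h0
    rw [show (119/200 : ℂ) = ((119/200 : ℝ) : ℂ) by push_cast; rfl, re_const_sub] at this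
    simp at this
    linarith [hz'.2]
  have h4 : DifferentiableAt ℂ (fun z : ℂ => (119/200 + z) / (119/200 - z)) z :=
    DifferentiableAt.fun_div (by fun_prop) (by fun_prop) h0
  have h5 : DifferentiableAt ℂ (fun z : ℂ => Complex.exp (ρ * z)) z := by fun_prop
  have h6 : DifferentiableAt ℂ (fun z : ℂ => Complex.exp (z ^ 2 / 1000)) z := by fun_prop
  exact ((h5.fun_mul h4).fun_mul h6).fun_mul h3

lemma PP_bdd {m : ι → ℝ} (hm : ∀ i, m i = 1 ∨ m i = 2) (ρ : ℝ) :
    ∃ B : ℝ, ∀ z : ℂ, z.re ∈ Icc (-(69/200) : ℝ) 0 → ‖PP m ρ z‖ ≤ B := by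
  obtain ⟨C, A, hC, hMP⟩ := MP_lower hm
  obtain ⟨C1, hC1, hU⟩ := MP_upper hm
  refine ⟨Real.exp |ρ| * 1 * C1 * (Real.exp 1 * C * Real.exp (250 * A ^ 2)), fun z hz => ?_⟩
  have b1 : ‖Complex.exp (ρ * z)‖ ≤ Real.exp |ρ| := by
    rw [Complex.norm_exp, Complex.re_ofReal_mul]
    refine Real.exp_le_exp.2 ((le_abs_self _).trans ?_)
    rw [abs_mul]
    refine mul_le_of_le_one_right (abs_nonneg _) ?_
    rw [abs_le]; constructor <;> linarith [hz.1, hz.2]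
  have b2 : ‖(119/200 + z) / (119/200 - z)‖ ≤ 1 := by
    rw [norm_div, show (119/200 : ℂ) = ((119/200 : ℝ) : ℂ) by push_cast; rfl]
    apply div_le_one_of_le₀ _ (norm_nonneg _)
    apply norm_le_of_re
    · simp
    · rw [re_const_add, re_const_sub]
      rw [abs_of_pos (a := 119/200 - z.re) (by linarith [hz.2]), abs_le]
      constructor <;> linarith [hz.1, hz.2]
  have b3 := hU (((319/200 : ℝ) : ℂ) + z) (by rw [re_const_add]; constructor <;> linarith [hz.1, hz.2])
  have b5 : ‖Complex.exp (z ^ 2 / 1000) * (MP m (((319/200 : ℝ) : ℂ) - z))⁻¹‖ ≤ Real.exp 1 * C * Real.exp (250 * A ^ 2) := by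
    rw [norm_mul, norm_gauss]
    have h1 := hMP (((319/200 : ℝ) : ℂ) - z) (by rw [re_const_sub]; constructor <;> linarith [hz.1, hz.2])
    rw [show (((319/200 : ℝ) : ℂ) - z).im = -z.im by simp, abs_neg] at h1
    have h2 : Real.exp ((z.re ^ 2 - z.im ^ 2) / 1000) ≤ Real.exp 1 * Real.exp (-(z.im ^ 2 / 1000)) := by
      rw [← Real.exp_add]
      gcongr
      nlinarith [hz.1, hz.2]
    have h3 : Real.exp (-(z.im ^ 2 / 1000)) * Real.exp (A * |z.im|) ≤ Real.exp (250 * A ^ 2) := by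
      rw [← Real.exp_add]
      gcongr
      nlinarith [sq_nonneg (|z.im| - 500 * A), sq_abs z.im]
    calc _ ≤ (Real.exp 1 * Real.exp (-(z.im ^ 2 / 1000))) * (C * Real.exp (A * |z.im|)) :=
          mul_le_mul h2 h1 (norm_nonneg _) (by positivity)
      _ = Real.exp 1 * C * (Real.exp (-(z.im ^ 2 / 1000)) * Real.exp (A * |z.im|)) := by ring
      _ ≤ _ := by gcongr
  rw [PP, div_eq_mul_inv (MP m _), mul_comm (MP m _), ← mul_assoc, mul_assoc (_ * _) (Complex.exp _), norm_mul, norm_mul, norm_mul]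
  calc _ ≤ Real.exp |ρ| * 1 * (Real.exp 1 * C * Real.exp (250 * A ^ 2)) * C1 := by gcongr
    _ = _ := by ring

lemma H_bound {m : ι → ℝ} (hm : ∀ i, m i = 1 ∨ m i = 2) {φ : ℝ → ℝ}
    (hIntg : ∀ s : ℂ, 0 < s.re → Integrable fun u : ℝ => (φ u : ℂ) * Complex.exp (s * u))
    (hmel : ∀ s : ℂ, 0 < s.re → ∫ u : ℝ, (φ u : ℂ) * Complex.exp (s * u) = MP m s)
    {ξ n : ℝ} (hn : 0 ≤ n) (hξ : ξ = -(400/119) - 2 * Lam m) :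
    (∫ u : ℝ, (φ (u + n) : ℂ) * mker (om ξ m) u).re ≤ -(Real.exp ((ξ - n) * (319/200)) * (Real.pi / (69/25))) := by
  have es : ∀ (s : ℂ) (u : ℝ), (φ (u + n) : ℂ) * Complex.exp (s * u) =
      Complex.exp (-(s * n)) * ((φ (u + n) : ℂ) * Complex.exp (s * ((u + n : ℝ) : ℂ))) := by
    intro s u
    rw [mul_left_comm, ← Complex.exp_add]; push_cast; congr 2; ring
  have hi : ∀ s : ℂ, 0 < s.re → Integrable fun u : ℝ => (φ (u + n) : ℂ) * Complex.exp (s * u) := by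
    intro s hs
    simp_rw [es s]
    exact ((hIntg s hs).comp_add_right n).const_mul _
  have hv : ∀ s : ℂ, 0 < s.re → ∫ u : ℝ, (φ (u + n) : ℂ) * Complex.exp (s * u) =
      Complex.exp (-(s * n)) * MP m s := by
    intro s hs
    simp_rw [es s]
    rw [integral_const_mul, integral_add_right_eq_self (fun u : ℝ => (φ u : ℂ) * Complex.exp (s * u)), hmel s hs]
  rw [fubini_ker (om_strip ξ hm) (by norm_num) (σ := 5/4) (by norm_num) (ψ := fun u => (φ (u + n) : ℂ))
    (hi _ (by rw [Complex.ofReal_re]; norm_num))]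
  have hy : ∀ y : ℝ, om ξ m (vl (5/4) y) * ∫ u : ℝ, (φ (u + n) : ℂ) * Complex.exp (vl (5/4) y * u) =
      ((-Real.exp ((ξ - n) * (319/200)) : ℝ) : ℂ) * (PP m (ξ - n) (vl (-(69/200)) y) * KK (69/25) (vl (-(69/200)) y)) := by
    intro y
    rw [hv _ (by rw [vl_re]; norm_num)]
    set z := vl (-(69/200)) y with hz
    have e1 : vl (5/4) y = z + ((319/200 : ℝ) : ℂ) := by simp [hz, vl]; ring
    rw [e1]
    unfold om PP
    have a1 : Complex.exp (ξ * (z + ((319/200 : ℝ) : ℂ))) * Complex.exp (-((z + ((319/200 : ℝ) : ℂ)) * n)) =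
        ((Real.exp ((ξ - n) * (319/200)) : ℝ) : ℂ) * Complex.exp ((ξ - n : ℝ) * z) := by
      push_cast
      rw [← Complex.exp_add, ← Complex.exp_add]; congr 1; ring
    have a2 : z + ((319/200 : ℝ) : ℂ) - 1 = 119/200 + z := by push_cast; ring
    have a3 : 219/100 - (z + ((319/200 : ℝ) : ℂ)) = 119/200 - z := by push_cast; ring
    have a4 : z + ((319/200 : ℝ) : ℂ) - 319/200 = z := by push_cast; ring
    have a5 : 319/100 - (z + ((319/200 : ℝ) : ℂ)) = ((319/200 : ℝ) : ℂ) - z := by push_cast; ring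
    rw [a2, a3, a4, a5, add_comm z] at *
    rw [div_eq_mul_inv (MP m _) (MP m _)]
    push_cast at a1 ⊢
    linear_combination ((119 / 200 + z) / (119 / 200 - z) * -KK (69 / 25) z * Complex.exp (z ^ 2 / 1000) *
      (MP m (319/200 - z))⁻¹ * MP m (319/200 + z)) * a1
  simp_rw [hy]
  rw [integral_const_mul, Complex.re_ofReal_mul]
  have hc := contour_ge (c := 69/25) (e := 69/200) (g := 1/2) (ℓ := -n) (by norm_num) (by norm_num) (by norm_num)
    (by linarith) (PP_diff hm (ξ - n)) (PP_bdd hm (ξ - n)) (PP_zero hm _)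
    (by rw [(PP_hasDeriv hm (ξ - n)).deriv]; congr 1; rw [hξ]; ring) (PP_imag (ξ - n))
  rw [neg_mul]
  have := mul_le_mul_of_nonneg_left hc (Real.exp_pos ((ξ - n) * (319/200))).le
  linarith

end HPart

end ModP15

section ModP16
open MeasureTheory Set Filter Topology

noncomputable section DPart

lemma PD_congr {f g : ℝ → ℂ} (hf : PD f) (h : ∀ t, g t = f t) : PD g := by
  have : g = f := funext h
  rwa [this]

lemma MM_ratio_eq {d : ℝ} (hd : 0 < d) (y : ℝ) : MM d (1 - vl (1/2) y) * (MM d (319/100 - vl (1/2) y))⁻¹ =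
    ((Real.exp (219/100 * d / 2 * Real.log (Real.pi * d)) : ℝ) : ℂ) *
    (Complex.Gamma ((d / 4 : ℝ) - (d / 2 : ℝ) * y * Complex.I) /
      Complex.Gamma ((269/100 * d / 2 : ℝ) - (d / 2 : ℝ) * y * Complex.I)) := by
  have hd0 : (d : ℂ) ≠ 0 := by exact_mod_cast hd.ne'
  unfold MM
  have e1 : (1 - vl (1/2) y) * d / 2 = (d / 4 : ℝ) - (d / 2 : ℝ) * y * Complex.I := by
    simp only [vl]; push_cast; ring
  have e2 : (319/100 - vl (1/2) y) * d / 2 = (269/100 * d / 2 : ℝ) - (d / 2 : ℝ) * y * Complex.I := by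
    simp only [vl]; push_cast; ring
  have e3 : Complex.exp (-((1 - vl (1/2) y) * d / 2) * (Real.log (Real.pi * d) : ℝ)) =
      ((Real.exp (219/100 * d / 2 * Real.log (Real.pi * d)) : ℝ) : ℂ) *
        Complex.exp (-((319/100 - vl (1/2) y) * d / 2) * (Real.log (Real.pi * d) : ℝ)) := by
    rw [Complex.ofReal_exp, ← Complex.exp_add]
    congr 1; push_cast; ring
  rw [e3, e1, e2]
  generalize Complex.Gamma ((d / 4 : ℝ) - (d / 2 : ℝ) * y * Complex.I) = G1
  generalize Complex.Gamma ((269/100 * d / 2 : ℝ) - (d / 2 : ℝ) * y * Complex.I) = G2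
  have hE := Complex.exp_ne_zero (-((269/100 * d / 2 : ℝ) - (d / 2 : ℝ) * y * Complex.I) * (Real.log (Real.pi * d) : ℝ))
  generalize Complex.exp (-((269/100 * d / 2 : ℝ) - (d / 2 : ℝ) * y * Complex.I) * (Real.log (Real.pi * d) : ℝ)) = E at *
  generalize (Real.exp (219/100 * d / 2 * Real.log (Real.pi * d))) = R
  have hd2 : ((d / 2 : ℝ) : ℂ) ≠ 0 := by exact_mod_cast (by positivity : d / 2 ≠ 0)
  generalize ((d / 2 : ℝ) : ℂ) = D at *
  rw [mul_inv, mul_inv, div_eq_mul_inv]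
  field_simp

lemma MM_ratio_PD {d : ℝ} (hd : 0 < d) :
    PD fun y : ℝ => MM d (1 - vl (1/2) y) * (MM d (319/100 - vl (1/2) y))⁻¹ :=
  PD_congr ((PD_const (Real.exp_pos (219/100 * d / 2 * Real.log (Real.pi * d))).le).mul
    (PD_beta (p := d / 4) (q := 269/100 * d / 2) (by positivity) (by linarith) (d / 2))) (MM_ratio_eq hd)

lemma MM_ratio_PD' {d : ℝ} (hd : d = 1 ∨ d = 2) :
    PD fun y : ℝ => (1 - vl (1/2) y) * (MM d (1 - vl (1/2) y) * (MM d (319/100 - vl (1/2) y))⁻¹) := by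
  have hd0 : 0 < d := by rcases hd with rfl | rfl <;> norm_num
  refine PD_congr ((PD_const (c := 2 / d * Real.exp (219/100 * d / 2 * Real.log (Real.pi * d))) (by positivity)).mul
    (PD_beta (p := d / 4 + 1) (q := 269/100 * d / 2) (by positivity) (by rcases hd with rfl | rfl <;> norm_num) (d / 2))) ?_
  intro y
  rw [MM_ratio_eq hd0]
  have hne : ((d / 4 : ℝ) : ℂ) - (d / 2 : ℝ) * y * Complex.I ≠ 0 := by
    intro h
    have := congrArg Complex.re h
    simp at this
    linarith
  have h1 := Complex.Gamma_add_one _ hne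
  have hd1 : (d : ℂ) ≠ 0 := by exact_mod_cast hd0.ne'
  have e : ((d / 4 + 1 : ℝ) : ℂ) - (d / 2 : ℝ) * y * Complex.I = ((d / 4 : ℝ) : ℂ) - (d / 2 : ℝ) * y * Complex.I + 1 := by
    push_cast; ring
  rw [e, h1]
  generalize Complex.Gamma ((d / 4 : ℝ) - (d / 2 : ℝ) * y * Complex.I) = G1
  generalize Complex.Gamma ((269/100 * d / 2 : ℝ) - (d / 2 : ℝ) * y * Complex.I) = G2
  generalize (Real.exp (219/100 * d / 2 * Real.log (Real.pi * d))) = R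
  simp only [vl]
  push_cast
  field_simp
  ring

variable {ι : Type*} [Fintype ι]

lemma D_PD {m : ι → ℝ} (hm : ∀ i, m i = 1 ∨ m i = 2) (i0 : ι) (ξ n : ℝ) :
    PD fun y : ℝ => om ξ m (vl (1/2) y) * (Complex.exp ((vl (1/2) y - 1) * n) * MP m (1 - vl (1/2) y)) *
      Complex.exp ((1/1000 : ℝ) * (y : ℂ) ^ 2) := by
  classical
  have hp : ∀ i, 0 < m i := fun i => by rcases hm i with h | h <;> rw [h] <;> norm_num
  have F1 := PD_const (Real.exp_pos (ξ / 2 - n / 2 + (219/200) ^ 2 / 1000)).le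
  have F2 := PD_exp (ξ + n - 219/100/1000)
  have F3 := PD_inv (p := 119/200 + 219/200) (by norm_num) 1
  have F4 := PD_inv (p := 219/200) (by norm_num) 1
  have F5 := PD_inv (p := 69/25 - 219/200) (by norm_num) (-1)
  have F6 := PD_inv (p := 69/25 + 219/200) (by norm_num) 1
  have F7 := PD_const (c := (69/25) ^ 2) (by norm_num)
  have F8 := MM_ratio_PD' (hm i0)
  have F9 := PD.prod (Finset.univ.erase i0) fun i _ => MM_ratio_PD (hp i)
  refine PD_congr ((((((((F1.mul F2).mul F3).mul F4).mul F4).mul F5).mul F6).mul F7).mul (F8.mul F9)) fun y => ?_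
  have e1 : (1 - vl (1/2) y) * (MM (m i0) (1 - vl (1/2) y) * (MM (m i0) (319/100 - vl (1/2) y))⁻¹) *
      ∏ i ∈ Finset.univ.erase i0, MM (m i) (1 - vl (1/2) y) * (MM (m i) (319/100 - vl (1/2) y))⁻¹ =
      (1 - vl (1/2) y) * (MP m (1 - vl (1/2) y) * (MP m (319/100 - vl (1/2) y))⁻¹) := by
    rw [mul_assoc, Finset.mul_prod_erase Finset.univ
      (fun i => MM (m i) (1 - vl (1/2) y) * (MM (m i) (319/100 - vl (1/2) y))⁻¹) (Finset.mem_univ i0),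
      Finset.prod_mul_distrib, Finset.prod_inv_distrib]
    rfl
  rw [e1]
  unfold om KK
  have e2 : Complex.exp (ξ * vl (1/2) y) * Complex.exp ((vl (1/2) y - 319/200) ^ 2 / 1000) *
      Complex.exp ((vl (1/2) y - 1) * n) * Complex.exp ((1/1000 : ℝ) * (y : ℂ) ^ 2) =
      ((Real.exp (ξ / 2 - n / 2 + (219/200) ^ 2 / 1000) : ℝ) : ℂ) *
        Complex.exp (y * (ξ + n - 219/100/1000 : ℝ) * Complex.I) := by
    rw [Complex.ofReal_exp, ← Complex.exp_add, ← Complex.exp_add, ← Complex.exp_add, ← Complex.exp_add]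
    congr 1
    simp only [vl]
    push_cast
    ring_nf
    rw [Complex.I_sq]
    ring
  have e3 : 219/100 - vl (1/2) y = ((119/200 + 219/200 : ℝ) : ℂ) - (1 : ℝ) * y * Complex.I := by
    simp only [vl]; push_cast; ring
  have e4 : (vl (1/2) y - 319/200) ^ 2 = (((219/200 : ℝ) : ℂ) - (1 : ℝ) * y * Complex.I) ^ 2 := by
    simp only [vl]; push_cast; ring
  have e5 : ((69/25 : ℝ) : ℂ) ^ 2 - (((219/200 : ℝ) : ℂ) - (1 : ℝ) * y * Complex.I) ^ 2 =
      (((69/25 - 219/200 : ℝ) : ℂ) - (-1 : ℝ) * y * Complex.I) * (((69/25 + 219/200 : ℝ) : ℂ) - (1 : ℝ) * y * Complex.I) := by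
    push_cast; ring
  rw [← e2, e3, e4, e5]
  generalize ((119/200 + 219/200 : ℝ) : ℂ) - (1 : ℝ) * y * Complex.I = A1
  generalize ((219/200 : ℝ) : ℂ) - (1 : ℝ) * y * Complex.I = A2
  generalize ((69/25 - 219/200 : ℝ) : ℂ) - (-1 : ℝ) * y * Complex.I = A3
  generalize ((69/25 + 219/200 : ℝ) : ℂ) - (1 : ℝ) * y * Complex.I = A4
  simp only [div_eq_mul_inv, mul_inv]
  push_cast
  ring

lemma D_nonneg {m : ι → ℝ} (hm : ∀ i, m i = 1 ∨ m i = 2) (i0 : ι) {φ : ℝ → ℝ}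
    (hIntg : ∀ s : ℂ, 0 < s.re → Integrable fun u : ℝ => (φ u : ℂ) * Complex.exp (s * u))
    (hmel : ∀ s : ℂ, 0 < s.re → ∫ u : ℝ, (φ u : ℂ) * Complex.exp (s * u) = MP m s) (ξ n : ℝ) :
    0 ≤ (∫ u : ℝ, (φ (-u + n) : ℂ) * (mker (om ξ m) u * Complex.exp (-(u : ℂ)))).re := by
  have e0 : ∀ u : ℝ, (φ (-u + n) : ℂ) * (mker (om ξ m) u * Complex.exp (-(u : ℂ))) =
      (φ (n - u) : ℂ) * Complex.exp (-(u : ℂ)) * mker (om ξ m) u := by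
    intro u; rw [neg_add_eq_sub]; ring
  simp_rw [e0]
  have es : ∀ (s : ℂ) (u : ℝ), (φ (n - u) : ℂ) * Complex.exp (-(u : ℂ)) * Complex.exp (s * u) =
      Complex.exp ((s - 1) * n) * ((φ (n - u) : ℂ) * Complex.exp ((1 - s) * ((n - u : ℝ) : ℂ))) := by
    intro s u
    rw [mul_left_comm, ← Complex.exp_add, mul_assoc, ← Complex.exp_add]; push_cast; congr 2; ring
  have hre : ∀ s : ℂ, s.re < 1 → 0 < (1 - s).re := by
    intro s hs; simp only [Complex.sub_re, Complex.one_re]; linarith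
  have hi : ∀ s : ℂ, s.re < 1 → Integrable fun u : ℝ => (φ (n - u) : ℂ) * Complex.exp (-(u : ℂ)) * Complex.exp (s * u) := by
    intro s hs
    simp_rw [es s]
    exact ((hIntg (1 - s) (hre s hs)).comp_sub_left n).const_mul _
  have hv : ∀ s : ℂ, s.re < 1 → ∫ u : ℝ, (φ (n - u) : ℂ) * Complex.exp (-(u : ℂ)) * Complex.exp (s * u) =
      Complex.exp ((s - 1) * n) * MP m (1 - s) := by
    intro s hs
    simp_rw [es s]
    rw [integral_const_mul, integral_sub_left_eq_self (fun u : ℝ => (φ u : ℂ) * Complex.exp ((1 - s) * u)) volume n,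
      hmel _ (hre s hs)]
  rw [fubini_ker (om_strip ξ hm) (by norm_num) (σ := 1/2) (by norm_num)
    (ψ := fun u => (φ (n - u) : ℂ) * Complex.exp (-(u : ℂ)))
    (hi _ (by rw [Complex.ofReal_re]; norm_num))]
  obtain ⟨r, hr, h⟩ := (D_PD hm i0 ξ n).gauss (η := 1/1000) (by norm_num)
  have : ∀ y : ℝ, om ξ m (vl (1/2) y) * ∫ u : ℝ, (φ (n - u) : ℂ) * Complex.exp (-(u : ℂ)) * Complex.exp (vl (1/2) y * u) =
      om ξ m (vl (1/2) y) * (Complex.exp ((vl (1/2) y - 1) * n) * MP m (1 - vl (1/2) y)) *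
      Complex.exp ((1/1000 : ℝ) * (y : ℂ) ^ 2) * Complex.exp (-(1/1000 : ℝ) * (y : ℂ) ^ 2) := by
    intro y
    rw [hv _ (by rw [vl_re]; norm_num), mul_assoc _ (Complex.exp _) (Complex.exp _), ← Complex.exp_add,
      neg_mul, add_neg_cancel, Complex.exp_zero, mul_one]
  simp_rw [this]
  rw [h, Complex.ofReal_re]
  exact hr

end DPart

end ModP16

section ModP17
open MeasureTheory Set Filter Topology

noncomputable section Numerics

lemma psiR_add_one {x : ℝ} (hx : 0 < x) : psiR (x + 1) = psiR x + 1 / x := by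
  have h := Complex.digamma_apply_add_one (x : ℂ) (gamma_ne_aux hx)
  rw [Complex.digamma_def, logDeriv_Gamma_real hx, show (x : ℂ) + 1 = ((x + 1 : ℝ) : ℂ) by push_cast; rfl,
    logDeriv_Gamma_real (by positivity)] at h
  rw [one_div]
  exact_mod_cast h

lemma psiR_add_nat {x : ℝ} (hx : 0 < x) (N : ℕ) : psiR (x + N) = psiR x + ∑ k ∈ Finset.range N, 1 / (x + k) := by
  induction N with
  | zero => simp
  | succ n ih =>
    rw [Finset.sum_range_succ, Nat.cast_succ, ← add_assoc, psiR_add_one (by positivity), ih]; ring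

lemma logGamma_add_one {x : ℝ} (hx : 0 < x) : Real.log (Real.Gamma (x + 1)) = Real.log (Real.Gamma x) + Real.log x := by
  rw [Real.Gamma_add_one hx.ne', Real.log_mul hx.ne' (Real.Gamma_pos_of_pos hx).ne']; ring

lemma psiR_le_log {x : ℝ} (hx : 0 < x) : psiR x ≤ Real.log x := by
  have h3 : HasDerivAt Real.Gamma (deriv Real.Gamma x) x := by
    refine (Real.differentiableAt_Gamma fun k hk => ?_).hasDerivAt
    have h3 : (0:ℝ) ≤ k := k.cast_nonneg
    linarith
  have h4 : HasDerivAt (Real.log ∘ Real.Gamma) (psiR x) x := h3.log (Real.Gamma_pos_of_pos hx).ne'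
  have h5 := Real.convexOn_log_Gamma.le_slope_of_hasDerivAt (x := x) (y := x + 1) hx
    (show (0:ℝ) < x + 1 by positivity) (lt_add_one x) h4
  rw [slope_def_field] at h5
  simp only [Function.comp, logGamma_add_one hx] at h5
  simpa using h5

lemma log_le_half {x : ℝ} (hx : 0 < x) : Real.log (x + 1) - Real.log x ≤ (1 / x + 1 / (x + 1)) / 2 := by
  rw [← Real.log_div (by positivity) hx.ne']
  have ht : 0 < (x + 1) / x := by positivity
  have h0 : 0 ≤ Real.log ((x + 1) / x) := Real.log_nonneg (by rw [le_div_iff₀ hx]; linarith)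
  have := Real.self_le_sinh_iff.2 h0
  rw [Real.sinh_log ht] at this
  refine this.trans (le_of_eq ?_)
  field_simp
  ring

lemma psiR_le {x : ℝ} (hx : 0 < x) : psiR x ≤ Real.log x - 1 / (2 * x) := by
  have step : ∀ k : ℕ, psiR x - Real.log x + 1 / (2 * x) ≤ psiR (x + k) - Real.log (x + k) + 1 / (2 * (x + k)) := by
    intro k
    induction k with
    | zero => simp
    | succ n ih =>
      refine ih.trans ?_
      have hp : 0 < x + n := by positivity
      rw [Nat.cast_succ, ← add_assoc, psiR_add_one hp]
      have h1 := log_le_half hp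
      have e1 : 1 / (2 * (x + n)) = (1 / (x + n)) / 2 := by field_simp
      have e2 : 1 / (2 * (x + n + 1)) = (1 / (x + n + 1)) / 2 := by field_simp
      rw [e1, e2]
      linarith
  have h2 : ∀ k : ℕ, psiR x - Real.log x + 1 / (2 * x) ≤ 1 / (2 * (x + k)) := by
    intro k
    have := psiR_le_log (x := x + k) (by positivity)
    linarith [step k]
  have h3 : Tendsto (fun k : ℕ => 1 / (2 * (x + (k : ℝ)))) atTop (𝓝 0) := by
    apply Tendsto.div_atTop tendsto_const_nhds
    apply Tendsto.const_mul_atTop (by norm_num)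
    exact tendsto_atTop_add_const_left _ _ tendsto_natCast_atTop_atTop
  have := ge_of_tendsto' h3 h2
  linarith

lemma psiR_le_shift {x : ℝ} (hx : 0 < x) (N : ℕ) :
    psiR x ≤ Real.log (x + N) - 1 / (2 * (x + N)) - ∑ k ∈ Finset.range N, 1 / (x + k) := by
  have h1 := psiR_add_nat hx N
  have h2 := psiR_le (x := x + N) (by positivity)
  linarith

lemma log_one_add_ge {x : ℝ} (hx : 0 < x) :
    2 / (2 * x + 1) + 2 / 3 / (2 * x + 1) ^ 3 ≤ Real.log (x + 1) - Real.log x := by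
  rw [← Real.log_div (by positivity) hx.ne', show (x + 1) / x = 1 + x⁻¹ by field_simp]
  have := sum_le_hasSum (Finset.range 2) (fun i _ => by positivity) (Real.hasSum_log_one_add_inv hx)
  refine le_trans (le_of_eq ?_) this
  simp only [Finset.sum_range_succ, Finset.sum_range_zero]
  push_cast
  field_simp
  ring

/-- Stirling defect -/
def gst (x : ℝ) : ℝ := Real.log (Real.Gamma x) - (x - 1/2) * Real.log x + x

lemma gst_step {x : ℝ} (hx : 1 ≤ x) : gst (x + 1) - 1 / (12 * (x + 1) + 1) ≤ gst x - 1 / (12 * x + 1) := by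
  have hx0 : 0 < x := by linarith
  unfold gst
  rw [logGamma_add_one hx0]
  have h1 := log_one_add_ge hx0
  have h2 : (x + 1/2) * (2 / (2 * x + 1) + 2 / 3 / (2 * x + 1) ^ 3) = 1 + 1 / (3 * (2 * x + 1) ^ 2) := by
    field_simp
  have h3 := mul_le_mul_of_nonneg_left h1 (show 0 ≤ x + 1/2 by positivity)
  rw [h2] at h3
  have h4 : 1 / (12 * x + 1) - 1 / (12 * (x + 1) + 1) ≤ 1 / (3 * (2 * x + 1) ^ 2) := by
    rw [div_sub_div _ _ (by positivity) (by positivity), div_le_div_iff₀ (by positivity) (by positivity)]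
    nlinarith
  linarith

lemma gst_ge_aux {x : ℝ} (hx : 0 < x) {N : ℕ} (hN : N ≠ 0) :
    Real.log (2 * Real.pi) / 2 - (1/2 + x) * (1 + x) / N ≤ gst (x + (N + 1 : ℕ)) := by
  have hN0 : (0 : ℝ) < N := by exact_mod_cast Nat.pos_of_ne_zero hN
  have h1 := Real.convexOn_log_Gamma.slope_mono_adjacent (x := (N : ℝ)) (y := N + 1) (z := x + (N + 1 : ℕ)) hN0
    (show (0:ℝ) < x + (N + 1 : ℕ) by positivity) (lt_add_one _) (by push_cast; linarith)
  simp only [Function.comp, logGamma_add_one hN0] at h1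
  rw [show (N : ℝ) + 1 - N = 1 by ring, show x + ((N + 1 : ℕ) : ℝ) - (N + 1) = x by push_cast; ring, div_one,
    add_sub_cancel_left, le_div_iff₀ hx] at h1
  have h2 := Stirling.le_log_factorial_stirling hN
  rw [← Real.Gamma_nat_eq_factorial, logGamma_add_one hN0] at h2
  unfold gst
  have hq : 0 < x + ((N + 1 : ℕ) : ℝ) := by positivity
  have h3 : Real.log (x + (N + 1 : ℕ)) - Real.log N ≤ (1 + x) / N := by
    rw [← Real.log_div hq.ne' hN0.ne']
    refine (Real.log_le_sub_one_of_pos (by positivity)).trans (le_of_eq ?_)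
    push_cast
    field_simp
    ring
  have h4 := mul_le_mul_of_nonneg_left h3 (show 0 ≤ (N : ℝ) + 1/2 + x by positivity)
  have h5 : ((N : ℝ) + 1/2 + x) * ((1 + x) / N) = (1 + x) + (1/2 + x) * (1 + x) / N := by
    field_simp
    ring
  rw [h5] at h4
  push_cast at *
  linarith

lemma gst_ge {x : ℝ} (hx : 1 ≤ x) : Real.log (2 * Real.pi) / 2 + 1 / (12 * x + 1) ≤ gst x := by
  have hx0 : 0 < x := by linarith
  have step : ∀ k : ℕ, gst (x + k) - 1 / (12 * (x + k) + 1) ≤ gst x - 1 / (12 * x + 1) := by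
    intro k
    induction k with
    | zero => simp
    | succ n ih =>
      refine le_trans ?_ ih
      rw [Nat.cast_succ, ← add_assoc]
      exact gst_step (by have : (0:ℝ) ≤ n := n.cast_nonneg
                         linarith)
  have h2 : ∀ N : ℕ, Real.log (2 * Real.pi) / 2 - (1/2 + x) * (1 + x) / ((N + 1 : ℕ) : ℝ) - 1 / (((N + 1 : ℕ) : ℝ)) ≤
      gst x - 1 / (12 * x + 1) := by
    intro N
    have a1 := gst_ge_aux hx0 (N := N + 1) (by omega)
    have a2 := step (N + 1 + 1)
    have a3 : 1 / (12 * (x + ((N + 1 + 1 : ℕ) : ℝ)) + 1) ≤ 1 / (((N + 1 : ℕ) : ℝ)) := by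
      apply one_div_le_one_div_of_le (by positivity)
      push_cast
      have : (0:ℝ) ≤ N := N.cast_nonneg
      linarith
    linarith
  have t1 : ∀ c : ℝ, Tendsto (fun N : ℕ => c / ((N + 1 : ℕ) : ℝ)) atTop (𝓝 0) := fun c =>
    (tendsto_const_div_atTop_nhds_zero_nat c).comp (tendsto_add_atTop_nat 1)
  have t2 := ((tendsto_const_nhds (x := Real.log (2 * Real.pi) / 2)).sub (t1 ((1/2 + x) * (1 + x)))).sub (t1 1)
  have := le_of_tendsto' t2 h2
  linarith

lemma Gamma_add_nat {x : ℝ} (hx : 0 < x) (N : ℕ) :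
    Real.log (Real.Gamma (x + N)) = Real.log (Real.Gamma x) + Real.log (∏ k ∈ Finset.range N, (x + k)) := by
  induction N with
  | zero => simp
  | succ n ih =>
    have h0 : 0 < x + n := by positivity
    have h1 : (∏ k ∈ Finset.range n, (x + k)) ≠ 0 := Finset.prod_ne_zero_iff.2 fun k _ => by positivity
    rw [Finset.prod_range_succ, Nat.cast_succ, ← add_assoc, logGamma_add_one h0, ih,
      Real.log_mul h1 h0.ne']; ring

lemma log_upper {X f : ℝ} (k : ℕ) (hX : 0 < X) (hf : 0 ≤ f)
    (h : X ≤ 2.7182818283 ^ k * ∑ i ∈ Finset.range 8, f ^ i / (i.factorial : ℝ)) : Real.log X ≤ k + f := by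
  rw [Real.log_le_iff_le_exp hX, Real.exp_add, ← Real.exp_one_pow]
  refine h.trans ?_
  have := Real.sum_le_exp_of_nonneg hf 8
  have h9 := Real.exp_one_gt_d9.le
  have h0 : 0 ≤ ∑ i ∈ Finset.range 8, f ^ i / (i.factorial : ℝ) := Finset.sum_nonneg fun i _ => by positivity
  gcongr

lemma log_lower {X f : ℝ} (k : ℕ) (hX : 0 < X) (hf : 0 ≤ f)
    (h : 2.7182818286 ^ k ≤ X * ∑ i ∈ Finset.range 8, f ^ i / (i.factorial : ℝ)) : k - f ≤ Real.log X := by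
  rw [Real.le_log_iff_exp_le hX, Real.exp_sub, ← Real.exp_one_pow, div_le_iff₀ (Real.exp_pos _)]
  have h9 := Real.exp_one_lt_d9.le
  have := Real.sum_le_exp_of_nonneg hf 8
  calc Real.exp 1 ^ k ≤ 2.7182818286 ^ k := by gcongr
    _ ≤ _ := h
    _ ≤ _ := by gcongr

lemma logGamma_ge {x : ℝ} (hx : 1 ≤ x) (N : ℕ) :
    Real.log (2 * Real.pi) / 2 + 1 / (12 * (x + N) + 1) + (x + N - 1/2) * Real.log (x + N) - (x + N) -
      Real.log (∏ k ∈ Finset.range N, (x + k)) ≤ Real.log (Real.Gamma x) := by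
  have h1 := Gamma_add_nat (x := x) (by linarith) N
  have h2 := gst_ge (x := x + N) (by have : (0:ℝ) ≤ N := N.cast_nonneg
                                     linarith)
  unfold gst at h2
  linarith

end Numerics

end ModP17

section ModP18
open MeasureTheory Set Filter Topology

noncomputable section Numerics2

lemma num_log_two_pi : (2 : ℝ) - 0.16214 ≤ Real.log (2 * Real.pi) := by
  have h1 := log_lower (X := 2 * 3.141592) (f := 0.16214) 2 (by norm_num) (by norm_num)
    (by norm_num [Finset.sum_range_succ, Nat.factorial])
  have h2 : Real.log (2 * 3.141592) ≤ Real.log (2 * Real.pi) :=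
    Real.log_le_log (by norm_num) (by linarith [Real.pi_gt_d6])
  push_cast at h1
  linarith

lemma num_real : 0.738 ≤ Real.log (1/2 * Real.Gamma (319/200)) - 319/200 * psiR (319/400) := by
  rw [Real.log_mul (by norm_num) (Real.Gamma_pos_of_pos (by norm_num)).ne', one_div, Real.log_inv]
  have h0 := num_log_two_pi
  have h1 := psiR_le_shift (x := 319/400) (by norm_num) 15
  have h2 := logGamma_ge (x := 319/200) (by norm_num) 5
  have h3 := log_upper (X := 319/400 + 15) (f := 0.75987) 2 (by norm_num) (by norm_num)
    (by norm_num [Finset.sum_range_succ, Nat.factorial])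
  have h4 := log_lower (X := 319/200 + 5) (f := 0.1137) 2 (by norm_num) (by norm_num)
    (by norm_num [Finset.sum_range_succ, Nat.factorial])
  have h5 := log_upper (X := ∏ k ∈ Finset.range 5, (319/200 + (k : ℝ))) (f := 0.94686) 5
    (Finset.prod_pos fun k _ => by positivity) (by norm_num)
    (by norm_num [Finset.sum_range_succ, Finset.prod_range_succ, Nat.factorial])
  have h6 := Real.log_two_lt_d9
  have h7 : ∑ k ∈ Finset.range 15, 1 / (319/400 + (k : ℝ)) = ∑ k ∈ Finset.range 15, 1 / (319/400 + (k : ℝ)) := rfl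
  conv_rhs at h7 => norm_num [Finset.sum_range_succ]
  rw [h7] at h1
  push_cast at h1 h2 h3 h4 h5
  norm_num at h0 h1 h2 h3 h4 h5 h6 ⊢
  linarith

lemma num_complex : 0.482 ≤ Real.log (Real.Gamma (319/100)) - 319/100 * psiR (319/200) := by
  have h0 := num_log_two_pi
  have h1 := psiR_le_shift (x := 319/200) (by norm_num) 15
  have h2 := logGamma_ge (x := 319/100) (by norm_num) 4
  have h3 := log_upper (X := 319/200 + 15) (f := 0.80912) 2 (by norm_num) (by norm_num)
    (by norm_num [Finset.sum_range_succ, Nat.factorial])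
  have h4 := log_lower (X := 319/100 + 4) (f := 0.02732) 2 (by norm_num) (by norm_num)
    (by norm_num [Finset.sum_range_succ, Nat.factorial])
  have h5 := log_upper (X := ∏ k ∈ Finset.range 4, (319/100 + (k : ℝ))) (f := 0.06241) 6
    (Finset.prod_pos fun k _ => by positivity) (by norm_num)
    (by norm_num [Finset.sum_range_succ, Finset.prod_range_succ, Nat.factorial])
  have h7 : ∑ k ∈ Finset.range 15, 1 / (319/200 + (k : ℝ)) = ∑ k ∈ Finset.range 15, 1 / (319/200 + (k : ℝ)) := rfl
  conv_rhs at h7 => norm_num [Finset.sum_range_succ]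
  rw [h7] at h1
  push_cast at h1 h2 h3 h4 h5
  norm_num at h0 h1 h2 h3 h4 h5 ⊢
  linarith

lemma num_const : 0.0031 * Real.exp (400/119 * (319/200) + (319/200) ^ 2 / 1000) ≤
    (219/100) * (319/200) ^ 2 * ((69/25) ^ 2 - (319/200) ^ 2) / (2 * (69/25) ^ 3) := by
  have h1 := log_lower (X := (219/100) * (319/200) ^ 2 * ((69/25) ^ 2 - (319/200) ^ 2) / (2 * (69/25) ^ 3) / 0.0031)
    (f := 0.62081) 6 (by norm_num) (by norm_num)
    (by norm_num [Finset.sum_range_succ, Nat.factorial])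
  have h2 : Real.exp (400/119 * (319/200) + (319/200) ^ 2 / 1000) ≤
      (219/100) * (319/200) ^ 2 * ((69/25) ^ 2 - (319/200) ^ 2) / (2 * (69/25) ^ 3) / 0.0031 := by
    rw [← Real.le_log_iff_exp_le (by norm_num)]
    refine le_trans ?_ h1
    norm_num
  rw [le_div_iff₀ (by norm_num)] at h2
  linarith

lemma num_place {d : ℝ} (hd : d = 1 ∨ d = 2) :
    Real.exp (0.241 * d + 0.497 * (if d = 1 then 1 else 0)) ≤
      d / 2 * Real.Gamma (319/100 * d / 2) * Real.exp (-(319/100 * d / 2 * psiR (319/200 * d / 2))) := by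
  rcases hd with rfl | rfl
  · have h := num_real
    have hp : 0 < 1/2 * Real.Gamma (319/200) := mul_pos (by norm_num) (Real.Gamma_pos_of_pos (by norm_num))
    rw [show (319/100 * 1 / 2 : ℝ) = 319/200 by norm_num, show (319/200 * 1 / 2 : ℝ) = 319/400 by norm_num]
    nth_rewrite 1 [← Real.exp_log hp]
    rw [← Real.exp_add]
    apply Real.exp_le_exp.2
    norm_num at h ⊢
    linarith
  · have h := num_complex
    have hp : 0 < Real.Gamma (319/100) := Real.Gamma_pos_of_pos (by norm_num)
    rw [show (319/100 * 2 / 2 : ℝ) = 319/100 by norm_num, show (319/200 * 2 / 2 : ℝ) = 319/200 by norm_num,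
      show (2 / 2 : ℝ) = 1 by norm_num, one_mul]
    nth_rewrite 1 [← Real.exp_log hp]
    rw [← Real.exp_add]
    apply Real.exp_le_exp.2
    norm_num at h ⊢
    linarith

end Numerics2

end ModP18

section ModP19
open MeasureTheory Set Filter Topology NumberField NumberField.Units

noncomputable section MainIneq

variable {ι : Type*} [Fintype ι]

/-- real value of the Mellin factor -/
def MPr (m : ι → ℝ) (x : ℝ) : ℝ :=
  ∏ i, (m i / 2 * Real.exp (-(x * m i / 2) * Real.log (Real.pi * m i)) * Real.Gamma (x * m i / 2))

lemma MP_ofReal (m : ι → ℝ) (x : ℝ) : MP m (x : ℂ) = (MPr m x : ℂ) := by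
  unfold MP MPr
  rw [Complex.ofReal_prod]
  refine Finset.prod_congr rfl fun i _ => ?_
  unfold MM
  rw [show (x : ℂ) * m i / 2 = ((x * m i / 2 : ℝ) : ℂ) by push_cast; ring, Complex.Gamma_ofReal]
  push_cast
  rfl

lemma om_zero (ξ : ℝ) (m : ι → ℝ) : (om ξ m 0).re =
    (219/100 : ℝ)⁻¹ * ((69/25) ^ 2 / ((319/200) ^ 2 * ((69/25) ^ 2 - (319/200) ^ 2))) *
      Real.exp ((319/200) ^ 2 / 1000) * (MPr m (319/100))⁻¹ := by
  have : om ξ m 0 = (((219/100 : ℝ)⁻¹ * ((69/25) ^ 2 / ((319/200) ^ 2 * ((69/25) ^ 2 - (319/200) ^ 2))) *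
      Real.exp ((319/200) ^ 2 / 1000) * (MPr m (319/100))⁻¹ : ℝ) : ℂ) := by
    unfold om KK
    rw [show (319/100 - 0 : ℂ) = ((319/100 : ℝ) : ℂ) by push_cast; ring, MP_ofReal, mul_zero, Complex.exp_zero]
    push_cast
    rw [show ((0 : ℂ) - 319/200) ^ 2 = (319/200) ^ 2 by ring]
    ring
  rw [this, Complex.ofReal_re]

lemma prod_lower {m : ι → ℝ} (hm : ∀ i, m i = 1 ∨ m i = 2) {ξ : ℝ} (hξ : ξ = -(400/119) - 2 * Lam m) :
    Real.exp (∑ i, (0.241 * m i + 0.497 * (if m i = 1 then 1 else 0))) * Real.exp (-(400/119 * (319/200))) ≤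
      Real.exp (ξ * (319/200)) * MPr m (319/100) := by
  have e : Real.exp (ξ * (319/200)) * MPr m (319/100) = (∏ i, (m i / 2 * Real.Gamma (319/100 * m i / 2) *
      Real.exp (-(319/100 * m i / 2 * psiR (319/200 * m i / 2))))) * Real.exp (-(400/119 * (319/200))) := by
    have e1 : Real.exp (ξ * (319/200)) = (∏ i, Real.exp (-(319/100 * (m i / 2 * (psiR (319/200 * m i / 2) - Real.log (Real.pi * m i)))))) *
        Real.exp (-(400/119 * (319/200))) := by
      rw [← Real.exp_sum, ← Real.exp_add, Finset.sum_neg_distrib, ← Finset.mul_sum]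
      congr 1
      rw [hξ, Lam]; ring
    rw [e1, mul_right_comm, MPr, ← Finset.prod_mul_distrib]
    congr 1
    refine Finset.prod_congr rfl fun i _ => ?_
    have e2 : Real.exp (-(319/100 * m i / 2 * psiR (319/200 * m i / 2))) =
        Real.exp (-(319/100 * (m i / 2 * (psiR (319/200 * m i / 2) - Real.log (Real.pi * m i))))) *
         Real.exp (-(319/100 * m i / 2) * Real.log (Real.pi * m i)) := by
      rw [← Real.exp_add]; congr 1; ring
    rw [e2]; ring
  rw [e, Real.exp_sum]
  gcongr with i
  exact num_place (hm i)

lemma final_arith {R w E A M : ℝ} (hM : 0 < M) (hw : 0 < w) (h1 : A * Real.exp (-(400/119 * (319/200))) ≤ E * M)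
    (hA : 0 < A)
    (h : w * (E * (Real.pi / (69/25))) ≤ R * (2 * Real.pi * ((219/100 : ℝ)⁻¹ * ((69/25) ^ 2 / ((319/200) ^ 2 * ((69/25) ^ 2 - (319/200) ^ 2))) *
      Real.exp ((319/200) ^ 2 / 1000) * M⁻¹))) : 0.0031 * A ≤ R / w := by
  have hc := num_const
  rw [Real.exp_add] at hc
  rw [Real.exp_neg] at h1
  have p1 := Real.exp_pos (400/119 * (319/200))
  have p2 := Real.exp_pos ((319/200) ^ 2 / 1000)
  generalize Real.exp (400/119 * (319/200)) = X at *
  generalize Real.exp ((319/200) ^ 2 / 1000) = Y at *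
  have hpi := Real.pi_pos
  rw [le_div_iff₀ hw]
  have h2 : w * E * M ≤ R * (2 * (69/25) * ((219/100 : ℝ)⁻¹ * ((69/25) ^ 2 / ((319/200) ^ 2 * ((69/25) ^ 2 - (319/200) ^ 2))) * Y)) := by
    have := mul_le_mul_of_nonneg_right h (show 0 ≤ M * (69/25) / Real.pi by positivity)
    refine le_trans (le_of_eq ?_) (this.trans (le_of_eq ?_))
    · field_simp
    · field_simp
  have h3 : A ≤ E * M * X := by
    rw [← div_eq_mul_inv, div_le_iff₀ p1] at h1; exact h1
  set C : ℝ := (219/100) * (319/200) ^ 2 * ((69/25) ^ 2 - (319/200) ^ 2) / (2 * (69/25) ^ 3) with hC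
  have hC0 : 0 < C := by rw [hC]; norm_num
  have h4 : (2 * (69/25) * ((219/100 : ℝ)⁻¹ * ((69/25) ^ 2 / ((319/200) ^ 2 * ((69/25) ^ 2 - (319/200) ^ 2))) * Y)) = C⁻¹ * Y := by
    rw [hC]; field_simp
  rw [h4] at h2
  -- w A ≤ w E M X ≤ R C⁻¹ Y X
  have h5 : w * A ≤ R * (C⁻¹ * Y) * X := by
    calc w * A ≤ w * (E * M * X) := by gcongr
      _ = w * E * M * X := by ring
      _ ≤ _ := by gcongr
  have h6 : 0 < w * A := by positivity
  have hR : 0 < R := by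
    by_contra hneg
    have : R * (C⁻¹ * Y) * X ≤ 0 := by
      rw [mul_assoc]
      exact mul_nonpos_of_nonpos_of_nonneg (not_lt.1 hneg) (by positivity)
    linarith
  calc 0.0031 * A * w = 0.0031 * (w * A) := by ring
    _ ≤ 0.0031 * (R * (C⁻¹ * Y) * X) := by gcongr
    _ = R * C⁻¹ * (0.0031 * (X * Y)) := by ring
    _ ≤ R * C⁻¹ * C := by gcongr
    _ = R := by field_simp

variable (K : Type*) [Field K] [NumberField K]

lemma real_func_eq : ∃ κ : ℝ, 0 < κ ∧ (∀ u, Summable fun q : QX (XO K) => phiR K (u + nQ q)) ∧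
    (∀ u, Summable fun q : QX (XD K) => phiR K (-u + nQ q)) ∧
    ∀ u, Real.exp u * (regulator K + torsionOrder K * ∑' q : QX (XO K), phiR K (u + nQ q)) =
      κ * (regulator K + torsionOrder K * ∑' q : QX (XD K), phiR K (-u + nQ q)) := by
  obtain ⟨κ, hκ, h⟩ := func_eq K
  have hR : 0 < regulator K := regulator_pos K
  have hw : (torsionOrder K : ENNReal) ≠ 0 := by
    exact_mod_cast (torsionOrder_pos K).ne'
  have f1 : ∀ u, ∑' q : QX (XO K), phi K (u + nQ q) ≠ ⊤ := fun u => (h u).2.ne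
  have f2 : ∀ u, ∑' q : QX (XD K), phi K (-u + nQ q) ≠ ⊤ := by
    intro u htop
    have h1 := (h u).1
    rw [htop, ENNReal.mul_top hw, add_top, ENNReal.mul_top (by simpa using hκ)] at h1
    exact (ENNReal.mul_ne_top ENNReal.ofReal_ne_top (ENNReal.add_ne_top.2 ⟨ENNReal.ofReal_ne_top,
      ENNReal.mul_ne_top (ENNReal.natCast_ne_top _) (f1 u)⟩)) h1
  refine ⟨κ, hκ, fun u => ENNReal.summable_toReal (f1 u), fun u => ENNReal.summable_toReal (f2 u), fun u => ?_⟩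
  have h1 := congrArg ENNReal.toReal (h u).1
  rw [ENNReal.toReal_mul, ENNReal.toReal_mul, ENNReal.toReal_add ENNReal.ofReal_ne_top
    (ENNReal.mul_ne_top (ENNReal.natCast_ne_top _) (f1 u)), ENNReal.toReal_add ENNReal.ofReal_ne_top
    (ENNReal.mul_ne_top (ENNReal.natCast_ne_top _) (f2 u)), ENNReal.toReal_mul, ENNReal.toReal_mul,
    ENNReal.toReal_ofReal (Real.exp_pos u).le, ENNReal.toReal_ofReal hκ.le, ENNReal.toReal_ofReal hR.le,
    ENNReal.toReal_natCast, ENNReal.tsum_toReal_eq (fun q => (phi_lt_top K _).ne),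
    ENNReal.tsum_toReal_eq (fun q => (phi_lt_top K _).ne)] at h1
  exact h1

theorem main_bound : 0.0031 * Real.exp (0.241 * (Module.finrank ℚ K : ℝ) +
    0.497 * (InfinitePlace.nrRealPlaces K : ℝ)) ≤ regulator K / (torsionOrder K : ℝ) := by
  classical
  obtain ⟨κ, hκ, hs, hs', heq⟩ := real_func_eq K
  obtain ⟨q0, hq0⟩ := exists_nQ_zero K
  set m : InfinitePlace K → ℝ := fun v => (v.mult : ℝ) with hmdef
  have hm : ∀ v, m v = 1 ∨ m v = 2 := by
    intro v
    simp only [hmdef, InfinitePlace.mult]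
    split_ifs
    · left; norm_num
    · right; norm_num
  obtain ⟨i0⟩ : Nonempty (InfinitePlace K) := inferInstance
  set ξ : ℝ := -(400/119) - 2 * Lam m with hξ
  have hIntg : ∀ s : ℂ, 0 < s.re → Integrable fun u : ℝ => (phiR K u : ℂ) * Complex.exp (s * u) :=
    fun s hs => integrable_phi hs
  have hmel : ∀ s : ℂ, 0 < s.re → ∫ u : ℝ, (phiR K u : ℂ) * Complex.exp (s * u) = MP m s :=
    fun s hs => integral_phi hs
  have hw : (0 : ℝ) < torsionOrder K := by exact_mod_cast torsionOrder_pos K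
  have hR : 0 < regulator K := regulator_pos K
  have hco : ∀ X : Set K, Countable (QX X) := fun X => by unfold QX; infer_instance
  have hc1 := hco (XO K)
  have hc2 := hco (XD K)
  have hmain := abstract_ineq (om_strip ξ hm) hR.le hw.le hκ (φ := phiR K) (n := fun q : QX (XO K) => nQ q)
    (n' := fun q : QX (XD K) => nQ q) (h0 := Real.exp (ξ * (319/200)) * (Real.pi / (69/25)))
    (fun u => ENNReal.toReal_nonneg)
    (fun u v huv => ENNReal.toReal_mono (phi_lt_top K u).ne (phi_anti K huv)) hs hs' heq (om_one ξ m)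
    (fun q => (H_bound hm hIntg hmel (nQ_nonneg K q) hξ).trans (neg_nonpos.2 (by positivity))) q0
    (by
      have := H_bound hm hIntg hmel (nQ_nonneg K q0) hξ
      rw [hq0, sub_zero] at this
      simpa only [hq0] using this)
    (fun q => D_nonneg hm i0 hIntg hmel ξ (nQ q))
  rw [om_zero] at hmain
  have hp : ∀ i, 0 < m i := fun i => by rcases hm i with h | h <;> rw [h] <;> norm_num
  have hM : 0 < MPr m (319/100) := Finset.prod_pos fun i _ => by
    have := hp i
    have := Real.Gamma_pos_of_pos (s := 319/100 * m i / 2) (by positivity)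
    positivity
  have hfin := final_arith hM hw (prod_lower hm hξ) (Real.exp_pos _) hmain
  convert hfin using 3
  rw [Finset.sum_add_distrib, ← Finset.mul_sum, ← Finset.mul_sum]
  congr 2
  · simp only [hmdef]
    rw [← InfinitePlace.sum_mult_eq]; push_cast; rfl
  · rw [Finset.sum_boole]
    unfold InfinitePlace.nrRealPlaces
    rw [Fintype.card_subtype]
    congr 2
    ext v
    simp only [Finset.mem_filter, Finset.mem_univ, true_and, hmdef, InfinitePlace.mult]
    split_ifs with h <;> simp [h]

end MainIneq

end ModP19

open NumberField

/-- Friedman: for a number field `K` of degree `d` with `r₁` real embeddings, regulator `R_K`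
and `w_K` roots of unity, one has `R_K / w_K ≥ 0.0031 · exp(0.241·d + 0.497·r₁)`. -/
theorem regulator_div_torsionOrder_ge (K : Type*) [Field K] [NumberField K] :
    NumberField.Units.regulator K / (NumberField.Units.torsionOrder K : ℝ) ≥
      0.0031 * Real.exp (0.241 * (Module.finrank ℚ K : ℝ) +
        0.497 * (NumberField.InfinitePlace.nrRealPlaces K : ℝ)) := by
  exact main_bound K
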